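/- Let n ≥ 3, k ≥ 1, α ∈ (0,1) and 0 < ν < n−2. For δ > 0 sufficiently small the following holds: if τ ∈ C^{k,α}_{−ν/2−1}(ℝⁿ) with ‖τ‖_{k,α,−ν/2−1} < δ and (φ, W, τ) with φ = 1 + ψ, ψ ∈ C^{k+2,α}_{−ν}(ℝⁿ) of small norm, W ∈ C^{k+1,α}_{−ν/2}(ℝⁿ,ℝⁿ) of small norm, is a solution of the flat-background conformally formulated vacuum constraint system, then the linearization 𝓛 of the system at (φ, W) in the (φ, W) directions, namely 𝓛(ψ', Z) = ( Δψ' + ((−3n+2)/(n−2))·((n−2)/(4(n−1)))|𝒟W|² φ^{(−3n+2)/(n−2)−1} ψ' − ((n+2)/(n−2))·((n−2)/(4n)) τ² φ^{(n+2)/(n−2)−1} ψ' + 2·((n−2)/(4(n−1))) ⟨𝒟W, 𝒟Z⟩ φ^{(−3n+2)/(n−2)} , LZ + ((n−1)/n)·(2n/(n−2)) φ^{2n/(n−2)−1} ψ' ∇τ ), is an isomorphism from C^{k+2,α}_{−ν}(ℝⁿ) × C^{k+1,α}_{−ν/2}(ℝⁿ,ℝⁿ) onto C^{k,α}_{−ν−2}(ℝⁿ)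 × C^{k−1,α}_{−ν/2−2}(ℝⁿ,ℝⁿ). That is, these solutions are nondegenerate. -/

import Mathlib

noncomputable section

open scoped BigOperators
open Filter MeasureTheory

/-- Euclidean space ℝⁿ. -/
abbrev Euc (n : ℕ) := EuclideanSpace ℝ (Fin n)

/-- Partial derivative ∂_j f of a scalar function. -/
def pder (n : ℕ) (f : Euc n → ℝ) (j : Fin n) (x : Euc n) : ℝ :=
  fderiv ℝ f x (EuclideanSpace.single j 1)

/-- The divergence Σ_k ∂_k X_k of a vector field. -/
def divg (n : ℕ) (X : Euc n → Euc n) (x : Euc n) : ℝ :=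
  ∑ k, pder n (fun y => X y k) k x

/-- The flat conformal Killing operator:
`(𝒟X)_{jk} = ½(∂_j X_k + ∂_k X_j) − (1/n)(div X)δ_{jk}`. -/
def confKill (n : ℕ) (X : Euc n → Euc n) (x : Euc n) (j k : Fin n) : ℝ :=
  (1/2) * (pder n (fun y => X y k) j x + pder n (fun y => X y j) k x)
    - (1/(n:ℝ)) * divg n X x * (if j = k then 1 else 0)

/-- The flat vector Laplacian `(LX)_j = −Σ_k ∂_k((𝒟X)_{jk})`. -/
def vLap (n : ℕ) (X : Euc n → Euc n) (x : Euc n) (j : Fin n) : ℝ :=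
  - ∑ k, pder n (fun y => confKill n X y j k) k x

/-- The Euclidean Laplacian Δf = Σ_i ∂_i∂_i f. -/
def lap (n : ℕ) (f : Euc n → ℝ) (x : Euc n) : ℝ :=
  ∑ i, pder n (fun y => pder n f i y) i x

/-- `WBound n k α ν C u` : the weighted Hölder norm of `u` in `C^{k,α}_{−ν}(ℝⁿ)`
is bounded by `C`; i.e. `u` is `C^k`, `(1+|x|)^{ν+|β|}|∂^β u(x)| ≤ C` for `|β| ≤ k`
(expressed via iterated Fréchet derivatives), the weighted Hölder seminorm on dyadic
annuli of the top derivatives is bounded by `C`, and so is the Hölder seminorm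
of the top derivatives on the unit ball. -/
def WBound (n : ℕ) {F : Type*} [NormedAddCommGroup F] [NormedSpace ℝ F]
    (k : ℕ) (α ν C : ℝ) (u : Euc n → F) : Prop :=
  ContDiff ℝ k u
  ∧ (∀ i : ℕ, i ≤ k → ∀ x : Euc n,
      (1 + ‖x‖) ^ (ν + i) * ‖iteratedFDeriv ℝ i u x‖ ≤ C)
  ∧ (∀ R : ℝ, 1 ≤ R → ∀ x y : Euc n,
      R ≤ ‖x‖ → ‖x‖ ≤ 2*R → R ≤ ‖y‖ → ‖y‖ ≤ 2*R → x ≠ y →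
      (1 + R) ^ (ν + k + α) * ‖iteratedFDeriv ℝ k u x - iteratedFDeriv ℝ k u y‖
        ≤ C * ‖x - y‖ ^ α)
  ∧ (∀ x y : Euc n, ‖x‖ ≤ 1 → ‖y‖ ≤ 1 → x ≠ y →
      ‖iteratedFDeriv ℝ k u x - iteratedFDeriv ℝ k u y‖ ≤ C * ‖x - y‖ ^ α)

/-- Membership in the weighted Hölder space `C^{k,α}_{−ν}(ℝⁿ)`. -/
def MemW (n : ℕ) {F : Type*} [NormedAddCommGroup F] [NormedSpace ℝ F]
    (k : ℕ) (α ν : ℝ) (u : Euc n → F) : Prop :=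
  ∃ C : ℝ, WBound n k α ν C u

/-- The flat-background conformally formulated vacuum constraint system on ℝⁿ:
(i) `Δφ + ((n−2)/(4(n−1)))|𝒟W|² φ^{(−3n+2)/(n−2)} − ((n−2)/(4n)) τ² φ^{(n+2)/(n−2)} = 0`
(ii) `LW + ((n−1)/n) φ^{2n/(n−2)} ∇τ = 0`. -/
def VacuumSystem (n : ℕ) (φ : Euc n → ℝ) (W : Euc n → Euc n) (τ : Euc n → ℝ) : Prop :=
  (∀ x : Euc n,
    lap n φ x
      + (((n:ℝ)-2)/(4*((n:ℝ)-1))) * (∑ j, ∑ k, (confKill n W x j k)^2)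
          * (φ x) ^ ((-3*(n:ℝ)+2)/((n:ℝ)-2))
      - (((n:ℝ)-2)/(4*(n:ℝ))) * (τ x)^2 * (φ x) ^ (((n:ℝ)+2)/((n:ℝ)-2)) = 0)
  ∧ (∀ x : Euc n, ∀ j : Fin n,
    vLap n W x j
      + (((n:ℝ)-1)/(n:ℝ)) * (φ x) ^ ((2*(n:ℝ))/((n:ℝ)-2)) * pder n τ j x = 0)

open scoped ContDiff Topology

section Convolution

variable {n : ℕ} {E : Type*} [NormedAddCommGroup E] [NormedSpace ℝ E]

/-- Convolution `∫ K(t) g(x - t) dt` of a scalar kernel with a vector valued function. -/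
def cv (K : Euc n → ℝ) (g : Euc n → E) : Euc n → E :=
  convolution K g (ContinuousLinearMap.lsmul ℝ ℝ) volume

theorem cv_apply (K : Euc n → ℝ) (g : Euc n → E) (x : Euc n) :
    cv K g x = ∫ t, K t • g (x - t) := rfl

theorem integrable_cv {K : Euc n → ℝ} {g : Euc n → E} (hK : Continuous K)
    (hc : HasCompactSupport K) (hg : Continuous g) (x : Euc n) :
    Integrable (fun t => K t • g (x - t)) := by
  refine Continuous.integrable_of_hasCompactSupport (by fun_prop) ?_
  exact hc.smul_right

theorem cv_contDiff {K : Euc n → ℝ} {g : Euc n → E} (hK : ContDiff ℝ ∞ K)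
    (hc : HasCompactSupport K) (hg : Continuous g) : ContDiff ℝ ∞ (cv K g) :=
  hc.contDiff_convolution_left _ hK hg.locallyIntegrable

theorem fderiv_cv_left {K : Euc n → ℝ} {g : Euc n → E} (hK : ContDiff ℝ ∞ K)
    (hc : HasCompactSupport K) (hg : Continuous g) (x v : Euc n) :
    fderiv ℝ (cv K g) x v = cv (fun y => fderiv ℝ K y v) g x := by
  have h := hc.hasFDerivAt_convolution_left (ContinuousLinearMap.lsmul ℝ ℝ)
    (hK.of_le (by exact_mod_cast le_top)) (hg.locallyIntegrable (μ := volume)) x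
  have h2 : fderiv ℝ (cv K g) x = _ := h.fderiv
  rw [h2, convolution_def, ContinuousLinearMap.integral_apply]
  · rfl
  · have hK' : Continuous (fderiv ℝ K) := hK.continuous_fderiv (by simp)
    refine Continuous.integrable_of_hasCompactSupport ?_ ?_
    · fun_prop
    · refine (hc.fderiv ℝ).mono fun y hy => ?_
      rw [Function.mem_support] at hy ⊢
      contrapose! hy
      simp [hy]

theorem cv_congr {K : Euc n → ℝ} {g g' : Euc n → E} {l : ℝ}
    (hl : ∀ y, l < ‖y‖ → K y = 0) {x : Euc n}
    (h : ∀ y ∈ Metric.closedBall x l, g y = g' y) : cv K g x = cv K g' x := by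
  rw [cv_apply, cv_apply]
  congr 1
  ext t
  by_cases ht : ‖t‖ ≤ l
  · rw [h]
    simpa [dist_eq_norm] using ht
  · simp [hl t (not_le.mp ht)]

theorem hasCompactSupport_of_ball {K : Euc n → ℝ} {l : ℝ} (hl : ∀ y, l < ‖y‖ → K y = 0) :
    HasCompactSupport K :=
  HasCompactSupport.intro (isCompact_closedBall (0 : Euc n) l) fun y hy => hl y (by simpa using hy)

theorem hasFDerivAt_cv_right {K : Euc n → ℝ} {g : Euc n → E} {l : ℝ} (hK : Continuous K)
    (hl : ∀ y, l < ‖y‖ → K y = 0) (hg : ContDiff ℝ 1 g) (x : Euc n) :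
    HasFDerivAt (cv K g) (cv K (fderiv ℝ g) x) x := by
  obtain ⟨χ, hχ⟩ : ∃ χ : ContDiffBump x, χ.rIn = |l| + 2 :=
    ⟨⟨|l| + 2, |l| + 3, by positivity, by linarith⟩, rfl⟩
  have hχ1 : ∀ y, dist y x < |l| + 2 → χ y = 1 := fun y hy =>
    χ.one_of_mem_closedBall (by rw [Metric.mem_closedBall, hχ]; exact hy.le)
  have hg' : ContDiff ℝ 1 (fun y => χ y • g y) := χ.contDiff.smul hg
  have hc : HasCompactSupport (fun y => χ y • g y) := χ.hasCompactSupport.smul_right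
  have h := hc.hasFDerivAt_convolution_right (ContinuousLinearMap.lsmul ℝ ℝ)
    (hK.locallyIntegrable (μ := volume)) hg' x
  have h1 : convolution K (fderiv ℝ (fun y => χ y • g y))
      (ContinuousLinearMap.precompR (Euc n) (ContinuousLinearMap.lsmul ℝ ℝ)) volume x
      = cv K (fderiv ℝ (fun y => χ y • g y)) x := by
    rw [cv_apply, convolution_def]
    congr 1
  rw [h1, cv_congr (g' := fderiv ℝ g) hl] at h
  · refine h.congr_of_eventuallyEq ?_
    filter_upwards [Metric.ball_mem_nhds x one_pos] with z hz
    refine cv_congr hl fun y hy => ?_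
    rw [hχ1, one_smul]
    rw [Metric.mem_ball] at hz
    rw [Metric.mem_closedBall] at hy
    linarith [dist_triangle y z x, le_abs_self l]
  · intro y hy
    rw [Metric.mem_closedBall] at hy
    refine Filter.EventuallyEq.fderiv_eq ?_
    filter_upwards [Metric.ball_mem_nhds y one_pos] with z hz
    rw [hχ1, one_smul]
    rw [Metric.mem_ball] at hz
    linarith [dist_triangle z y x, le_abs_self l]

theorem iteratedFDeriv_cv_right {K : Euc n → ℝ} {g : Euc n → E} {l : ℝ} (hK : Continuous K)
    (hl : ∀ y, l < ‖y‖ → K y = 0) (i : ℕ) (hg : ContDiff ℝ i g) :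
    iteratedFDeriv ℝ i (cv K g) = cv K (iteratedFDeriv ℝ i g) := by
  induction i with
  | zero =>
    ext1 x
    rw [iteratedFDeriv_zero_eq_comp, iteratedFDeriv_zero_eq_comp, Function.comp_apply, cv_apply,
      cv_apply, ← LinearIsometryEquiv.coe_toContinuousLinearEquiv,
      ← ContinuousLinearEquiv.integral_comp_comm]
    simp
  | succ i ih =>
    ext1 x
    have hd : ContDiff ℝ 1 (iteratedFDeriv ℝ i g) :=
      hg.iteratedFDeriv_right (by push_cast; rw [add_comm])
    rw [iteratedFDeriv_succ_eq_comp_left, iteratedFDeriv_succ_eq_comp_left, Function.comp_apply,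
      ih (hg.of_le (by exact_mod_cast Nat.le_succ i)), (hasFDerivAt_cv_right hK hl hd x).fderiv,
      cv_apply, cv_apply]
    let I : (Euc n →L[ℝ] (Euc n [×i]→L[ℝ] E)) ≃L[ℝ] (Euc n [×(i + 1)]→L[ℝ] E) :=
      (continuousMultilinearCurryLeftEquiv ℝ (fun _ : Fin (i + 1) =>
        Euc n) E).symm.toContinuousLinearEquiv
    refine (ContinuousLinearEquiv.integral_comp_comm (𝕜 := ℝ)
      (E := Euc n →L[ℝ] (Euc n [×i]→L[ℝ] E)) (F := Euc n [×(i + 1)]→L[ℝ] E) I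
      (fun t => K t • fderiv ℝ (iteratedFDeriv ℝ i g) (x - t))).symm.trans ?_
    congr 1

theorem iteratedFDeriv_succ_apply_dir {w : Euc n → E} (hw : ContDiff ℝ ∞ w) {j : ℕ}
    (v : Fin (j + 1) → Euc n) (y : Euc n) : iteratedFDeriv ℝ (j+1) w y v
      = iteratedFDeriv ℝ j (fun z => fderiv ℝ w z (v (Fin.last j))) y (Fin.init v) := by
  have hw' : ContDiff ℝ ∞ (fderiv ℝ w) := hw.fderiv_right (by simp)
  rw [iteratedFDeriv_succ_apply_right]
  have := (ContinuousLinearMap.apply ℝ E (v (Fin.last j))).iteratedFDeriv_comp_left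
    (x := y) hw'.contDiffAt (i := j) (by exact_mod_cast le_top)
  have e : (fun z => fderiv ℝ w z (v (Fin.last j)))
    = (ContinuousLinearMap.apply ℝ E (v (Fin.last j))) ∘ (fderiv ℝ w) := rfl
  rw [e, this]
  rfl

theorem iteratedFDeriv_cv_left {g : Euc n → E} (hg : Continuous g) (j : ℕ) :
    ∀ {K : Euc n → ℝ} (_ : ContDiff ℝ ∞ K) (_ : HasCompactSupport K)
    (x : Euc n) (v : Fin j → Euc n), iteratedFDeriv ℝ j (cv K g) x v
      = cv (fun y => iteratedFDeriv ℝ j K y v) g x := by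
  induction j with
  | zero => intro K hK hl x v; simp
  | succ j ih =>
    intro K hK hl x v
    have hK' : ContDiff ℝ ∞ (fun y => fderiv ℝ K y (v (Fin.last j))) :=
      (hK.fderiv_right (by simp)).clm_apply contDiff_const
    have hl' : HasCompactSupport (fun y => fderiv ℝ K y (v (Fin.last j))) := hl.fderiv_apply ℝ _
    rw [iteratedFDeriv_succ_apply_dir (cv_contDiff hK hl hg)]
    simp_rw [iteratedFDeriv_succ_apply_dir hK]
    rw [← ih hK' hl']
    congr 2
    ext1 z
    exact fderiv_cv_left hK hl hg z _

theorem norm_cv_le {K : Euc n → ℝ} {g : Euc n → E} {l M : ℝ}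
    (hl : ∀ y, l < ‖y‖ → K y = 0) (hM : ∀ y, |K y| ≤ M) (hg : Continuous g) (x : Euc n) :
    ‖cv K g x‖ ≤ M * ∫ y in Metric.closedBall x l, ‖g y‖ := by
  have e : cv K g x = ∫ t, K (x - t) • g t := by
    rw [cv_apply, ← integral_sub_left_eq_self _ volume x]
    simp
  rw [e, ← integral_const_mul, ← integral_indicator measurableSet_closedBall]
  refine norm_integral_le_of_norm_le ?_ (Eventually.of_forall fun t => ?_)
  · rw [integrable_indicator_iff measurableSet_closedBall]
    exact ContinuousOn.integrableOn_compact (isCompact_closedBall x l) (by fun_prop)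
  · by_cases ht : t ∈ Metric.closedBall x l
    · rw [Set.indicator_of_mem ht, norm_smul]
      exact mul_le_mul_of_nonneg_right (hM _) (norm_nonneg _)
    · rw [Set.indicator_of_notMem ht, hl]
      · simp
      · rw [Metric.mem_closedBall, not_le, dist_comm, dist_eq_norm] at ht
        exact ht

theorem norm_iteratedFDeriv_cv_le {K : Euc n → ℝ} {g : Euc n → E} {l M : ℝ}
    (hK : ContDiff ℝ ∞ K) (hl : ∀ y, l < ‖y‖ → K y = 0) (j : ℕ)
    (hM : ∀ y, ‖iteratedFDeriv ℝ j K y‖ ≤ M) (hg : Continuous g) (x : Euc n) :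
    ‖iteratedFDeriv ℝ j (cv K g) x‖ ≤ M * ∫ y in Metric.closedBall x l, ‖g y‖ := by
  have hM0 : 0 ≤ M := (norm_nonneg _).trans (hM 0)
  have hi : 0 ≤ ∫ y in Metric.closedBall x l, ‖g y‖ := integral_nonneg fun _ => norm_nonneg _
  refine ContinuousMultilinearMap.opNorm_le_bound (mul_nonneg hM0 hi) fun v => ?_
  rw [iteratedFDeriv_cv_left hg j hK (hasCompactSupport_of_ball hl)]
  refine (norm_cv_le (l := l) (M := M * ∏ i, ‖v i‖) ?_ ?_ hg x).trans (le_of_eq (by ring))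
  · intro y hy
    have : iteratedFDeriv ℝ j K y = 0 := by
      have : K =ᶠ[𝓝 y] fun _ => 0 := by
        filter_upwards [(isOpen_lt continuous_const continuous_norm).mem_nhds hy] with z hz
        exact hl z hz
      rw [(this.iteratedFDeriv ℝ j).eq_of_nhds]
      simp
    simp [this]
  · intro y
    refine ((iteratedFDeriv ℝ j K y).le_opNorm v).trans ?_
    exact mul_le_mul_of_nonneg_right (hM y) (by positivity)

theorem norm_iteratedFDeriv_iteratedFDeriv {F : Type*} [NormedAddCommGroup F] [NormedSpace ℝ F]
    (i j : ℕ) (w : F → E) (x : F) :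
    ‖iteratedFDeriv ℝ j (iteratedFDeriv ℝ i w) x‖ = ‖iteratedFDeriv ℝ (i + j) w x‖ := by
  induction i generalizing j with
  | zero =>
    rw [iteratedFDeriv_zero_eq_comp, LinearIsometryEquiv.norm_iteratedFDeriv_comp_left, zero_add]
  | succ i ih =>
    let I : (F →L[ℝ] (F [×i]→L[ℝ] E)) ≃ₗᵢ[ℝ] (F [×(i + 1)]→L[ℝ] E) :=
      (continuousMultilinearCurryLeftEquiv ℝ (fun _ : Fin (i + 1) => F) E).symm
    have h := LinearIsometryEquiv.norm_iteratedFDeriv_comp_left (𝕜 := ℝ)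
      (F := F →L[ℝ] (F [×i]→L[ℝ] E)) (G := F [×(i + 1)]→L[ℝ] E) I
      (fderiv ℝ (iteratedFDeriv ℝ i w)) x j
    have e : iteratedFDeriv ℝ (i + 1) w = I ∘ fderiv ℝ (iteratedFDeriv ℝ i w) :=
      iteratedFDeriv_succ_eq_comp_left
    rw [e, h, norm_iteratedFDeriv_fderiv, ih, add_assoc, add_comm 1 j]

end Convolution

section Kernel

theorem contDiff_rpow_mul_of_zero {h : ℝ → ℝ} (hh : ContDiff ℝ ∞ h)
    (h0 : ∀ s, s < 1/8 → h s = 0) (q : ℝ) : ContDiff ℝ ∞ (fun s : ℝ => s ^ q * h s) := by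
  rw [contDiff_iff_contDiffAt]
  intro s
  rcases lt_or_ge s (1/8) with hs | hs
  · refine (contDiffAt_const (c := (0:ℝ))).congr_of_eventuallyEq ?_
    filter_upwards [Iio_mem_nhds hs] with t ht
    rw [h0 t ht, mul_zero]
  · exact (Real.contDiffAt_rpow_const_of_ne (by linarith)).mul hh.contDiffAt

/-- A smooth monotone transition from `0` on `(-∞, 1/2]` to `1` on `[1, ∞)`. -/
def trans01 (s : ℝ) : ℝ := Real.smoothTransition (2 * s - 1)

theorem trans01_contDiff : ContDiff ℝ ∞ trans01 := by
  unfold trans01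
  exact Real.smoothTransition.contDiff.comp (by fun_prop)

theorem trans01_zero {s : ℝ} (hs : s ≤ 1/2) : trans01 s = 0 :=
  Real.smoothTransition.zero_of_nonpos (by linarith)

theorem trans01_one {s : ℝ} (hs : 1 ≤ s) : trans01 s = 1 :=
  Real.smoothTransition.one_of_one_le (by linarith)

theorem deriv_trans01_contDiff : ContDiff ℝ ∞ (deriv trans01) :=
  (contDiff_infty_iff_deriv.mp trans01_contDiff).2

theorem deriv_trans01_zero {s : ℝ} (hs : s < 1/2) : deriv trans01 s = 0 := by
  have : trans01 =ᶠ[𝓝 s] fun _ => 0 := by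
    filter_upwards [Iio_mem_nhds hs] with t ht using trans01_zero (le_of_lt ht)
  rw [this.deriv_eq]; simp

theorem deriv_trans01_zero' {s : ℝ} (hs : 1 < s) : deriv trans01 s = 0 := by
  have : trans01 =ᶠ[𝓝 s] fun _ => 1 := by
    filter_upwards [Ioi_mem_nhds hs] with t ht using trans01_one (le_of_lt ht)
  rw [this.deriv_eq]; simp

theorem trans01_mono : Monotone trans01 := by
  intro a b h
  exact Real.smoothTransition.monotone (by linarith)

/-- Derivative of the radial profile of the kernel. -/
def kerD (n : ℕ) (s : ℝ) : ℝ := s ^ (-(n/2:ℝ)) * ((trans01 (4 * s) - trans01 s) / 4)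

/-- Radial profile of the averaging kernel. -/
def kerS (n : ℕ) (s : ℝ) : ℝ := s ^ (1 - (n/2:ℝ)) * deriv trans01 s

theorem kerD_contDiff (n : ℕ) : ContDiff ℝ ∞ (kerD n) := by
  refine contDiff_rpow_mul_of_zero ?_ ?_ _
  · exact ((trans01_contDiff.comp (contDiff_const.mul contDiff_id)).sub trans01_contDiff).div_const _
  · intro s hs
    rw [trans01_zero, trans01_zero] <;> linarith

theorem kerS_contDiff (n : ℕ) : ContDiff ℝ ∞ (kerS n) := by
  refine contDiff_rpow_mul_of_zero deriv_trans01_contDiff ?_ _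
  intro s hs
  exact deriv_trans01_zero (by linarith)

theorem kerD_ode (n : ℕ) {s : ℝ} (hs : 0 ≤ s) :
    4 * s * deriv (kerD n) s + 2 * n * kerD n s = 2 ^ n * kerS n (4 * s) - kerS n s := by
  rcases hs.eq_or_lt with rfl | hs
  · simp [kerD, kerS, deriv_trans01_zero]
  · have hA : Differentiable ℝ trans01 := trans01_contDiff.differentiable (by simp)
    have h1 : HasDerivAt (fun s => trans01 (4 * s)) (deriv trans01 (4 * s) * 4) s := by
      have := (hA (4 * s)).hasDerivAt.comp s ((hasDerivAt_id s).const_mul 4)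
      rw [mul_one] at this
      exact this
    have h2 := ((h1.sub (hA s).hasDerivAt).div_const 4)
    have h3 := (Real.hasDerivAt_rpow_const (x := s) (p := -(n/2:ℝ)) (Or.inl hs.ne')).mul h2
    have h4 : deriv (kerD n) s = _ := h3.deriv
    rw [h4]
    simp only [kerD, kerS, Pi.sub_apply]
    have e1 : s ^ (-(n/2:ℝ) - 1) = s ^ (-(n/2:ℝ)) / s := by
      rw [Real.rpow_sub hs, Real.rpow_one]
    have e2 : s ^ (1 - (n/2:ℝ)) = s ^ (-(n/2:ℝ)) * s := by
      rw [sub_eq_add_neg, Real.rpow_add hs, Real.rpow_one]; ring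
    have e3 : (4 * s) ^ (1 - (n/2:ℝ)) * 2 ^ n = 4 * (s ^ (-(n/2:ℝ)) * s) := by
      rw [Real.mul_rpow (by norm_num) hs.le, e2]
      have : (4:ℝ) ^ (1 - (n/2:ℝ)) = 4 / 2 ^ n := by
        rw [Real.rpow_sub (by norm_num), Real.rpow_one]
        congr 1
        rw [show (4:ℝ) = 2 ^ (2:ℝ) by norm_num, ← Real.rpow_mul (by norm_num)]
        rw [show (2:ℝ) * (n/2) = n by ring, Real.rpow_natCast]
      rw [this]
      field_simp
    rw [e1, e2]
    have e4 : 2 ^ n * ((4 * s) ^ (1 - (n/2:ℝ)) * deriv trans01 (4 * s))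
      = 4 * (s ^ (-(n/2:ℝ)) * s) * deriv trans01 (4 * s) := by rw [← e3]; ring
    rw [e4]
    field_simp
    ring

/-- Radial profile whose Laplacian is a difference of averaging kernels. -/
def kerP (n : ℕ) (s : ℝ) : ℝ := ∫ t in (1:ℝ)..s, kerD n t

theorem kerP_hasDerivAt (n : ℕ) (s : ℝ) : HasDerivAt (kerP n) (kerD n s) s :=
  intervalIntegral.integral_hasDerivAt_right
    ((kerD_contDiff n).continuous.intervalIntegrable _ _)
    ((kerD_contDiff n).continuous.stronglyMeasurableAtFilter _ _)
    (kerD_contDiff n).continuous.continuousAt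

theorem kerP_contDiff (n : ℕ) : ContDiff ℝ ∞ (kerP n) := by
  rw [contDiff_infty_iff_deriv]
  refine ⟨fun s => (kerP_hasDerivAt n s).differentiableAt, ?_⟩
  rw [show deriv (kerP n) = kerD n from funext fun s => (kerP_hasDerivAt n s).deriv]
  exact kerD_contDiff n

theorem kerP_zero (n : ℕ) {s : ℝ} (hs : 1 ≤ s) : kerP n s = 0 := by
  unfold kerP
  rw [intervalIntegral.integral_congr (g := fun _ => 0)]
  · simp
  · intro t ht
    rw [Set.uIcc_of_le hs] at ht
    have : 1 ≤ t := ht.1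
    simp only [kerD]
    rw [trans01_one this, trans01_one (by linarith)]
    simp

theorem hasFDerivAt_comp_norm_sq {n : ℕ} {P : ℝ → ℝ} {P' : ℝ} {x : Euc n}
    (h : HasDerivAt P P' (‖x‖ ^ 2)) (j : Fin n) :
    pder n (fun y => P (‖y‖ ^ 2)) j x = P' * (2 * x j) := by
  have h1 : HasFDerivAt (fun y : Euc n => ‖y‖ ^ 2) (2 • innerSL ℝ x) x :=
    (hasStrictFDerivAt_norm_sq x).hasFDerivAt
  have h2 := h.comp_hasFDerivAt x h1
  have h3 : fderiv ℝ (fun y : Euc n => P (‖y‖ ^ 2)) x = _ := h2.fderiv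
  rw [pder, h3]
  simp [EuclideanSpace.inner_single_right]

theorem pder_coord {n : ℕ} (j : Fin n) (x : Euc n) : pder n (fun y => y j) j x = 1 := by
  have h : HasFDerivAt (fun y : Euc n => y j) (EuclideanSpace.proj j : Euc n →L[ℝ] ℝ) x :=
    (EuclideanSpace.proj j : Euc n →L[ℝ] ℝ).hasFDerivAt
  rw [pder, h.fderiv]
  simp

theorem pder_mul {n : ℕ} {f g : Euc n → ℝ} {x : Euc n} (hf : DifferentiableAt ℝ f x)
    (hg : DifferentiableAt ℝ g x) (j : Fin n) :
    pder n (fun y => f y * g y) j x = f x * pder n g j x + g x * pder n f j x := by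
  rw [pder, fderiv_fun_mul hf hg]
  simp [pder]

theorem lap_radial {n : ℕ} {P p : ℝ → ℝ} (hP : ∀ s, HasDerivAt P (p s) s)
    (hp : Differentiable ℝ p) (x : Euc n) :
    lap n (fun y => P (‖y‖ ^ 2)) x
      = 4 * ‖x‖ ^ 2 * deriv p (‖x‖ ^ 2) + 2 * n * p (‖x‖ ^ 2) := by
  have hsq : Differentiable ℝ (fun y : Euc n => ‖y‖ ^ 2) := differentiable_id.norm_sq ℝ
  have h : ∀ i : Fin n, pder n (fun y => pder n (fun y => P (‖y‖ ^ 2)) i y) i x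
      = 4 * deriv p (‖x‖ ^ 2) * (x i) ^ 2 + 2 * p (‖x‖ ^ 2) := by
    intro i
    have e : (fun y : Euc n => pder n (fun y => P (‖y‖ ^ 2)) i y)
        = fun y => p (‖y‖ ^ 2) * (2 * y i) := funext fun y => hasFDerivAt_comp_norm_sq (hP _) i
    rw [e]
    have hd : DifferentiableAt ℝ (fun y : Euc n => y i) x :=
      (EuclideanSpace.proj i : Euc n →L[ℝ] ℝ).differentiableAt
    have hd2 : DifferentiableAt ℝ (fun y : Euc n => p (‖y‖ ^ 2)) x :=
      (hp _).comp x hsq.differentiableAt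
    rw [pder_mul hd2 (hd.const_mul 2),
      hasFDerivAt_comp_norm_sq (hp _).hasDerivAt,
      pder_mul (differentiableAt_const (2:ℝ)) hd, pder_coord]
    have : pder n (fun _ : Euc n => (2:ℝ)) i x = 0 := by simp [pder]
    rw [this]
    ring
  rw [lap, Finset.sum_congr rfl fun i _ => h i, Finset.sum_add_distrib, ← Finset.mul_sum,
    EuclideanSpace.norm_sq_eq]
  simp
  ring

/-- A smooth kernel supported in the unit ball whose Laplacian is the difference of two
dilates of a smooth averaging kernel. -/
theorem exists_dyadic_kernel (n : ℕ) (hn : 1 ≤ n) : ∃ κ σ : Euc n → ℝ,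
    ContDiff ℝ ∞ κ ∧ ContDiff ℝ ∞ σ ∧ (∀ y, 1 < ‖y‖ → κ y = 0) ∧ (∀ y, 1 < ‖y‖ → σ y = 0) ∧
    ∫ y, σ y = 1 ∧ ∀ x, lap n κ x = 2 ^ n * σ ((2:ℝ) • x) - σ x := by
  have hsq : ContDiff ℝ ∞ (fun y : Euc n => ‖y‖ ^ 2) := contDiff_norm_sq ℝ
  have hκ0 : ContDiff ℝ ∞ (fun y : Euc n => kerP n (‖y‖ ^ 2)) := (kerP_contDiff n).comp hsq
  have hσ0 : ContDiff ℝ ∞ (fun y : Euc n => kerS n (‖y‖ ^ 2)) := (kerS_contDiff n).comp hsq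
  have hσz : ∀ y : Euc n, 1 < ‖y‖ → kerS n (‖y‖ ^ 2) = 0 := by
    intro y hy
    rw [kerS, deriv_trans01_zero' (by nlinarith), mul_zero]
  have hpos : 0 < ∫ y : Euc n, kerS n (‖y‖ ^ 2) := by
    obtain ⟨s, hs, hs'⟩ := exists_deriv_eq_slope trans01 (show (1/2:ℝ) < 1 by norm_num)
      trans01_contDiff.continuous.continuousOn
      (trans01_contDiff.differentiable (by simp)).differentiableOn
    rw [trans01_one le_rfl, trans01_zero le_rfl] at hs'
    have hs0 : 0 < s := by linarith [hs.1]
    refine Continuous.integral_pos_of_hasCompactSupport_nonneg_nonzero hσ0.continuous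
      (hasCompactSupport_of_ball hσz) (fun y => ?_)
      (x := EuclideanSpace.single ⟨0, hn⟩ (Real.sqrt s)) ?_
    · exact mul_nonneg (Real.rpow_nonneg (by positivity) _) trans01_mono.deriv_nonneg
    · simp only [PiLp.norm_single, Real.norm_eq_abs, sq_abs]
      rw [Real.sq_sqrt hs0.le, kerS, hs']
      have := Real.rpow_pos_of_pos hs0 (1 - (n/2:ℝ))
      norm_num
      exact this.ne'
  set c := ∫ y : Euc n, kerS n (‖y‖ ^ 2) with hc
  refine ⟨fun y => c⁻¹ * kerP n (‖y‖ ^ 2), fun y => c⁻¹ * kerS n (‖y‖ ^ 2),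
    contDiff_const.mul hκ0, contDiff_const.mul hσ0, fun y hy => ?_, fun y hy => ?_, ?_, ?_⟩
  · simp only
    rw [kerP_zero n (by nlinarith), mul_zero]
  · simp only
    rw [hσz y hy, mul_zero]
  · rw [integral_const_mul, ← hc, inv_mul_cancel₀ hpos.ne']
  · intro x
    have := lap_radial (n := n) (P := fun s => c⁻¹ * kerP n s) (p := fun s => c⁻¹ * kerD n s)
      (fun s => (kerP_hasDerivAt n s).const_mul _)
      (((kerD_contDiff n).differentiable (by simp)).const_mul _) x
    rw [this, deriv_const_mul _ ((kerD_contDiff n).differentiable (by simp) _)]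
    have h2 := kerD_ode n (s := ‖x‖ ^ 2) (by positivity)
    have h3 : ‖(2:ℝ) • x‖ ^ 2 = 4 * ‖x‖ ^ 2 := by rw [norm_smul]; norm_num; ring
    simp only [h3]
    linear_combination c⁻¹ * h2

end Kernel

section DyadicSums

theorem two_zpow_rpow_natCast (j : ℕ) (a : ℝ) : ((2:ℝ) ^ (j:ℤ)) ^ a = ((2:ℝ) ^ a) ^ j := by
  rw [zpow_natCast, ← Real.rpow_natCast, ← Real.rpow_mul (by norm_num), mul_comm,
    Real.rpow_mul (by norm_num), Real.rpow_natCast]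

theorem summable_two_zpow {a b : ℝ} (ha : 0 < a) (hb : 0 < b) :
    Summable (fun m : ℤ => min (((2:ℝ) ^ m) ^ a) (((2:ℝ) ^ m) ^ (-b))) := by
  have hnn : ∀ m : ℤ, 0 ≤ min (((2:ℝ) ^ m) ^ a) (((2:ℝ) ^ m) ^ (-b)) := fun m => by positivity
  have h1 : ∀ c : ℝ, 0 < c → Summable (fun j : ℕ => ((2:ℝ) ^ (-c)) ^ j) := fun c hc =>
    summable_geometric_of_lt_one (by positivity)
      (Real.rpow_lt_one_of_one_lt_of_neg (by norm_num) (by linarith))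
  refine Summable.of_nat_of_neg ?_ ?_
  · refine Summable.of_nonneg_of_le (fun j => hnn _) (fun j => ?_) (h1 b hb)
    refine (min_le_right _ _).trans (le_of_eq ?_)
    exact two_zpow_rpow_natCast j (-b)
  · refine Summable.of_nonneg_of_le (fun j => hnn _) (fun j => ?_) (h1 a ha)
    refine (min_le_left _ _).trans (le_of_eq ?_)
    rw [zpow_neg, Real.inv_rpow (by positivity), ← Real.rpow_neg (by positivity)]
    exact two_zpow_rpow_natCast j (-a)

/-- Two-sided dyadic sums are bounded uniformly in the reference scale. -/
theorem exists_dyadic_sum_bound {a b : ℝ} (ha : 0 < a) (hb : 0 < b) : ∃ C : ℝ, 0 < C ∧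
    ∀ r : ℝ, 0 < r →
      Summable (fun m : ℤ => min (((2:ℝ) ^ m / r) ^ a) (((2:ℝ) ^ m / r) ^ (-b))) ∧
      ∑' m : ℤ, min (((2:ℝ) ^ m / r) ^ a) (((2:ℝ) ^ m / r) ^ (-b)) ≤ C := by
  set g : ℤ → ℝ := fun m => min (((2:ℝ) ^ m) ^ a) (((2:ℝ) ^ m) ^ (-b)) with hg
  have hs : Summable g := summable_two_zpow ha hb
  have hg0 : ∀ m, 0 ≤ g m := fun m => by positivity
  refine ⟨2 ^ b * (∑' m, g m) + 1, by positivity, fun r hr => ?_⟩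
  obtain ⟨N, hN1, hN2⟩ := exists_mem_Ico_zpow hr (show (1:ℝ) < 2 by norm_num)
  have hle : ∀ m : ℤ, min (((2:ℝ) ^ m / r) ^ a) (((2:ℝ) ^ m / r) ^ (-b)) ≤ 2 ^ b * g (m - N) := by
    intro m
    have h2b : (1:ℝ) ≤ 2 ^ b := Real.one_le_rpow (by norm_num) hb.le
    have hp : (0:ℝ) < 2 ^ N := by positivity
    have e1 : (2:ℝ) ^ (m - N) = 2 ^ m / 2 ^ N := zpow_sub₀ (by norm_num) _ _
    have hup : (2:ℝ) ^ m / r ≤ 2 ^ (m - N) := by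
      rw [e1]; gcongr
    have hlo : (2:ℝ) ^ (m - N) / 2 ≤ 2 ^ m / r := by
      rw [e1, div_div]
      have : (2:ℝ) ^ N * 2 = 2 ^ (N + 1) := by rw [zpow_add₀ (by norm_num), zpow_one]
      rw [this]
      gcongr
    rw [hg, mul_min_of_nonneg _ _ (by positivity)]
    refine min_le_min ?_ ?_
    · calc ((2:ℝ) ^ m / r) ^ a ≤ ((2:ℝ) ^ (m - N)) ^ a := by gcongr
        _ ≤ 2 ^ b * ((2:ℝ) ^ (m - N)) ^ a := le_mul_of_one_le_left (by positivity) h2b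
    · calc ((2:ℝ) ^ m / r) ^ (-b) ≤ ((2:ℝ) ^ (m - N) / 2) ^ (-b) :=
          Real.rpow_le_rpow_of_nonpos (by positivity) hlo (by linarith)
        _ = 2 ^ b * ((2:ℝ) ^ (m - N)) ^ (-b) := by
          rw [Real.div_rpow (by positivity) (by norm_num), Real.rpow_neg (by norm_num : (0:ℝ) ≤ 2)]
          field_simp
  have hs' : Summable (fun m => 2 ^ b * g (m - N)) :=
    (((Equiv.subRight N).summable_iff (f := g)).mpr hs).mul_left _
  have hs2 : Summable (fun m : ℤ => min (((2:ℝ) ^ m / r) ^ a) (((2:ℝ) ^ m / r) ^ (-b))) :=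
    Summable.of_nonneg_of_le (fun m => by positivity) hle hs'
  refine ⟨hs2, (hs2.tsum_le_tsum hle hs').trans ?_⟩
  have h3 : ∑' m, g (m - N) = ∑' m, g m := (Equiv.subRight N).tsum_eq g
  rw [tsum_mul_left, h3]
  linarith

end DyadicSums

section BallIntegral

/-- The integral of `(1 + |y|)^{-s}` over a ball of radius `R` centred at the origin is
`O(R^{n-s})` as long as `s < n`. -/
theorem exists_integral_ball_le (n : ℕ) (hn : 1 ≤ n) {s : ℝ} (hs0 : 0 ≤ s) (hs : s < n) :
    ∃ C : ℝ, 0 < C ∧ ∀ R : ℝ, 0 < R →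
      ∫ y in Metric.closedBall (0 : Euc n) R, (1 + ‖y‖) ^ (-s) ≤ C * R ^ ((n:ℝ) - s) := by
  have hfr : Module.finrank ℝ (Euc n) = n := by simp
  have : Nonempty (Fin n) := ⟨⟨0, hn⟩⟩
  have hli : LocallyIntegrable (fun y : Euc n => ‖y‖ ^ (-s)) volume := by
    refine locallyIntegrable_of_norm_le_rpow (C := 1) (α := s) (by rw [hfr]; exact hn)
      (by rw [hfr]; exact hs) (Eventually.of_forall fun y => ?_) ?_
    · rw [one_mul, Real.norm_of_nonneg (by positivity)]
    · exact (measurable_norm.pow_const _).aestronglyMeasurable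
  set A := ∫ y in Metric.closedBall (0 : Euc n) 1, ‖y‖ ^ (-s) with hA
  have hA0 : 0 ≤ A := setIntegral_nonneg measurableSet_closedBall fun y _ => by positivity
  refine ⟨A + 1, by positivity, fun R hR => ?_⟩
  have h1 : ∫ y in Metric.closedBall (0 : Euc n) R, ‖y‖ ^ (-s) = R ^ ((n:ℝ) - s) * A := by
    have h := Measure.setIntegral_comp_smul_of_pos volume (fun y : Euc n => ‖y‖ ^ (-s))
      (Metric.closedBall (0 : Euc n) 1) hR
    rw [smul_unitClosedBall_of_nonneg hR.le, hfr] at h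
    have e : ∀ y : Euc n, ‖R • y‖ ^ (-s) = R ^ (-s) * ‖y‖ ^ (-s) := fun y => by
      rw [norm_smul, Real.norm_of_nonneg hR.le, Real.mul_rpow hR.le (norm_nonneg _)]
    simp only [e] at h
    rw [integral_const_mul, ← hA, smul_eq_mul] at h
    have hRn : (R ^ n : ℝ) ≠ 0 := by positivity
    rw [sub_eq_add_neg, Real.rpow_add hR, Real.rpow_natCast, mul_assoc, h]
    field_simp
  calc ∫ y in Metric.closedBall (0 : Euc n) R, (1 + ‖y‖) ^ (-s)
      ≤ ∫ y in Metric.closedBall (0 : Euc n) R, ‖y‖ ^ (-s) := by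
        refine integral_mono_ae ?_ (hli.integrableOn_isCompact (isCompact_closedBall _ _)) ?_
        · refine ContinuousOn.integrableOn_compact (isCompact_closedBall _ _) ?_
          refine ContinuousOn.rpow_const (by fun_prop) fun y _ => Or.inl ?_
          positivity
        · refine ae_restrict_of_ae ?_
          have : ∀ᵐ y : Euc n, y ≠ 0 := by
            have : Nontrivial (Euc n) := inferInstance
            exact Measure.ae_ne volume 0
          filter_upwards [this] with y hy
          exact Real.rpow_le_rpow_of_nonpos (norm_pos_iff.mpr hy) (by linarith) (by linarith)
    _ = R ^ ((n:ℝ) - s) * A := h1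
    _ ≤ (A + 1) * R ^ ((n:ℝ) - s) := by
        rw [mul_comm]; gcongr; linarith

end BallIntegral

section HolderClass

variable {n : ℕ} {E : Type*} [NormedAddCommGroup E] [NormedSpace ℝ E]

theorem rpow_le_of_comparable {r s : ℝ} (hr : 0 < r) (h1 : r ≤ 2 * s) (h2 : s ≤ 2 * r) (p : ℝ) :
    s ^ p ≤ 2 ^ |p| * r ^ p := by
  have hs : 0 < s := by linarith
  rcases le_total 0 p with hp | hp
  · rw [abs_of_nonneg hp, ← Real.mul_rpow (by norm_num) hr.le]
    gcongr
  · rw [abs_of_nonpos hp, Real.rpow_neg (by norm_num), ← Real.inv_rpow (by norm_num),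
      ← Real.mul_rpow (by norm_num) hr.le]
    exact Real.rpow_le_rpow_of_nonpos (by positivity) (by linarith) hp

theorem one_add_norm_comparable {x y : Euc n} (h : ‖x - y‖ ≤ (1 + ‖x‖) / 4) :
    1 + ‖x‖ ≤ 2 * (1 + ‖y‖) ∧ 1 + ‖y‖ ≤ 2 * (1 + ‖x‖) := by
  have h1 := norm_le_norm_add_norm_sub' x y
  have h2 := norm_le_norm_add_norm_sub x y
  have := norm_nonneg x
  have := norm_nonneg y
  constructor <;> linarith

/-- A weighted Hölder condition equivalent to `WBound`, in which differences are only
compared for points close to each other relative to their distance to the origin. -/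
def HB (n : ℕ) {F : Type*} [NormedAddCommGroup F] [NormedSpace ℝ F]
    (k : ℕ) (α μ C : ℝ) (u : Euc n → F) : Prop :=
  ContDiff ℝ k u
  ∧ (∀ i : ℕ, i ≤ k → ∀ x : Euc n, ‖iteratedFDeriv ℝ i u x‖ ≤ C * (1 + ‖x‖) ^ (-(μ + i)))
  ∧ (∀ i : ℕ, i ≤ k → ∀ x y : Euc n, ‖x - y‖ ≤ (1 + ‖x‖) / 4 →
      ‖iteratedFDeriv ℝ i u x - iteratedFDeriv ℝ i u y‖
        ≤ C * (1 + ‖x‖) ^ (-(μ + i + α)) * ‖x - y‖ ^ α)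

theorem HB.nonneg {k : ℕ} {α μ C : ℝ} {u : Euc n → E} (h : HB n k α μ C u) : 0 ≤ C := by
  have := (norm_nonneg _).trans (h.2.1 0 (Nat.zero_le _) 0)
  simpa using this

theorem HB.mono {k : ℕ} {α μ C C' : ℝ} {u : Euc n → E} (h : HB n k α μ C u) (hC : C ≤ C') :
    HB n k α μ C' u := by
  refine ⟨h.1, fun i hi x => (h.2.1 i hi x).trans ?_, fun i hi x y hxy =>
    (h.2.2 i hi x y hxy).trans ?_⟩ <;> gcongr

theorem HB.mono_weight {k : ℕ} {α μ μ' C : ℝ} {u : Euc n → E} (h : HB n k α μ C u)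
    (hμ : μ' ≤ μ) : HB n k α μ' C u := by
  have hC := h.nonneg
  have h1 : ∀ x : Euc n, 1 ≤ 1 + ‖x‖ := fun x => by linarith [norm_nonneg x]
  refine ⟨h.1, fun i hi x => (h.2.1 i hi x).trans ?_, fun i hi x y hxy =>
    (h.2.2 i hi x y hxy).trans ?_⟩
  · gcongr
    exact h1 x
  · gcongr
    exact h1 x

theorem HB.mono_order {k k' : ℕ} {α μ C : ℝ} {u : Euc n → E} (h : HB n k α μ C u)
    (hk : k' ≤ k) : HB n k' α μ C u :=
  ⟨h.1.of_le (by exact_mod_cast hk), fun i hi x => h.2.1 i (hi.trans hk) x,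
    fun i hi x y hxy => h.2.2 i (hi.trans hk) x y hxy⟩

theorem HB.add {k : ℕ} {α μ C C' : ℝ} {u v : Euc n → E} (hu : HB n k α μ C u)
    (hv : HB n k α μ C' v) : HB n k α μ (C + C') (fun x => u x + v x) := by
  have e : ∀ i ≤ k, ∀ x, iteratedFDeriv ℝ i (fun x => u x + v x) x
      = iteratedFDeriv ℝ i u x + iteratedFDeriv ℝ i v x := fun i hi x =>
    iteratedFDeriv_add_apply ((hu.1.of_le (by exact_mod_cast hi)).contDiffAt)
      ((hv.1.of_le (by exact_mod_cast hi)).contDiffAt)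
  refine ⟨hu.1.add hv.1, fun i hi x => ?_, fun i hi x y hxy => ?_⟩
  · rw [e i hi, add_mul]
    exact (norm_add_le _ _).trans (add_le_add (hu.2.1 i hi x) (hv.2.1 i hi x))
  · rw [e i hi, e i hi, add_sub_add_comm, add_mul, add_mul]
    exact (norm_add_le _ _).trans (add_le_add (hu.2.2 i hi x y hxy) (hv.2.2 i hi x y hxy))

/-- Post-composition with a continuous linear map. -/
theorem HB.clm {E' : Type*} [NormedAddCommGroup E'] [NormedSpace ℝ E'] {k : ℕ} {α μ C : ℝ}
    {u : Euc n → E} (hu : HB n k α μ C u) (L : E →L[ℝ] E') :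
    HB n k α μ (‖L‖ * C) (fun x => L (u x)) := by
  have e : ∀ i ≤ k, ∀ x, iteratedFDeriv ℝ i (fun x => L (u x)) x
      = L.compContinuousMultilinearMap (iteratedFDeriv ℝ i u x) := fun i hi x =>
    L.iteratedFDeriv_comp_left (f := u) hu.1.contDiffAt (by exact_mod_cast hi)
  refine ⟨L.contDiff.comp hu.1, fun i hi x => ?_, fun i hi x y hxy => ?_⟩
  · rw [e i hi, mul_assoc]
    exact (L.norm_compContinuousMultilinearMap_le _).trans (by gcongr; exact hu.2.1 i hi x)
  · rw [e i hi, e i hi]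
    have : L.compContinuousMultilinearMap (iteratedFDeriv ℝ i u x)
        - L.compContinuousMultilinearMap (iteratedFDeriv ℝ i u y)
        = L.compContinuousMultilinearMap (iteratedFDeriv ℝ i u x - iteratedFDeriv ℝ i u y) := by
      ext m; simp
    rw [this, mul_assoc, mul_assoc]
    refine (L.norm_compContinuousMultilinearMap_le _).trans ?_
    gcongr
    rw [← mul_assoc]
    exact hu.2.2 i hi x y hxy

theorem HB.const_smul {k : ℕ} {α μ C : ℝ} {u : Euc n → E} (hu : HB n k α μ C u) (c : ℝ) :
    HB n k α μ (|c| * C) (fun x => c • u x) := by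
  have h := hu.clm (c • ContinuousLinearMap.id ℝ E)
  refine HB.mono (C := ‖c • ContinuousLinearMap.id ℝ E‖ * C) (by simpa using h) ?_
  have := hu.nonneg
  gcongr
  rw [norm_smul]
  exact mul_le_of_le_one_right (norm_nonneg _) ContinuousLinearMap.norm_id_le

theorem HB.neg {k : ℕ} {α μ C : ℝ} {u : Euc n → E} (hu : HB n k α μ C u) :
    HB n k α μ C (fun x => - u x) := by
  simpa using hu.const_smul (-1)

theorem HB.sub {k : ℕ} {α μ C C' : ℝ} {u v : Euc n → E} (hu : HB n k α μ C u)
    (hv : HB n k α μ C' v) : HB n k α μ (C + C') (fun x => u x - v x) := by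
  simpa [sub_eq_add_neg] using hu.add hv.neg

theorem HB.zero (k : ℕ) (α μ : ℝ) : HB n k α μ 0 (fun _ => (0:E)) := by
  refine ⟨contDiff_const, fun i _ x => ?_, fun i _ x y _ => ?_⟩ <;>
  simp [show (fun _ : Euc n => (0:E)) = 0 from rfl]

theorem HB.sum {ι : Type*} (s : Finset ι) {k : ℕ} {α μ : ℝ} {C : ι → ℝ} {u : ι → Euc n → E}
    (hu : ∀ i ∈ s, HB n k α μ (C i) (u i)) :
    HB n k α μ (∑ i ∈ s, C i) (fun x => ∑ i ∈ s, u i x) := by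
  classical
  induction s using Finset.induction_on with
  | empty => simpa using HB.zero k α μ
  | insert a s ha ih =>
    simp only [Finset.sum_insert ha]
    exact (hu a (Finset.mem_insert_self _ _)).add
      (ih fun i hi => hu i (Finset.mem_insert_of_mem hi))

theorem norm_iteratedFDeriv_succ_sub (u : Euc n → E) (i : ℕ) (x y : Euc n) :
    ‖iteratedFDeriv ℝ (i+1) u x - iteratedFDeriv ℝ (i+1) u y‖
      = ‖iteratedFDeriv ℝ i (fderiv ℝ u) x - iteratedFDeriv ℝ i (fderiv ℝ u) y‖ := by
  let I : ContinuousMultilinearMap ℝ (fun _ : Fin i => Euc n) (Euc n →L[ℝ] E) ≃ₗᵢ[ℝ]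
      ContinuousMultilinearMap ℝ (fun _ : Fin (i+1) => Euc n) E :=
    (continuousMultilinearCurryRightEquiv' ℝ i (Euc n) E).symm
  have e : ∀ z, iteratedFDeriv ℝ (i+1) u z = I (iteratedFDeriv ℝ i (fderiv ℝ u) z) := fun z => by
    rw [iteratedFDeriv_succ_eq_comp_right, Function.comp_apply]
  rw [e, e, ← dist_eq_norm, ← dist_eq_norm, LinearIsometryEquiv.dist_map]

theorem HB.fderiv {k : ℕ} {α μ C : ℝ} {u : Euc n → E} (hu : HB n (k+1) α μ C u) :
    HB n k α (μ+1) C (fderiv ℝ u) := by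
  refine ⟨hu.1.fderiv_right (by norm_cast), fun i hi x => ?_, fun i hi x y hxy => ?_⟩
  · rw [norm_iteratedFDeriv_fderiv]
    convert hu.2.1 (i+1) (by omega) x using 3
    push_cast; ring
  · rw [← norm_iteratedFDeriv_succ_sub]
    convert hu.2.2 (i+1) (by omega) x y hxy using 4
    push_cast; ring

theorem norm_sub_le_of_fderiv_le {g : Euc n → E} {x y : Euc n} {ρ M : ℝ}
    (hg : Differentiable ℝ g) (hM : ∀ z, ‖x - z‖ ≤ ρ → ‖fderiv ℝ g z‖ ≤ M)
    (hxy : ‖x - y‖ ≤ ρ) : ‖g x - g y‖ ≤ M * ‖x - y‖ := by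
  refine (convex_closedBall x ρ).norm_image_sub_le_of_norm_fderiv_le (𝕜 := ℝ)
    (fun z _ => hg z) (fun z hz => hM z ?_) ?_ ?_
  · rwa [← dist_eq_norm, dist_comm]
  · rwa [Metric.mem_closedBall, dist_comm, dist_eq_norm]
  · exact Metric.mem_closedBall_self ((norm_nonneg _).trans hxy)

theorem le_rpow_mul_of_le {d r α : ℝ} (hd : 0 ≤ d) (hdr : d ≤ r) (hα0 : 0 < α) (hα1 : α ≤ 1) :
    d ≤ r ^ (1 - α) * d ^ α := by
  rcases hd.eq_or_lt with rfl | hd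
  · rw [Real.zero_rpow hα0.ne', mul_zero]
  · calc d = d ^ (1 - α) * d ^ α := by rw [← Real.rpow_add hd]; simp
      _ ≤ r ^ (1 - α) * d ^ α := by gcongr

/-- The lower order Hölder bounds follow from the bounds on the derivatives. -/
theorem HB.of_top {k : ℕ} {α μ C : ℝ} (hα0 : 0 < α) (hα1 : α ≤ 1) {u : Euc n → E}
    (hu : ContDiff ℝ k u)
    (hs : ∀ i : ℕ, i ≤ k → ∀ x : Euc n,
      ‖iteratedFDeriv ℝ i u x‖ ≤ C * (1 + ‖x‖) ^ (-(μ + i)))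
    (ht : ∀ x y : Euc n, ‖x - y‖ ≤ (1 + ‖x‖) / 4 →
      ‖iteratedFDeriv ℝ k u x - iteratedFDeriv ℝ k u y‖
        ≤ C * (1 + ‖x‖) ^ (-(μ + k + α)) * ‖x - y‖ ^ α) :
    HB n k α μ (2 ^ (|μ| + k) * C) u := by
  have hC : 0 ≤ C := by
    have := (norm_nonneg _).trans (hs 0 (Nat.zero_le _) 0)
    simpa using this
  have h1 : (1:ℝ) ≤ 2 ^ (|μ| + k) := Real.one_le_rpow (by norm_num) (by positivity)
  have hC' : C ≤ 2 ^ (|μ| + k) * C := le_mul_of_one_le_left hC h1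
  refine ⟨hu, fun i hi x => (hs i hi x).trans (by gcongr), fun i hi x y hxy => ?_⟩
  rcases hi.eq_or_lt with rfl | hi
  · exact (ht x y hxy).trans (by gcongr)
  · have hr : 0 < 1 + ‖x‖ := by positivity
    have hd : Differentiable ℝ (iteratedFDeriv ℝ i u) :=
      hu.differentiable_iteratedFDeriv (by exact_mod_cast hi)
    have h2 : ‖iteratedFDeriv ℝ i u x - iteratedFDeriv ℝ i u y‖
        ≤ (C * (2 ^ (|μ| + k) * (1 + ‖x‖) ^ (-(μ + i + 1)))) * ‖x - y‖ := by
      refine norm_sub_le_of_fderiv_le hd (fun z hz => ?_) hxy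
      rw [norm_fderiv_iteratedFDeriv]
      refine (hs (i+1) hi z).trans ?_
      gcongr
      obtain ⟨c1, c2⟩ := one_add_norm_comparable hz
      refine (rpow_le_of_comparable hr c1 c2 _).trans ?_
      rw [show -(μ + (i+1:ℕ)) = -(μ + i + 1) by push_cast; ring]
      gcongr
      · norm_num
      · rw [abs_neg, add_assoc]
        refine (abs_add_le _ _).trans ?_
        rw [abs_of_nonneg (by positivity : (0:ℝ) ≤ (i:ℝ) + 1)]
        gcongr
        exact_mod_cast hi
    refine h2.trans ?_
    have h3 : ‖x - y‖ ≤ (1 + ‖x‖) ^ (1 - α) * ‖x - y‖ ^ α :=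
      le_rpow_mul_of_le (norm_nonneg _) (by linarith) hα0 hα1
    calc (C * (2 ^ (|μ| + k) * (1 + ‖x‖) ^ (-(μ + i + 1)))) * ‖x - y‖
        ≤ (C * (2 ^ (|μ| + k) * (1 + ‖x‖) ^ (-(μ + i + 1))))
          * ((1 + ‖x‖) ^ (1 - α) * ‖x - y‖ ^ α) := by gcongr
      _ = 2 ^ (|μ| + k) * C * ((1 + ‖x‖) ^ (-(μ + i + 1)) * (1 + ‖x‖) ^ (1 - α))
          * ‖x - y‖ ^ α := by ring
      _ = _ := by rw [← Real.rpow_add hr]; ring_nf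

theorem HB.of_fderiv {k : ℕ} {α μ C : ℝ} (hα0 : 0 < α) (hα1 : α ≤ 1) {u : Euc n → E}
    (hd : Differentiable ℝ u) (hs : ∀ x, ‖u x‖ ≤ C * (1 + ‖x‖) ^ (-μ))
    (hu : HB n k α (μ+1) C (_root_.fderiv ℝ u)) :
    HB n (k+1) α μ (2 ^ (|μ| + (k + 1 : ℕ)) * C) u := by
  refine HB.of_top hα0 hα1 ?_ (fun i hi x => ?_) (fun x y hxy => ?_)
  · have := (contDiff_succ_iff_fderiv (𝕜 := ℝ) (n := (k : WithTop ℕ∞)) (f := u)).mpr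
      ⟨hd, by simp, hu.1⟩
    exact_mod_cast this
  · rcases i with _ | i
    · simpa using hs x
    · rw [← norm_iteratedFDeriv_fderiv]
      convert hu.2.1 i (by omega) x using 3
      push_cast; ring
  · rw [norm_iteratedFDeriv_succ_sub]
    convert hu.2.2 k le_rfl x y hxy using 4
    push_cast; ring

end HolderClass

section Equivalence

variable {n : ℕ} {E : Type*} [NormedAddCommGroup E] [NormedSpace ℝ E]

theorem WBound.nonneg {k : ℕ} {α μ C : ℝ} {u : Euc n → E} (h : WBound n k α μ C u) : 0 ≤ C :=
  le_trans (by positivity) (h.2.1 0 (Nat.zero_le _) 0)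

theorem exists_norm_eq_one_between {x y : Euc n} (hx : ‖x‖ ≤ 1) (hy : 1 ≤ ‖y‖) :
    ∃ z : Euc n, ‖z‖ = 1 ∧ ‖x - z‖ ≤ ‖x - y‖ ∧ ‖z - y‖ ≤ ‖x - y‖ := by
  have hc : ContinuousOn (fun t : ℝ => ‖x + t • (y - x)‖) (Set.Icc 0 1) := by fun_prop
  obtain ⟨t, ht, hz⟩ := intermediate_value_Icc (zero_le_one (α := ℝ)) hc
    (show (1:ℝ) ∈ Set.Icc _ _ by simpa using ⟨hx, hy⟩)
  refine ⟨x + t • (y - x), hz, ?_, ?_⟩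
  · rw [show x - (x + t • (y - x)) = t • (x - y) by module, norm_smul,
      Real.norm_of_nonneg ht.1]
    exact mul_le_of_le_one_left (norm_nonneg _) ht.2
  · rw [show x + t • (y - x) - y = (1 - t) • (x - y) by module, norm_smul,
      Real.norm_of_nonneg (by linarith [ht.2])]
    exact mul_le_of_le_one_left (norm_nonneg _) (by linarith [ht.1])

theorem WBound.hB (k : ℕ) {α : ℝ} (μ : ℝ) (hα0 : 0 < α) (hα1 : α ≤ 1) : ∃ K : ℝ, 0 < K ∧
    ∀ (C : ℝ) (u : Euc n → E), WBound n k α μ C u → HB n k α μ (K * C) u := by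
  set p := μ + k + α with hp
  set B : ℝ := 2 ^ |p| with hB
  have hB1 : 1 ≤ B := Real.one_le_rpow (by norm_num) (abs_nonneg _)
  refine ⟨2 ^ (|μ| + k) * (2 * B ^ 2), by positivity, fun C u h => ?_⟩
  have hC := h.nonneg
  have hCB : C ≤ 2 * B ^ 2 * C := le_mul_of_one_le_left hC (by nlinarith)
  have hBB : B * C ≤ B ^ 2 * C := by gcongr; nlinarith
  obtain ⟨hu, hs, hann, hball⟩ := h
  rw [mul_assoc]
  refine HB.of_top hα0 hα1 hu (fun i hi x => ?_) (fun x y hxy => ?_)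
  · have h1 := hs i hi x
    rw [Real.rpow_neg (by positivity), ← div_eq_mul_inv, le_div_iff₀ (by positivity), mul_comm]
    linarith
  · -- comparison of points on one dyadic annulus
    have hann' : ∀ (R : ℝ) (y z : Euc n), 1 ≤ R → R ≤ ‖y‖ → ‖y‖ ≤ 2*R → R ≤ ‖z‖ → ‖z‖ ≤ 2*R →
        1 + R ≤ 2 * (1 + ‖x‖) → 1 + ‖x‖ ≤ 2 * (1 + R) →
        ‖iteratedFDeriv ℝ k u y - iteratedFDeriv ℝ k u z‖
          ≤ B * C * (1 + ‖x‖) ^ (-p) * ‖y - z‖ ^ α := by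
      intro R y z hR h1 h2 h3 h4 h5 h6
      rcases eq_or_ne y z with rfl | hne
      · simp only [sub_self, norm_zero]
        positivity
      · have h7 := hann R hR y z h1 h2 h3 h4 hne
        have h8 := rpow_le_of_comparable (r := 1 + ‖x‖) (by positivity) h6 h5 (-p)
        rw [abs_neg] at h8
        have h9 : ‖iteratedFDeriv ℝ k u y - iteratedFDeriv ℝ k u z‖
            ≤ (1 + R) ^ (-p) * (C * ‖y - z‖ ^ α) := by
          rw [Real.rpow_neg (by linarith), ← div_eq_inv_mul, le_div_iff₀ (by positivity), mul_comm]
          exact h7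
        refine h9.trans ?_
        calc (1 + R) ^ (-p) * (C * ‖y - z‖ ^ α)
            ≤ (B * (1 + ‖x‖) ^ (-p)) * (C * ‖y - z‖ ^ α) := by gcongr
          _ = _ := by ring
    have hball' : ∀ (y z : Euc n), ‖y‖ ≤ 1 → ‖z‖ ≤ 1 → ‖x‖ ≤ 3 →
        ‖iteratedFDeriv ℝ k u y - iteratedFDeriv ℝ k u z‖
          ≤ B ^ 2 * C * (1 + ‖x‖) ^ (-p) * ‖y - z‖ ^ α := by
      intro y z hy hz hx
      rcases eq_or_ne y z with rfl | hne
      · simp only [sub_self, norm_zero]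
        positivity
      · refine (hball y z hy hz hne).trans ?_
        have h8 := rpow_le_of_comparable (r := 1 + ‖x‖) (s := 2) (by positivity) (by linarith)
          (by linarith [norm_nonneg x]) (-p)
        rw [abs_neg] at h8
        have h9 : (2:ℝ) ^ p ≤ B := Real.rpow_le_rpow_of_exponent_le (by norm_num) (le_abs_self p)
        have h10 : (1:ℝ) ≤ B ^ 2 * (1 + ‖x‖) ^ (-p) := by
          calc (1:ℝ) = 2 ^ p * 2 ^ (-p) := by rw [← Real.rpow_add (by norm_num)]; simp
            _ ≤ B * (B * (1 + ‖x‖) ^ (-p)) := by gcongr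
            _ = _ := by ring
        calc C * ‖y - z‖ ^ α ≤ (B ^ 2 * (1 + ‖x‖) ^ (-p)) * (C * ‖y - z‖ ^ α) :=
              le_mul_of_one_le_left (by positivity) h10
          _ = _ := by ring
    have hx0 := norm_nonneg x
    have hy0 := norm_nonneg y
    have n1 := norm_le_norm_add_norm_sub' x y
    have n2 := norm_le_norm_add_norm_sub x y
    have fin1 : ∀ d, 0 ≤ d → d ≤ ‖x - y‖ → B ^ 2 * C * (1 + ‖x‖) ^ (-p) * d ^ α
        ≤ B ^ 2 * C * (1 + ‖x‖) ^ (-p) * ‖x - y‖ ^ α := fun d h0 hd => by gcongr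
    have fin2 : ∀ d, 0 ≤ d → d ≤ ‖x - y‖ → B * C * (1 + ‖x‖) ^ (-p) * d ^ α
        ≤ B ^ 2 * C * (1 + ‖x‖) ^ (-p) * ‖x - y‖ ^ α := fun d h0 hd => by gcongr
    have fin3 : 2 * B ^ 2 * C * (1 + ‖x‖) ^ (-p) * ‖x - y‖ ^ α
        = B ^ 2 * C * (1 + ‖x‖) ^ (-p) * ‖x - y‖ ^ α
          + B ^ 2 * C * (1 + ‖x‖) ^ (-p) * ‖x - y‖ ^ α := by ring
    have pos : 0 ≤ B ^ 2 * C * (1 + ‖x‖) ^ (-p) * ‖x - y‖ ^ α := by positivity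
    rw [fin3]
    rcases le_total ‖x‖ 1 with hx | hx <;> rcases le_total ‖y‖ 1 with hy | hy
    · linarith [hball' x y hx hy (by linarith)]
    · obtain ⟨z, hz, hz1, hz2⟩ := exists_norm_eq_one_between hx hy
      refine (norm_sub_le_norm_sub_add_norm_sub _ (iteratedFDeriv ℝ k u z) _).trans ?_
      refine add_le_add ((hball' x z hx hz.le (by linarith)).trans (fin1 _ (norm_nonneg _) hz1)) ?_
      exact (hann' 1 z y le_rfl hz.ge (by linarith) hy (by linarith) (by linarith)
        (by linarith)).trans (fin2 _ (norm_nonneg _) hz2)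
    · obtain ⟨z, hz, hz1, hz2⟩ := exists_norm_eq_one_between hy hx
      rw [norm_sub_rev y x] at hz1 hz2
      refine (norm_sub_le_norm_sub_add_norm_sub _ (iteratedFDeriv ℝ k u z) _).trans ?_
      rw [norm_sub_rev z x] at hz2
      rw [norm_sub_rev y z] at hz1
      refine add_le_add ?_ ((hball' z y hz.le hy (by linarith)).trans (fin1 _ (norm_nonneg _) hz1))
      exact (hann' 1 x z le_rfl hx (by linarith) hz.ge (by linarith) (by linarith)
        (by linarith)).trans (fin2 _ (norm_nonneg _) hz2)
    · rcases le_total ‖x‖ ‖y‖ with hxy' | hxy'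
      · linarith [hann' ‖x‖ x y hx le_rfl (by linarith) hxy' (by linarith) (by linarith)
          (by linarith), fin2 _ (norm_nonneg _) le_rfl]
      · linarith [hann' ‖y‖ x y hy hxy' (by linarith) le_rfl (by linarith) (by linarith)
          (by linarith), fin2 _ (norm_nonneg _) le_rfl]

theorem HB.holder_of_comparable {k : ℕ} {α μ C : ℝ} (hα0 : 0 < α) (hα1 : α ≤ 1) {u : Euc n → E}
    (h : HB n k α μ C u) {x y : Euc n} (h1 : 1 + ‖x‖ ≤ 2 * (1 + ‖y‖))
    (h2 : 1 + ‖y‖ ≤ 2 * (1 + ‖x‖)) :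
    ‖iteratedFDeriv ℝ k u x - iteratedFDeriv ℝ k u y‖
      ≤ 8 * 2 ^ |μ + k| * C * (1 + ‖x‖) ^ (-(μ + k + α)) * ‖x - y‖ ^ α := by
  have hC := h.nonneg
  have hr : 0 < 1 + ‖x‖ := by positivity
  have hB1 : (1:ℝ) ≤ 2 ^ |μ + k| := Real.one_le_rpow (by norm_num) (abs_nonneg _)
  rcases le_total ‖x - y‖ ((1 + ‖x‖) / 4) with hd | hd
  · refine (h.2.2 k le_rfl x y hd).trans ?_
    gcongr
    nlinarith
  · have e1 := h.2.1 k le_rfl x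
    have e2 := h.2.1 k le_rfl y
    have e3 := rpow_le_of_comparable hr h1 h2 (-(μ + k))
    rw [abs_neg] at e3
    have e4 : (1 + ‖x‖) ^ (-(μ + k)) ≤ (1 + ‖x‖) ^ (-(μ + k + α)) * (4 * ‖x - y‖ ^ α) := by
      rw [neg_add (μ + k) α, Real.rpow_add hr, mul_assoc]
      refine le_mul_of_one_le_right (by positivity) ?_
      rw [Real.rpow_neg hr.le, ← div_eq_inv_mul, le_div_iff₀ (by positivity), one_mul]
      calc (1 + ‖x‖) ^ α ≤ (4 * ‖x - y‖) ^ α := by gcongr; linarith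
        _ = 4 ^ α * ‖x - y‖ ^ α := Real.mul_rpow (by norm_num) (norm_nonneg _)
        _ ≤ 4 * ‖x - y‖ ^ α := by
          gcongr
          calc (4:ℝ) ^ α ≤ 4 ^ (1:ℝ) := Real.rpow_le_rpow_of_exponent_le (by norm_num) hα1
            _ = 4 := by norm_num
    calc ‖iteratedFDeriv ℝ k u x - iteratedFDeriv ℝ k u y‖
        ≤ C * (1 + ‖x‖) ^ (-(μ + k)) + C * (2 ^ |μ + k| * (1 + ‖x‖) ^ (-(μ + k))) :=
          (norm_sub_le _ _).trans (add_le_add e1 (e2.trans (by gcongr)))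
      _ = (1 + 2 ^ |μ + k|) * C * (1 + ‖x‖) ^ (-(μ + k)) := by ring
      _ ≤ (2 * 2 ^ |μ + k|) * C * ((1 + ‖x‖) ^ (-(μ + k + α)) * (4 * ‖x - y‖ ^ α)) := by
          gcongr
          linarith
      _ = _ := by ring

theorem HB.wBound (k : ℕ) {α : ℝ} (μ : ℝ) (hα0 : 0 < α) (hα1 : α ≤ 1) : ∃ K : ℝ, 0 < K ∧
    ∀ (C : ℝ) (u : Euc n → E), HB n k α μ C u → WBound n k α μ (K * C) u := by
  set p := μ + k + α with hp
  set B : ℝ := 2 ^ |p| with hB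
  set A : ℝ := 8 * 2 ^ |μ + k| with hA
  have hB1 : 1 ≤ B := Real.one_le_rpow (by norm_num) (abs_nonneg _)
  have hA1 : 1 ≤ A := by
    have : (1:ℝ) ≤ 2 ^ |μ + k| := Real.one_le_rpow (by norm_num) (abs_nonneg _)
    linarith
  refine ⟨A * B, by positivity, fun C u h => ?_⟩
  have hC := h.nonneg
  refine ⟨h.1, fun i hi x => ?_, fun R hR x y h1 h2 h3 h4 _ => ?_, fun x y hx hy _ => ?_⟩
  · have := h.2.1 i hi x
    rw [Real.rpow_neg (by positivity), ← div_eq_mul_inv, le_div_iff₀ (by positivity)] at this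
    rw [mul_comm]
    refine this.trans (le_mul_of_one_le_left hC (by nlinarith))
  · have e := h.holder_of_comparable hα0 hα1 (x := x) (y := y) (by linarith) (by linarith)
    have e2 := rpow_le_of_comparable (r := 1 + R) (s := 1 + ‖x‖) (by positivity)
      (by linarith) (by linarith) (-p)
    rw [abs_neg] at e2
    have e3 : ‖iteratedFDeriv ℝ k u x - iteratedFDeriv ℝ k u y‖
        ≤ A * C * (B * (1 + R) ^ (-p)) * ‖x - y‖ ^ α := e.trans (by gcongr)
    calc (1 + R) ^ p * ‖iteratedFDeriv ℝ k u x - iteratedFDeriv ℝ k u y‖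
        ≤ (1 + R) ^ p * (A * C * (B * (1 + R) ^ (-p)) * ‖x - y‖ ^ α) := by gcongr
      _ = ((1 + R) ^ p * (1 + R) ^ (-p)) * (A * B * C * ‖x - y‖ ^ α) := by ring
      _ = _ := by rw [← Real.rpow_add (by positivity)]; simp
  · have hx0 := norm_nonneg x
    have hy0 := norm_nonneg y
    have e := h.holder_of_comparable hα0 hα1 (x := x) (y := y) (by linarith) (by linarith)
    have e2 := rpow_le_of_comparable (r := 1) (s := 1 + ‖x‖) (by positivity)
      (by linarith) (by linarith) (-p)
    rw [abs_neg, Real.one_rpow, mul_one] at e2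
    refine e.trans ?_
    calc A * C * (1 + ‖x‖) ^ (-p) * ‖x - y‖ ^ α ≤ A * C * B * ‖x - y‖ ^ α := by gcongr
      _ = _ := by ring

end Equivalence

section Products

variable {n : ℕ} {E : Type*} [NormedAddCommGroup E] [NormedSpace ℝ E]

theorem norm_iteratedFDeriv_smul_le_of_bounds {u : Euc n → ℝ} {v : Euc n → E} {k i : ℕ}
    (hik : i ≤ k) (hu : ContDiff ℝ k u) (hv : ContDiff ℝ k v) {x : Euc n} {A B r a b : ℝ}
    (hr : 0 < r) (hA : 0 ≤ A)
    (hua : ∀ j ≤ k, ‖iteratedFDeriv ℝ j u x‖ ≤ A * r ^ (-(a + j)))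
    (hvb : ∀ j ≤ k, ‖iteratedFDeriv ℝ j v x‖ ≤ B * r ^ (-(b + j))) :
    ‖iteratedFDeriv ℝ i (fun y => u y • v y) x‖ ≤ 2 ^ k * (A * B) * r ^ (-(a + b + i)) := by
  have hB : 0 ≤ B := by
    have := (norm_nonneg _).trans (hvb 0 (Nat.zero_le _))
    exact nonneg_of_mul_nonneg_left this (by positivity)
  refine (norm_iteratedFDeriv_smul_le (hu.of_le (by exact_mod_cast hik))
    (hv.of_le (by exact_mod_cast hik)) x le_rfl).trans ?_
  calc ∑ j ∈ Finset.range (i + 1), (i.choose j : ℝ) * ‖iteratedFDeriv ℝ j u x‖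
        * ‖iteratedFDeriv ℝ (i - j) v x‖
      ≤ ∑ j ∈ Finset.range (i + 1), (i.choose j : ℝ) * (A * B * r ^ (-(a + b + i))) := by
        refine Finset.sum_le_sum fun j hj => ?_
        have hj' : j ≤ i := Nat.lt_succ_iff.mp (Finset.mem_range.mp hj)
        calc (i.choose j : ℝ) * ‖iteratedFDeriv ℝ j u x‖ * ‖iteratedFDeriv ℝ (i - j) v x‖
            ≤ (i.choose j : ℝ) * (A * r ^ (-(a + j))) * (B * r ^ (-(b + (i - j : ℕ)))) := by
              gcongr
              · exact hua j (hj'.trans hik)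
              · exact hvb (i - j) (by omega)
          _ = (i.choose j : ℝ) * (A * B * (r ^ (-(a + j)) * r ^ (-(b + (i - j : ℕ))))) := by ring
          _ = _ := by
              rw [← Real.rpow_add hr, Nat.cast_sub hj']
              ring_nf
    _ = 2 ^ i * (A * B * r ^ (-(a + b + i))) := by
        rw [← Finset.sum_mul]
        congr 1
        exact_mod_cast Nat.sum_range_choose i
    _ ≤ 2 ^ k * (A * B * r ^ (-(a + b + i))) := by
        gcongr
        norm_num
    _ = _ := by ring

/-- Products of weighted Hölder functions: the weights add. -/
theorem HB.smul (k : ℕ) {α : ℝ} (μ₁ μ₂ : ℝ) : ∃ K : ℝ, 0 < K ∧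
    ∀ (C₁ C₂ : ℝ) (u : Euc n → ℝ) (v : Euc n → E), HB n k α μ₁ C₁ u → HB n k α μ₂ C₂ v →
      HB n k α (μ₁ + μ₂) (K * (C₁ * C₂)) (fun x => u x • v x) := by
  set B : ℝ := 2 ^ (|μ₂| + k) with hB
  have hB1 : 1 ≤ B := Real.one_le_rpow (by norm_num) (by positivity)
  refine ⟨2 ^ k * (B + 1), by positivity, fun C₁ C₂ u v hu hv => ?_⟩
  have h1 := hu.nonneg
  have h2 := hv.nonneg
  refine ⟨hu.1.smul hv.1, fun i hi x => ?_, fun i hi x y hxy => ?_⟩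
  · have hr : 0 < 1 + ‖x‖ := by positivity
    refine (norm_iteratedFDeriv_smul_le_of_bounds hi hu.1 hv.1 hr h1
      (fun j hj => hu.2.1 j hj x) (fun j hj => hv.2.1 j hj x)).trans ?_
    gcongr
    exact le_mul_of_one_le_right (by positivity) (by linarith)
  · have hr : 0 < 1 + ‖x‖ := by positivity
    obtain ⟨c1, c2⟩ := one_add_norm_comparable hxy
    have hxy' : x + (y - x) = y := by abel
    have hus : ContDiff ℝ k (fun z => u (z + (y - x))) := hu.1.comp (by fun_prop)
    have hvs : ContDiff ℝ k (fun z => v (z + (y - x))) := hv.1.comp (by fun_prop)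
    have hud : ContDiff ℝ k (fun z => u z - u (z + (y - x))) := hu.1.sub hus
    have hvd : ContDiff ℝ k (fun z => v z - v (z + (y - x))) := hv.1.sub hvs
    have e1 : ∀ j ≤ k, iteratedFDeriv ℝ j (fun z => u z - u (z + (y - x))) x
        = iteratedFDeriv ℝ j u x - iteratedFDeriv ℝ j u y := fun j hj => by
      have := iteratedFDeriv_sub_apply (x := x) (i := j)
        ((hu.1.of_le (by exact_mod_cast hj)).contDiffAt)
        ((hus.of_le (by exact_mod_cast hj)).contDiffAt)
      rw [iteratedFDeriv_comp_add_right, hxy'] at this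
      exact this
    have e2 : ∀ j ≤ k, iteratedFDeriv ℝ j (fun z => v z - v (z + (y - x))) x
        = iteratedFDeriv ℝ j v x - iteratedFDeriv ℝ j v y := fun j hj => by
      have := iteratedFDeriv_sub_apply (x := x) (i := j)
        ((hv.1.of_le (by exact_mod_cast hj)).contDiffAt)
        ((hvs.of_le (by exact_mod_cast hj)).contDiffAt)
      rw [iteratedFDeriv_comp_add_right, hxy'] at this
      exact this
    have hle : ∀ j : ℕ, (1 + ‖y‖) ^ (-(μ₂ + j)) ≤ 2 ^ (|μ₂| + j) * (1 + ‖x‖) ^ (-(μ₂ + j)) := by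
      intro j
      refine (rpow_le_of_comparable hr c1 c2 _).trans ?_
      gcongr
      · norm_num
      · rw [abs_neg]
        exact (abs_add_le _ _).trans (by simp)
    have t1 := norm_iteratedFDeriv_smul_le_of_bounds (a := μ₁ + α) (b := μ₂)
      (A := C₁ * ‖x - y‖ ^ α) (B := C₂ * B) hi hud hvs hr (by positivity)
      (fun j hj => by
        rw [e1 j hj]
        refine (hu.2.2 j hj x y hxy).trans (le_of_eq ?_)
        rw [show μ₁ + α + j = μ₁ + j + α by ring]; ring)
      (fun j hj => by
        rw [iteratedFDeriv_comp_add_right, hxy', mul_assoc]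
        refine (hv.2.1 j hj y).trans ?_
        gcongr
        refine (hle j).trans ?_
        rw [hB]
        gcongr
        norm_num)
    have t2 := norm_iteratedFDeriv_smul_le_of_bounds (a := μ₁) (b := μ₂ + α)
      (A := C₁) (B := C₂ * ‖x - y‖ ^ α) hi hu.1 hvd hr h1 (fun j hj => hu.2.1 j hj x)
      (fun j hj => by
        rw [e2 j hj]
        refine (hv.2.2 j hj x y hxy).trans (le_of_eq ?_)
        rw [show μ₂ + α + j = μ₂ + j + α by ring]; ring)
    have hprod : ContDiff ℝ k (fun z => u z • v z) := hu.1.smul hv.1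
    have hprods : ContDiff ℝ k (fun z => u (z + (y - x)) • v (z + (y - x))) := hus.smul hvs
    have e3 : iteratedFDeriv ℝ i (fun z => u z • v z) x - iteratedFDeriv ℝ i (fun z => u z • v z) y
        = iteratedFDeriv ℝ i (fun z => (u z - u (z + (y - x))) • v (z + (y - x))) x
          + iteratedFDeriv ℝ i (fun z => u z • (v z - v (z + (y - x)))) x := by
      have h3 := iteratedFDeriv_add_apply (x := x) (i := i)
        (((hud.smul hvs).of_le (by exact_mod_cast hi)).contDiffAt)
        (((hu.1.smul hvd).of_le (by exact_mod_cast hi)).contDiffAt)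
      have h4 := iteratedFDeriv_sub_apply (x := x) (i := i)
        ((hprod.of_le (by exact_mod_cast hi)).contDiffAt)
        ((hprods.of_le (by exact_mod_cast hi)).contDiffAt)
      rw [iteratedFDeriv_comp_add_right (f := fun z => u z • v z), hxy'] at h4
      rw [← h4]
      refine Eq.trans ?_ h3
      congr 1
      ext z
      simp only [Pi.sub_apply, Pi.add_apply, Pi.smul_apply']
      module
    rw [e3]
    refine (norm_add_le _ _).trans ((add_le_add t1 t2).trans (le_of_eq ?_))
    rw [show μ₁ + α + μ₂ + i = μ₁ + μ₂ + i + α by ring,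
      show μ₁ + (μ₂ + α) + i = μ₁ + μ₂ + i + α by ring]
    ring

end Products

section Powers

variable {n : ℕ}

theorem rpow_mem_bound {t : ℝ} (ht : |t - 1| ≤ 1/2) (p : ℝ) : t ^ p ≤ 2 ^ |p| := by
  have h := abs_le.mp ht
  have := rpow_le_of_comparable (r := 1) (s := t) one_pos (by linarith) (by linarith) p
  simpa using this

theorem abs_rpow_sub_rpow_le {s t : ℝ} (hs : |s - 1| ≤ 1/2) (ht : |t - 1| ≤ 1/2) (p : ℝ) :
    |s ^ p - t ^ p| ≤ |p| * 2 ^ |p - 1| * |s - t| := by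
  have hc : Convex ℝ (Set.Icc (1/2:ℝ) (3/2)) := convex_Icc _ _
  have hm : ∀ {r : ℝ}, |r - 1| ≤ 1/2 → r ∈ Set.Icc (1/2:ℝ) (3/2) := fun {r} hr => by
    have := abs_le.mp hr
    exact ⟨by linarith, by linarith⟩
  refine hc.norm_image_sub_le_of_norm_hasDerivWithin_le (f := fun r : ℝ => r ^ p)
    (f' := fun r => p * r ^ (p - 1))
    (fun r hr => (Real.hasDerivAt_rpow_const (Or.inl (by linarith [hr.1]))).hasDerivWithinAt)
    (fun r hr => ?_) (hm ht) (hm hs)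
  have hr0 : 0 < r := by linarith [hr.1]
  rw [norm_mul, Real.norm_eq_abs, Real.norm_of_nonneg (by positivity)]
  gcongr
  exact rpow_mem_bound (abs_le.mpr ⟨by linarith [hr.1], by linarith [hr.2]⟩) _

theorem HB.one_add_bound {k : ℕ} {α ν C : ℝ} {ψ : Euc n → ℝ} (hν : 0 ≤ ν)
    (h : HB n k α ν C ψ) (hC : C ≤ 1/2) (x : Euc n) : |1 + ψ x - 1| ≤ 1/2 := by
  have h1 := (h.mono_weight hν).2.1 0 (Nat.zero_le _) x
  simp only [norm_iteratedFDeriv_zero, Real.norm_eq_abs] at h1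
  simp only [Nat.cast_zero, add_zero, neg_zero, Real.rpow_zero, mul_one] at h1
  rw [add_sub_cancel_left]
  linarith

theorem HB.one_add_rpow {α ν : ℝ} (hα0 : 0 < α) (hα1 : α ≤ 1) (hν : 0 ≤ ν) (k : ℕ) :
    ∀ p : ℝ, ∃ K : ℝ, 0 < K ∧ ∀ (C : ℝ) (ψ : Euc n → ℝ), C ≤ 1/2 → HB n k α ν C ψ →
      HB n k α 0 K (fun x => (1 + ψ x) ^ p) := by
  induction k with
  | zero =>
    intro p
    refine ⟨2 ^ |p| + |p| * 2 ^ |p - 1|, by positivity, fun C ψ hC h => ?_⟩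
    have hC0 := h.nonneg
    have hb := h.one_add_bound hν hC
    have hp : ∀ x, 0 < 1 + ψ x := fun x => by linarith [(abs_le.mp (hb x)).1]
    have hh := h.mono_weight hν
    refine ⟨?_, fun i hi x => ?_, fun i hi x y hxy => ?_⟩
    · have := h.1
      rw [Nat.cast_zero, contDiff_zero] at this ⊢
      exact (continuous_const.add this).rpow_const fun x => Or.inl (hp x).ne'
    · obtain rfl := Nat.le_zero.mp hi
      rw [norm_iteratedFDeriv_zero, Real.norm_of_nonneg (Real.rpow_nonneg (hp x).le _)]
      simp only [Nat.cast_zero, add_zero, neg_zero, Real.rpow_zero, mul_one]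
      have := rpow_mem_bound (hb x) p
      have h2 : 0 ≤ |p| * (2:ℝ) ^ |p - 1| := by positivity
      linarith
    · obtain rfl := Nat.le_zero.mp hi
      have h1 := hh.2.2 0 le_rfl x y hxy
      have e : ∀ (g : Euc n → ℝ), ‖iteratedFDeriv ℝ 0 g x - iteratedFDeriv ℝ 0 g y‖
          = |g x - g y| := fun g => by
        rw [iteratedFDeriv_zero_eq_comp, Function.comp_apply, Function.comp_apply, ← dist_eq_norm,
          LinearIsometryEquiv.dist_map, Real.dist_eq]
      rw [e] at h1 ⊢
      have h2 := abs_rpow_sub_rpow_le (hb x) (hb y) p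
      rw [add_sub_add_left_eq_sub] at h2
      refine h2.trans ?_
      set w := (1 + ‖x‖) ^ (-((0:ℝ) + (0:ℕ) + α)) * ‖x - y‖ ^ α with hw
      have hw0 : 0 ≤ w := by positivity
      rw [mul_assoc, ← hw] at h1
      rw [mul_assoc _ ((1 + ‖x‖) ^ _), ← hw]
      have h4 : |ψ x - ψ y| ≤ w := h1.trans (mul_le_of_le_one_left hw0 (by linarith))
      have h5 : |p| * 2 ^ |p - 1| * |ψ x - ψ y| ≤ |p| * 2 ^ |p - 1| * w := by gcongr
      have h6 : 0 ≤ (2:ℝ) ^ |p| * w := by positivity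
      linarith
  | succ k ih =>
    intro p
    obtain ⟨K₁, hK₁, h₁⟩ := ih (p - 1)
    obtain ⟨K₂, hK₂, h₂⟩ := HB.smul (n := n) (E := Euc n →L[ℝ] ℝ) k (α := α) 0 (ν + 1)
    refine ⟨2 ^ (|(0:ℝ)| + (k + 1 : ℕ)) * (2 ^ |p| + K₂ * (|p| * K₁)), by positivity,
      fun C ψ hC h => ?_⟩
    have hC0 := h.nonneg
    have hb := h.one_add_bound hν hC
    have hp : ∀ x, 0 < 1 + ψ x := fun x => by linarith [(abs_le.mp (hb x)).1]
    have hψd : Differentiable ℝ ψ := h.1.differentiable (by simp)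
    have hder : ∀ x, HasFDerivAt (fun x => (1 + ψ x) ^ p)
        ((p * (1 + ψ x) ^ (p - 1)) • _root_.fderiv ℝ ψ x) x := fun x => by
      exact (Real.hasDerivAt_rpow_const (Or.inl (hp x).ne')).comp_hasFDerivAt x
        ((hψd x).hasFDerivAt.const_add 1)
    refine HB.of_fderiv hα0 hα1 (fun x => (hder x).differentiableAt) (fun x => ?_) ?_
    · rw [Real.norm_of_nonneg (Real.rpow_nonneg (hp x).le _), neg_zero, Real.rpow_zero, mul_one]
      have := rpow_mem_bound (hb x) p
      have h2 : 0 ≤ K₂ * (|p| * K₁) := by positivity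
      linarith
    · have e : _root_.fderiv ℝ (fun x => (1 + ψ x) ^ p)
          = fun x => (p * (1 + ψ x) ^ (p - 1)) • _root_.fderiv ℝ ψ x :=
        funext fun x => (hder x).fderiv
      rw [e]
      have h3 := (h₁ C ψ hC (h.mono_order (Nat.le_succ k))).const_smul p
      have h4 := h₂ _ _ _ _ h3 h.fderiv
      refine (h4.mono_weight (by linarith)).mono ?_
      have h5 : K₂ * (|p| * K₁ * C) ≤ K₂ * (|p| * K₁) := by
        exact mul_le_mul_of_nonneg_left
          (mul_le_of_le_one_right (by positivity) (by linarith)) hK₂.le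
      have h6 : (0:ℝ) ≤ 2 ^ |p| := by positivity
      linarith

end Powers

section Pieces

variable {n : ℕ} {E : Type*} [NormedAddCommGroup E] [NormedSpace ℝ E]

/-- The convolution of `f` with the dilate of `κ` at scale `l`, normalised as an approximate
inverse of the Laplacian at that scale. -/
def piece (κ : Euc n → ℝ) (l : ℝ) (f : Euc n → E) (x : Euc n) : E :=
  (l ^ 2 / l ^ n) • cv (fun y => κ (l⁻¹ • y)) f x

theorem dilate_contDiff {κ : Euc n → ℝ} (hκ : ContDiff ℝ ∞ κ) (l : ℝ) :
    ContDiff ℝ ∞ (fun y => κ (l⁻¹ • y)) := hκ.comp (contDiff_const_smul _)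

theorem dilate_support {κ : Euc n → ℝ} (hκs : ∀ y, 1 < ‖y‖ → κ y = 0) {l : ℝ} (hl : 0 < l)
    (y : Euc n) (hy : l < ‖y‖) : κ (l⁻¹ • y) = 0 := by
  apply hκs
  rw [norm_smul, norm_inv, Real.norm_of_nonneg hl.le, ← div_eq_inv_mul, one_lt_div hl]
  exact hy

theorem norm_iteratedFDeriv_dilate_le {κ : Euc n → ℝ} (hκ : ContDiff ℝ ∞ κ) {l M : ℝ} (hl : 0 < l)
    (j : ℕ) (hM : ∀ y, ‖iteratedFDeriv ℝ j κ y‖ ≤ M) (y : Euc n) :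
    ‖iteratedFDeriv ℝ j (fun y => κ (l⁻¹ • y)) y‖ ≤ (l ^ j)⁻¹ * M := by
  rw [iteratedFDeriv_comp_const_smul _ (hκ.of_le (by exact_mod_cast le_top)), norm_smul, norm_pow,
    norm_inv, Real.norm_of_nonneg hl.le, inv_pow]
  gcongr
  exact hM _

theorem piece_contDiff {κ : Euc n → ℝ} (hκ : ContDiff ℝ ∞ κ) (hκs : ∀ y, 1 < ‖y‖ → κ y = 0)
    {l : ℝ} (hl : 0 < l) {f : Euc n → E} (hf : Continuous f) : ContDiff ℝ ∞ (piece κ l f) :=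
  contDiff_const.smul (cv_contDiff (dilate_contDiff hκ l)
    (hasCompactSupport_of_ball (dilate_support hκs hl)) hf)

theorem norm_iteratedFDeriv_piece {κ : Euc n → ℝ} (hκ : ContDiff ℝ ∞ κ)
    (hκs : ∀ y, 1 < ‖y‖ → κ y = 0) {l : ℝ} (hl : 0 < l) {f : Euc n → E} (hf : Continuous f)
    (i : ℕ) (x : Euc n) : ‖iteratedFDeriv ℝ i (piece κ l f) x‖
      = l ^ 2 / l ^ n * ‖iteratedFDeriv ℝ i (cv (fun y => κ (l⁻¹ • y)) f) x‖ := by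
  unfold piece
  rw [iteratedFDeriv_const_smul_apply' (((cv_contDiff (dilate_contDiff hκ l)
    (hasCompactSupport_of_ball (dilate_support hκs hl)) hf).of_le
      (by exact_mod_cast le_top)).contDiffAt), norm_smul, Real.norm_of_nonneg (by positivity)]

/-- The volume of the unit ball. -/
def ballVol (n : ℕ) : ℝ := (volume : Measure (Euc n)).real (Metric.closedBall 0 1)

theorem setIntegral_norm_closedBall_le {G : Type*} [NormedAddCommGroup G] {g : Euc n → G}
    {x : Euc n} {l A : ℝ} (hl : 0 ≤ l)
    (hg : ∀ y, ‖x - y‖ ≤ l → ‖g y‖ ≤ A) :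
    ∫ y in Metric.closedBall x l, ‖g y‖ ≤ A * (l ^ n * ballVol n) := by
  have h := norm_setIntegral_le_of_norm_le_const (μ := volume) (s := Metric.closedBall x l)
    (f := fun y => ‖g y‖) (C := A) measure_closedBall_lt_top (fun y hy => by
      rw [norm_norm]
      apply hg
      rwa [← dist_eq_norm, dist_comm])
  rw [Measure.addHaar_real_closedBall' volume x hl] at h
  simp only [finrank_euclideanSpace, Fintype.card_fin] at h
  exact (Real.le_norm_self _).trans h

theorem ballVol_nonneg (n : ℕ) : 0 ≤ ballVol n := measureReal_nonneg

theorem piece_local_low {κ : Euc n → ℝ} (hκ : ContDiff ℝ ∞ κ) (hκs : ∀ y, 1 < ‖y‖ → κ y = 0)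
    {M : ℝ} (hM : ∀ y, |κ y| ≤ M) {k : ℕ} {α μ C : ℝ} {f : Euc n → E} (hf : HB n k α (μ+2) C f)
    {l : ℝ} (hl : 0 < l) {x : Euc n} (hlx : l ≤ (1 + ‖x‖) / 4) {i : ℕ} (hi : i ≤ k) :
    ‖iteratedFDeriv ℝ i (piece κ l f) x‖
      ≤ M * ballVol n * 2 ^ |μ + 2 + i| * C * ((1 + ‖x‖) ^ (-(μ + i)) * (l / (1 + ‖x‖)) ^ 2) := by
  have hr : 0 < 1 + ‖x‖ := by positivity
  have hM0 : 0 ≤ M := (abs_nonneg _).trans (hM 0)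
  have hC := hf.nonneg
  rw [norm_iteratedFDeriv_piece hκ hκs hl hf.1.continuous,
    iteratedFDeriv_cv_right (dilate_contDiff hκ l).continuous (dilate_support hκs hl) i
      (hf.1.of_le (by exact_mod_cast hi))]
  have h1 := norm_cv_le (dilate_support hκs hl) (M := M) (fun y => hM _)
    (hf.1.continuous_iteratedFDeriv (m := i) (by exact_mod_cast hi)) x
  have h2 := setIntegral_norm_closedBall_le (g := iteratedFDeriv ℝ i f) (x := x) hl.le
    (A := C * (2 ^ |μ + 2 + i| * (1 + ‖x‖) ^ (-(μ + 2 + i)))) (fun y hy => by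
      refine (hf.2.1 i hi y).trans ?_
      gcongr
      obtain ⟨c1, c2⟩ := one_add_norm_comparable (hy.trans hlx)
      have := rpow_le_of_comparable hr c1 c2 (-(μ + 2 + i))
      rwa [abs_neg] at this)
  calc l ^ 2 / l ^ n * ‖cv (fun y => κ (l⁻¹ • y)) (iteratedFDeriv ℝ i f) x‖
      ≤ l ^ 2 / l ^ n * (M * (C * (2 ^ |μ + 2 + i| * (1 + ‖x‖) ^ (-(μ + 2 + i)))
        * (l ^ n * ballVol n))) := by
        gcongr
        exact h1.trans (by gcongr)
    _ = M * ballVol n * 2 ^ |μ + 2 + i| * C * (l ^ 2 * (1 + ‖x‖) ^ (-(μ + 2 + i))) := by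
        field_simp
    _ = _ := by
        rw [show -(μ + 2 + i) = -(μ + i) - (2:ℕ) by push_cast; ring, Real.rpow_sub hr,
          Real.rpow_natCast]
        field_simp

theorem cv_sub_const [CompleteSpace E] {K : Euc n → ℝ} {l : ℝ} (hK : Continuous K) (hl : ∀ y, l < ‖y‖ → K y = 0)
    {g : Euc n → E} (hg : Continuous g) (c : E) (x : Euc n) :
    cv K g x = cv K (fun y => g y - c) x + (∫ t, K t) • c := by
  have hKc := hasCompactSupport_of_ball hl
  have hi1 : Integrable (fun t => K t • (g (x - t) - c)) :=
    integrable_cv hK hKc (hg.sub continuous_const) x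
  have hi2 : Integrable (fun t => K t • c) := (hK.integrable_of_hasCompactSupport hKc).smul_const c
  rw [cv_apply, cv_apply, ← integral_smul_const, ← integral_add hi1 hi2]
  refine integral_congr_ae (Eventually.of_forall fun t => ?_)
  simp [smul_sub]

theorem iteratedFDeriv_cv_sub_const [CompleteSpace E] {K : Euc n → ℝ} {l : ℝ} (hK : ContDiff ℝ ∞ K)
    (hl : ∀ y, l < ‖y‖ → K y = 0) {g : Euc n → E} (hg : Continuous g) (c : E) {j : ℕ} (hj : j ≠ 0)
    (x : Euc n) :
    iteratedFDeriv ℝ j (cv K g) x = iteratedFDeriv ℝ j (cv K (fun y => g y - c)) x := by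
  have e : cv K g = fun x => cv K (fun y => g y - c) x + (∫ t, K t) • c :=
    funext fun x => cv_sub_const hK.continuous hl hg c x
  have hs : ContDiff ℝ ∞ (cv K (fun y => g y - c)) :=
    cv_contDiff hK (hasCompactSupport_of_ball hl) (hg.sub continuous_const)
  rw [e]
  have := iteratedFDeriv_add_apply (𝕜 := ℝ) (i := j) (x := x)
    ((hs.of_le (by exact_mod_cast le_top)).contDiffAt)
    (g := fun _ => (∫ t, K t) • c) contDiffAt_const
  rw [iteratedFDeriv_const_of_ne hj, Pi.zero_apply, add_zero] at this
  exact this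

theorem piece_local_high [CompleteSpace E] {κ : Euc n → ℝ} (hκ : ContDiff ℝ ∞ κ)
    (hκs : ∀ y, 1 < ‖y‖ → κ y = 0)
    {M : ℝ} {j : ℕ} (hj : j ≠ 0) (hM : ∀ y, ‖iteratedFDeriv ℝ j κ y‖ ≤ M) {k : ℕ} {α μ C : ℝ}
    (hα0 : 0 < α) {f : Euc n → E} (hf : HB n k α (μ+2) C f)
    {l : ℝ} (hl : 0 < l) {x : Euc n} (hlx : l ≤ (1 + ‖x‖) / 4) :
    ‖iteratedFDeriv ℝ (k + j) (piece κ l f) x‖ ≤ M * ballVol n * C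
      * ((1 + ‖x‖) ^ (-(μ + (k + j : ℕ))) * (l / (1 + ‖x‖)) ^ (2 - (j:ℝ) + α)) := by
  have hr : 0 < 1 + ‖x‖ := by positivity
  have hM0 : 0 ≤ M := (norm_nonneg _).trans (hM 0)
  have hC := hf.nonneg
  have hgc : Continuous (iteratedFDeriv ℝ k f) := hf.1.continuous_iteratedFDeriv (m := k) le_rfl
  rw [norm_iteratedFDeriv_piece hκ hκs hl hf.1.continuous, ← norm_iteratedFDeriv_iteratedFDeriv,
    iteratedFDeriv_cv_right (dilate_contDiff hκ l).continuous (dilate_support hκs hl) k hf.1,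
    iteratedFDeriv_cv_sub_const (dilate_contDiff hκ l) (dilate_support hκs hl) hgc
      (iteratedFDeriv ℝ k f x) hj]
  have h1 := norm_iteratedFDeriv_cv_le (dilate_contDiff hκ l) (dilate_support hκs hl) j
    (norm_iteratedFDeriv_dilate_le hκ hl j hM)
    (g := fun y => iteratedFDeriv ℝ k f y - iteratedFDeriv ℝ k f x) (hgc.sub continuous_const) x
  have h2 := setIntegral_norm_closedBall_le
    (g := fun y => iteratedFDeriv ℝ k f y - iteratedFDeriv ℝ k f x) (x := x) hl.le
    (A := C * (1 + ‖x‖) ^ (-(μ + 2 + k + α)) * l ^ α) (fun y hy => by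
      rw [norm_sub_rev]
      refine (hf.2.2 k le_rfl x y (hy.trans hlx)).trans ?_
      gcongr)
  calc _ ≤ l ^ 2 / l ^ n * ((l ^ j)⁻¹ * M * (C * (1 + ‖x‖) ^ (-(μ + 2 + k + α)) * l ^ α
        * (l ^ n * ballVol n))) := by
        gcongr
        exact h1.trans (by gcongr)
    _ = M * ballVol n * C * ((l ^ 2 / l ^ j * l ^ α) * (1 + ‖x‖) ^ (-(μ + 2 + k + α))) := by
        field_simp
    _ = _ := by
        have e1 : l ^ 2 / l ^ j * l ^ α = l ^ (2 - (j:ℝ) + α) := by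
          rw [Real.rpow_add hl, Real.rpow_sub hl, Real.rpow_natCast]
          norm_num
        have e2 : (1 + ‖x‖) ^ (-(μ + 2 + k + α))
            = (1 + ‖x‖) ^ (-(μ + (k + j : ℕ))) / (1 + ‖x‖) ^ (2 - (j:ℝ) + α) := by
          rw [← Real.rpow_sub hr]
          push_cast
          ring_nf
        rw [e1, e2, Real.div_rpow hl.le hr.le]
        ring

theorem piece_far {κ : Euc n → ℝ} (hκ : ContDiff ℝ ∞ κ) (hκs : ∀ y, 1 < ‖y‖ → κ y = 0)
    {M : ℝ} {i : ℕ} (hM : ∀ y, ‖iteratedFDeriv ℝ i κ y‖ ≤ M) {k : ℕ} {α μ C A : ℝ}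
    (hA : ∀ R : ℝ, 0 < R → ∫ y in Metric.closedBall (0 : Euc n) R, (1 + ‖y‖) ^ (-(μ + 2))
      ≤ A * R ^ ((n:ℝ) - (μ + 2)))
    {f : Euc n → E} (hf : HB n k α (μ+2) C f)
    {l : ℝ} (hl : 0 < l) {x : Euc n} (hlx : (1 + ‖x‖) / 4 ≤ l) :
    ‖iteratedFDeriv ℝ i (piece κ l f) x‖ ≤ M * A * 5 ^ ((n:ℝ) - (μ + 2)) * C
      * ((1 + ‖x‖) ^ (-(μ + i)) * (l / (1 + ‖x‖)) ^ (-(μ + i))) := by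
  have hr : 0 < 1 + ‖x‖ := by positivity
  have hM0 : 0 ≤ M := (norm_nonneg _).trans (hM 0)
  have hC := hf.nonneg
  have hwc : Continuous fun y : Euc n => C * (1 + ‖y‖) ^ (-(μ + 2)) := by
    refine continuous_const.mul (Continuous.rpow_const (by fun_prop) fun y => Or.inl ?_)
    positivity
  rw [norm_iteratedFDeriv_piece hκ hκs hl hf.1.continuous]
  have h1 := norm_iteratedFDeriv_cv_le (dilate_contDiff hκ l) (dilate_support hκs hl) i
    (norm_iteratedFDeriv_dilate_le hκ hl i hM) hf.1.continuous x
  have hinteg : ∀ (g : Euc n → ℝ) (_ : Continuous g) (y : Euc n) (R : ℝ),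
      IntegrableOn g (Metric.closedBall y R) := fun g hg y R =>
    hg.continuousOn.integrableOn_compact (isCompact_closedBall _ _)
  have h2 : ∫ y in Metric.closedBall x l, ‖f y‖ ≤ C * (A * (5 * l) ^ ((n:ℝ) - (μ + 2))) := by
    calc ∫ y in Metric.closedBall x l, ‖f y‖
        ≤ ∫ y in Metric.closedBall x l, C * (1 + ‖y‖) ^ (-(μ + 2)) := by
          refine setIntegral_mono (hinteg _ hf.1.continuous.norm _ _) (hinteg _ hwc _ _) fun y => ?_
          have := hf.2.1 0 (Nat.zero_le _) y
          rw [norm_iteratedFDeriv_zero] at this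
          simpa using this
      _ ≤ ∫ y in Metric.closedBall (0 : Euc n) (5 * l), C * (1 + ‖y‖) ^ (-(μ + 2)) := by
          refine setIntegral_mono_set (hinteg _ hwc _ _)
            (Eventually.of_forall fun y => by simp only [Pi.zero_apply]; positivity) ?_
          refine LE.le.eventuallyLE ?_
          refine Metric.closedBall_subset_closedBall' ?_
          rw [dist_zero_right]
          linarith
      _ ≤ C * (A * (5 * l) ^ ((n:ℝ) - (μ + 2))) := by
          rw [integral_const_mul]
          gcongr
          exact hA _ (by positivity)
  calc _ ≤ l ^ 2 / l ^ n * ((l ^ i)⁻¹ * M * (C * (A * (5 * l) ^ ((n:ℝ) - (μ + 2))))) := by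
        gcongr
        exact h1.trans (by gcongr)
    _ = M * A * 5 ^ ((n:ℝ) - (μ + 2)) * C * (l ^ 2 / l ^ n / l ^ i * l ^ ((n:ℝ) - (μ + 2))) := by
        rw [Real.mul_rpow (by norm_num) hl.le]
        field_simp
    _ = _ := by
        have e1 : l ^ 2 / l ^ n / l ^ i * l ^ ((n:ℝ) - (μ + 2)) = l ^ (-(μ + i)) := by
          rw [← Real.rpow_natCast, ← Real.rpow_natCast, ← Real.rpow_natCast, ← Real.rpow_sub hl,
            ← Real.rpow_sub hl, ← Real.rpow_add hl]
          push_cast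
          ring_nf
        rw [e1, ← Real.mul_rpow hr.le (by positivity), mul_div_cancel₀ _ hr.ne']

end Pieces

section PieceBounds

variable {n : ℕ} {E : Type*} [NormedAddCommGroup E] [NormedSpace ℝ E]

theorem exists_iteratedFDeriv_bound {κ : Euc n → ℝ} (hκ : ContDiff ℝ ∞ κ)
    (hκs : ∀ y, 1 < ‖y‖ → κ y = 0) (N : ℕ) :
    ∃ M : ℝ, 0 < M ∧ ∀ j ≤ N, ∀ y, ‖iteratedFDeriv ℝ j κ y‖ ≤ M := by
  have h : ∀ j, ∃ M : ℝ, ∀ y, ‖iteratedFDeriv ℝ j κ y‖ ≤ M := fun j =>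
    (hκ.continuous_iteratedFDeriv (m := j) (by exact_mod_cast le_top)).bounded_above_of_compact_support
      ((hasCompactSupport_of_ball hκs).iteratedFDeriv j)
  choose M hM using h
  have hM0 : ∀ j, 0 ≤ M j := fun j => (norm_nonneg _).trans (hM j 0)
  refine ⟨1 + ∑ j ∈ Finset.range (N+1), M j, ?_, fun j hj y => (hM j y).trans ?_⟩
  · have := Finset.sum_nonneg fun j (_ : j ∈ Finset.range (N+1)) => hM0 j
    positivity
  · have := Finset.single_le_sum (fun j _ => hM0 j) (Finset.mem_range.2 (Nat.lt_succ_of_le hj))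
    linarith

theorem rpow_le_rpow_min_of_le_one {s α μ p : ℝ} (hs : 0 < s) (hs1 : s ≤ 1) (hα : 0 ≤ α)
    (hμ : 0 ≤ μ) (hp : α ≤ p) : s ^ p ≤ min (s ^ α) (s ^ (-μ)) :=
  le_min (Real.rpow_le_rpow_of_exponent_ge hs hs1 hp)
    (Real.rpow_le_rpow_of_exponent_ge hs hs1 (by linarith))

theorem rpow_le_four_rpow_mul {s p q : ℝ} (hs : 1 / 4 ≤ s) (hpq : p ≤ q) :
    s ^ p ≤ 4 ^ (q - p) * s ^ q := by
  have hs0 : 0 < s := by linarith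
  have h1 : 1 ≤ (4 * s) ^ (q - p) := Real.one_le_rpow (by linarith) (by linarith)
  calc s ^ p = 1 * s ^ p := (one_mul _).symm
    _ ≤ (4 * s) ^ (q - p) * s ^ p := by gcongr
    _ = 4 ^ (q - p) * (s ^ (q - p) * s ^ p) := by
        rw [Real.mul_rpow (by norm_num) hs0.le]; ring
    _ = _ := by rw [← Real.rpow_add hs0]; ring_nf

theorem exists_piece_bound [CompleteSpace E] {κ : Euc n → ℝ} (hκ : ContDiff ℝ ∞ κ)
    (hκs : ∀ y, 1 < ‖y‖ → κ y = 0) (k : ℕ) {α μ : ℝ} (hα0 : 0 < α) (hα1 : α ≤ 1) (hμ0 : 0 < μ)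
    (hμ1 : μ < (n:ℝ) - 2) : ∃ K : ℝ, 0 < K ∧ ∀ (C : ℝ) (f : Euc n → E), HB n k α (μ+2) C f →
      ∀ (l : ℝ), 0 < l → ∀ x : Euc n,
      (∀ i ≤ k + 2, ‖iteratedFDeriv ℝ i (piece κ l f) x‖ ≤ K * C * ((1 + ‖x‖) ^ (-(μ + i))
        * min ((l / (1 + ‖x‖)) ^ α) ((l / (1 + ‖x‖)) ^ (-μ)))) ∧
      ‖iteratedFDeriv ℝ (k + 3) (piece κ l f) x‖ ≤ K * C * ((1 + ‖x‖) ^ (-(μ + (k + 3 : ℕ)))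
        * (l / (1 + ‖x‖)) ^ (α - 1)) := by
  obtain ⟨M, hM0, hM⟩ := exists_iteratedFDeriv_bound hκ hκs (k + 3)
  have hn : 1 ≤ n := by
    have : (1:ℝ) < n := by linarith
    exact_mod_cast this.le
  obtain ⟨A, hA0, hA⟩ := exists_integral_ball_le n hn (s := μ + 2) (by linarith) (by linarith)
  have hV := ballVol_nonneg n
  set K₁ := M * ballVol n * 2 ^ (μ + 2 + k) with hK₁
  set K₂ := M * A * 5 ^ ((n:ℝ) - (μ + 2)) * 4 ^ (μ + (k + 3 : ℕ) + α) with hK₂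
  have hK₁0 : 0 ≤ K₁ := by positivity
  have hK₂0 : 0 < K₂ := by positivity
  have hK₁' : M * ballVol n ≤ K₁ := by
    refine le_mul_of_one_le_right (by positivity) (Real.one_le_rpow (by norm_num) (by positivity))
  refine ⟨K₁ + K₂, by positivity, fun C f hf l hl x => ?_⟩
  have hC := hf.nonneg
  have hr : 0 < 1 + ‖x‖ := by positivity
  have hs : 0 < l / (1 + ‖x‖) := by positivity
  have hMκ : ∀ y, |κ y| ≤ M := fun y => by
    simpa [norm_iteratedFDeriv_zero] using hM 0 (Nat.zero_le _) y
  have hadd : ∀ {a t u : ℝ}, 0 ≤ t → 0 ≤ u → a ≤ K₁ ∨ a ≤ K₂ →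
      a * C * (t * u) ≤ (K₁ + K₂) * C * (t * u) := by
    intro a t u ht hu h
    have : a ≤ K₁ + K₂ := by rcases h with h | h <;> linarith
    gcongr
  rcases le_total l ((1 + ‖x‖) / 4) with hlx | hlx
  · have hs1 : l / (1 + ‖x‖) ≤ 1 := by rw [div_le_one hr]; linarith
    have hmn : 0 ≤ min ((l / (1 + ‖x‖)) ^ α) ((l / (1 + ‖x‖)) ^ (-μ)) := by positivity
    constructor
    · intro i hi
      rcases Nat.lt_or_ge k i with hik | hik
      · obtain ⟨j, rfl⟩ := Nat.exists_eq_add_of_lt hik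
        rw [show k + j + 1 = k + (j + 1) by ring] at hi ⊢
        refine (piece_local_high hκ hκs (Nat.succ_ne_zero j) (hM (j+1) (by omega)) hα0 hf hl hlx).trans ?_
        refine le_trans ?_ (hadd (by positivity) hmn (Or.inl hK₁'))
        gcongr
        refine rpow_le_rpow_min_of_le_one hs hs1 hα0.le hμ0.le ?_
        have : ((j + 1 : ℕ) : ℝ) ≤ 2 := by
          have : j + 1 ≤ 2 := by omega
          exact_mod_cast this
        linarith
      · refine (piece_local_low hκ hκs hMκ hf hl hlx hik).trans ?_
        refine le_trans ?_ (hadd (a := M * ballVol n * 2 ^ |μ + 2 + i|) (by positivity) hmn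
          (Or.inl ?_))
        · gcongr
          have := rpow_le_rpow_min_of_le_one (p := 2) hs hs1 hα0.le hμ0.le (by linarith)
          rwa [Real.rpow_two] at this
        · rw [abs_of_nonneg (by positivity)]
          have : (i:ℝ) ≤ k := by exact_mod_cast hik
          rw [hK₁]
          gcongr
          norm_num
    · refine (piece_local_high hκ hκs (j := 3) (by norm_num) (hM 3 (by omega)) hα0 hf hl hlx).trans ?_
      refine le_trans (le_of_eq ?_) (hadd (by positivity) (by positivity) (Or.inl hK₁'))
      congr 3
      push_cast
      ring
  · have hs1 : 1 / 4 ≤ l / (1 + ‖x‖) := by rw [le_div_iff₀ hr]; linarith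
    have hmn : 0 ≤ min ((l / (1 + ‖x‖)) ^ α) ((l / (1 + ‖x‖)) ^ (-μ)) := by positivity
    have key : ∀ i ≤ k + 3, ∀ q : ℝ, -(μ + i) ≤ q → q ≤ α →
        (l / (1 + ‖x‖)) ^ (-(μ + i)) ≤ 4 ^ (μ + (k + 3 : ℕ) + α) * (l / (1 + ‖x‖)) ^ q := by
      intro i hi q hq hq'
      refine (rpow_le_four_rpow_mul hs1 hq).trans ?_
      have : (i:ℝ) ≤ (k + 3 : ℕ) := by exact_mod_cast hi
      gcongr
      · norm_num
      · linarith
    constructor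
    · intro i hi
      refine (piece_far hκ hκs (hM i (by omega)) hA hf hl hlx).trans ?_
      refine le_trans ?_ (hadd (by positivity) hmn (Or.inr le_rfl))
      rw [hK₂]
      have h1 : (l / (1 + ‖x‖)) ^ (-(μ + i)) ≤ 4 ^ (μ + (k + 3 : ℕ) + α)
          * min ((l / (1 + ‖x‖)) ^ α) ((l / (1 + ‖x‖)) ^ (-μ)) := by
        have hi0 : (0:ℝ) ≤ i := by positivity
        rw [mul_min_of_nonneg _ _ (by positivity)]
        exact le_min (key i (by omega) α (by linarith) le_rfl)
          (key i (by omega) (-μ) (by linarith) (by linarith))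
      calc _ ≤ M * A * 5 ^ ((n:ℝ) - (μ + 2)) * C * ((1 + ‖x‖) ^ (-(μ + i)) *
            (4 ^ (μ + (k + 3 : ℕ) + α)
              * min ((l / (1 + ‖x‖)) ^ α) ((l / (1 + ‖x‖)) ^ (-μ)))) := by gcongr
        _ = _ := by ring
    · refine (piece_far hκ hκs (hM (k+3) le_rfl) hA hf hl hlx).trans ?_
      refine le_trans ?_ (hadd (by positivity) (by positivity) (Or.inr le_rfl))
      rw [hK₂]
      have h1 := key (k+3) le_rfl (α - 1) (by push_cast; have : (0:ℝ) ≤ k := by positivity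
                                              linarith) (by linarith)
      calc _ ≤ M * A * 5 ^ ((n:ℝ) - (μ + 2)) * C * ((1 + ‖x‖) ^ (-(μ + (k + 3 : ℕ))) *
            (4 ^ (μ + (k + 3 : ℕ) + α) * (l / (1 + ‖x‖)) ^ (α - 1))) := by gcongr
        _ = _ := by ring

end PieceBounds

section Newton

variable {n : ℕ}

/-- The dyadic sum of convolutions inverting the Laplacian. -/
def newton (κ : Euc n → ℝ) (f : Euc n → ℝ) (x : Euc n) : ℝ := ∑' m : ℤ, piece κ ((2:ℝ) ^ m) f x

theorem weight_mul_min_le {r l α μ i : ℝ} (hr : 1 ≤ r) (hl : 0 < l) (hα : 0 ≤ α) (hμ : 0 ≤ μ)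
    (hi : 0 ≤ i) : r ^ (-(μ + i)) * min ((l / r) ^ α) ((l / r) ^ (-μ)) ≤ min (l ^ α) (l ^ (-μ)) := by
  have hr0 : 0 < r := by linarith
  rw [mul_min_of_nonneg _ _ (by positivity)]
  refine min_le_min ?_ ?_
  · calc r ^ (-(μ + i)) * (l / r) ^ α ≤ 1 * l ^ α := by
          gcongr
          · exact Real.rpow_le_one_of_one_le_of_nonpos hr (by linarith)
          · exact div_le_self hl.le hr
      _ = _ := one_mul _
  · rw [Real.div_rpow hl.le hr0.le, neg_add, Real.rpow_add hr0]
    have : r ^ (-i) ≤ 1 := Real.rpow_le_one_of_one_le_of_nonpos hr (by linarith)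
    have h2 : 0 < r ^ (-μ) := by positivity
    calc r ^ (-μ) * r ^ (-i) * (l ^ (-μ) / r ^ (-μ)) = r ^ (-i) * l ^ (-μ) := by field_simp
      _ ≤ 1 * l ^ (-μ) := by gcongr
      _ = _ := one_mul _

/-- Uniform control of the terms of a dyadic series of functions by the weights adapted to order
`k` and decay `μ`. -/
def DyadicBound (n : ℕ) (k : ℕ) (α μ C : ℝ) (p : ℤ → Euc n → ℝ) : Prop :=
  (∀ m, ContDiff ℝ ∞ (p m)) ∧ ∀ (m : ℤ) (x : Euc n),
    (∀ i ≤ k, ‖iteratedFDeriv ℝ i (p m) x‖ ≤ C * ((1 + ‖x‖) ^ (-(μ + i))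
      * min (((2:ℝ) ^ m / (1 + ‖x‖)) ^ α) (((2:ℝ) ^ m / (1 + ‖x‖)) ^ (-μ)))) ∧
    ‖iteratedFDeriv ℝ (k + 1) (p m) x‖ ≤ C * ((1 + ‖x‖) ^ (-(μ + (k + 1 : ℕ)))
      * ((2:ℝ) ^ m / (1 + ‖x‖)) ^ (α - 1))

section Dyadic

variable {k : ℕ} {α μ C : ℝ} {p : ℤ → Euc n → ℝ}

theorem DyadicBound.nonneg (hp : DyadicBound n k α μ C p) : 0 ≤ C := by
  have := (hp.2 0 0).1 0 (Nat.zero_le _)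
  simpa using (norm_nonneg _).trans this

theorem DyadicBound.uniform (hp : DyadicBound n k α μ C p) (hα0 : 0 < α) (hμ0 : 0 < μ) (i : ℕ)
    (m : ℤ) (x : Euc n) (hi : i ≤ k) : ‖iteratedFDeriv ℝ i (p m) x‖
      ≤ C * min (((2:ℝ) ^ m) ^ α) (((2:ℝ) ^ m) ^ (-μ)) := by
  have hC := hp.nonneg
  refine ((hp.2 m x).1 i hi).trans ?_
  gcongr
  exact weight_mul_min_le (by linarith [norm_nonneg x]) (by positivity) hα0.le hμ0.le
    (by positivity)

theorem DyadicBound.contDiff (hp : DyadicBound n k α μ C p) (hα0 : 0 < α) (hμ0 : 0 < μ) :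
    ContDiff ℝ k (fun x => ∑' m, p m x) := by
  have := contDiff_tsum (𝕜 := ℝ) (N := (k : ℕ∞)) (f := p)
    (v := fun _ m => C * min (((2:ℝ) ^ m) ^ α) (((2:ℝ) ^ m) ^ (-μ)))
    (fun m => (hp.1 m).of_le (by exact_mod_cast le_top))
    (fun _ _ => (summable_two_zpow hα0 hμ0).mul_left C)
    (fun i m x hi => hp.uniform hα0 hμ0 i m x (by exact_mod_cast hi))
  exact_mod_cast this

theorem DyadicBound.hasSum (hp : DyadicBound n k α μ C p) (hα0 : 0 < α) (hμ0 : 0 < μ) {i : ℕ}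
    (hi : i ≤ k) (x : Euc n) : HasSum (fun m => iteratedFDeriv ℝ i (p m) x)
      (iteratedFDeriv ℝ i (fun x => ∑' m, p m x) x) := by
  rw [iteratedFDeriv_tsum_apply (𝕜 := ℝ) (N := (k : ℕ∞)) (f := p)
    (v := fun _ m => C * min (((2:ℝ) ^ m) ^ α) (((2:ℝ) ^ m) ^ (-μ)))
    (fun m => (hp.1 m).of_le (by exact_mod_cast le_top))
    (fun _ _ => (summable_two_zpow hα0 hμ0).mul_left C)
    (fun i m x hi => hp.uniform hα0 hμ0 i m x (by exact_mod_cast hi)) (by exact_mod_cast hi)]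
  exact (Summable.of_norm_bounded ((summable_two_zpow hα0 hμ0).mul_left C)
    (fun m => hp.uniform hα0 hμ0 i m x hi)).hasSum

theorem DyadicBound.norm_sub_le (hp : DyadicBound n k α μ C p) (hα0 : 0 < α) (hα1 : α < 1)
    (hμ0 : 0 < μ) {x y : Euc n} (hxy : ‖x - y‖ ≤ (1 + ‖x‖) / 4) (hne : 0 < ‖x - y‖) (m : ℤ) :
    ‖iteratedFDeriv ℝ k (p m) x - iteratedFDeriv ℝ k (p m) y‖
      ≤ C * (1 + 2 ^ (μ + k + α)) * ((1 + ‖x‖) ^ (-(μ + k + α)) * ‖x - y‖ ^ α)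
        * min (((2:ℝ) ^ m / ‖x - y‖) ^ α) (((2:ℝ) ^ m / ‖x - y‖) ^ (-(1 - α))) := by
  have hC := hp.nonneg
  have hr : 0 < 1 + ‖x‖ := by positivity
  set l : ℝ := 2 ^ m with hl
  set h := ‖x - y‖ with hh
  have hl0 : 0 < l := by positivity
  set q := μ + k + α with hq
  have hq0 : 0 < q := by positivity
  have hcmp : ∀ z : Euc n, ‖x - z‖ ≤ (1 + ‖x‖) / 4 →
      (1 + ‖z‖) ^ (-q) ≤ 2 ^ q * (1 + ‖x‖) ^ (-q) := by
    intro z hz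
    obtain ⟨c1, c2⟩ := one_add_norm_comparable hz
    have := rpow_le_of_comparable hr c1 c2 (-q)
    rwa [abs_neg, abs_of_pos hq0] at this
  have hval : ∀ z : Euc n, ‖iteratedFDeriv ℝ k (p m) z‖ ≤ C * ((1 + ‖z‖) ^ (-q) * l ^ α) := by
    intro z
    have hz : 0 < 1 + ‖z‖ := by positivity
    refine ((hp.2 m z).1 k le_rfl).trans ?_
    calc _ ≤ C * ((1 + ‖z‖) ^ (-(μ + k)) * (l / (1 + ‖z‖)) ^ α) := by
          gcongr
          exact min_le_left _ _
      _ = _ := by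
          rw [Real.div_rpow hl0.le hz.le, hq, neg_add (μ + (k:ℝ)), Real.rpow_add hz,
            Real.rpow_neg hz.le α]
          field_simp
  have hder : ∀ z : Euc n, ‖iteratedFDeriv ℝ (k+1) (p m) z‖
      ≤ C * ((1 + ‖z‖) ^ (-q) * l ^ (α - 1)) := by
    intro z
    have hz : 0 < 1 + ‖z‖ := by positivity
    refine (hp.2 m z).2.trans (le_of_eq ?_)
    rw [Real.div_rpow hl0.le hz.le, show -q = -(μ + (k + 1 : ℕ)) - (α - 1) by
      rw [hq]; push_cast; ring, Real.rpow_sub hz _ (α - 1)]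
    field_simp
  rw [mul_min_of_nonneg _ _ (by positivity)]
  refine le_min ?_ ?_
  · calc _ ≤ C * ((1 + ‖x‖) ^ (-q) * l ^ α) + C * ((1 + ‖y‖) ^ (-q) * l ^ α) :=
          (_root_.norm_sub_le _ _).trans (add_le_add (hval x) (hval y))
      _ ≤ C * ((1 + ‖x‖) ^ (-q) * l ^ α) + C * (2 ^ q * (1 + ‖x‖) ^ (-q) * l ^ α) := by
          gcongr
          exact hcmp y hxy
      _ = _ := by
          rw [Real.div_rpow hl0.le hne.le]
          field_simp
  · have hd : Differentiable ℝ (iteratedFDeriv ℝ k (p m)) :=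
      (hp.1 m).differentiable_iteratedFDeriv (by exact_mod_cast WithTop.coe_lt_top _)
    have := norm_sub_le_of_fderiv_le hd (x := x) (y := y) (ρ := h)
      (M := C * (2 ^ q * (1 + ‖x‖) ^ (-q) * l ^ (α - 1))) (fun z hz => by
        rw [norm_fderiv_iteratedFDeriv]
        refine (hder z).trans ?_
        gcongr
        exact hcmp z (hz.trans hxy)) le_rfl
    refine this.trans ?_
    calc C * (2 ^ q * (1 + ‖x‖) ^ (-q) * l ^ (α - 1)) * h
        ≤ C * ((1 + 2 ^ q) * (1 + ‖x‖) ^ (-q) * l ^ (α - 1)) * h := by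
          gcongr
          linarith
      _ = _ := by
          rw [Real.div_rpow hl0.le hne.le, neg_sub, Real.rpow_sub hne, Real.rpow_one]
          field_simp

end Dyadic

theorem DyadicBound.hB (k : ℕ) {α μ : ℝ} (hα0 : 0 < α) (hα1 : α < 1) (hμ0 : 0 < μ) :
    ∃ K : ℝ, 0 < K ∧ ∀ (C : ℝ) (p : ℤ → Euc n → ℝ), DyadicBound n k α μ C p →
      HB n k α μ (K * C) (fun x => ∑' m, p m x) := by
  obtain ⟨A, hA0, hA⟩ := exists_dyadic_sum_bound hα0 hμ0
  obtain ⟨B, hB0, hB⟩ := exists_dyadic_sum_bound hα0 (sub_pos.2 hα1)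
  refine ⟨2 ^ (|μ| + k) * (A + (1 + 2 ^ (μ + k + α)) * B), by positivity, fun C p hp => ?_⟩
  have hC := hp.nonneg
  rw [mul_assoc]
  refine HB.of_top hα0 hα1.le (hp.contDiff hα0 hμ0) ?_ ?_
  · intro i hi x
    have hr : 0 < 1 + ‖x‖ := by positivity
    obtain ⟨hs, hb⟩ := hA (1 + ‖x‖) hr
    have hs' := (hs.hasSum.mul_left ((1 + ‖x‖) ^ (-(μ + i)))).mul_left C
    rw [← (hp.hasSum hα0 hμ0 hi x).tsum_eq]
    refine (tsum_of_norm_bounded hs' fun m => (hp.2 m x).1 i hi).trans ?_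
    calc _ ≤ C * ((1 + ‖x‖) ^ (-(μ + i)) * A) := by gcongr
      _ = A * C * (1 + ‖x‖) ^ (-(μ + i)) := by ring
      _ ≤ _ := by
        gcongr
        have : 0 < (1 + (2:ℝ) ^ (μ + k + α)) * B := by positivity
        linarith
  · intro x y hxy
    rcases (norm_nonneg (x - y)).eq_or_lt with h0 | hne
    · have : x = y := sub_eq_zero.1 (norm_eq_zero.1 h0.symm)
      subst this
      simp only [sub_self, norm_zero]
      positivity
    obtain ⟨hs, hb⟩ := hB ‖x - y‖ hne
    have hs' := hs.hasSum.mul_left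
      (C * (1 + 2 ^ (μ + k + α)) * ((1 + ‖x‖) ^ (-(μ + k + α)) * ‖x - y‖ ^ α))
    rw [← ((hp.hasSum hα0 hμ0 le_rfl x).sub (hp.hasSum hα0 hμ0 le_rfl y)).tsum_eq]
    refine (tsum_of_norm_bounded hs' fun m =>
      hp.norm_sub_le hα0 hα1 hμ0 hxy hne m).trans ?_
    calc _ ≤ C * (1 + 2 ^ (μ + k + α)) * ((1 + ‖x‖) ^ (-(μ + k + α)) * ‖x - y‖ ^ α) * B := by
          gcongr
      _ = ((1 + 2 ^ (μ + k + α)) * B) * C * (1 + ‖x‖) ^ (-(μ + k + α)) * ‖x - y‖ ^ α := by ring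
      _ ≤ _ := by
        gcongr
        linarith

theorem exists_dyadicBound_piece {κ : Euc n → ℝ} (hκ : ContDiff ℝ ∞ κ)
    (hκs : ∀ y, 1 < ‖y‖ → κ y = 0) (k : ℕ) {α μ : ℝ} (hα0 : 0 < α) (hα1 : α ≤ 1) (hμ0 : 0 < μ)
    (hμ1 : μ < (n:ℝ) - 2) : ∃ K : ℝ, 0 < K ∧ ∀ (C : ℝ) (f : Euc n → ℝ), HB n k α (μ+2) C f →
      DyadicBound n (k + 2) α μ (K * C) (fun m => piece κ ((2:ℝ) ^ m) f) := by
  obtain ⟨K, hK0, hK⟩ := exists_piece_bound (E := ℝ) hκ hκs k hα0 hα1 hμ0 hμ1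
  exact ⟨K, hK0, fun C f hf => ⟨fun m => piece_contDiff hκ hκs (by positivity) hf.1.continuous,
    fun m x => hK C f hf _ (by positivity) x⟩⟩

theorem exists_newton_bound {κ : Euc n → ℝ} (hκ : ContDiff ℝ ∞ κ)
    (hκs : ∀ y, 1 < ‖y‖ → κ y = 0) (k : ℕ) {α μ : ℝ} (hα0 : 0 < α) (hα1 : α < 1) (hμ0 : 0 < μ)
    (hμ1 : μ < (n:ℝ) - 2) : ∃ K : ℝ, 0 < K ∧ ∀ (C : ℝ) (f : Euc n → ℝ), HB n k α (μ+2) C f →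
      HB n (k + 2) α μ (K * C) (newton κ f) := by
  obtain ⟨K, hK0, hK⟩ := exists_dyadicBound_piece hκ hκs k hα0 hα1.le hμ0 hμ1
  obtain ⟨K', hK'0, hK'⟩ := DyadicBound.hB (n := n) (k + 2) hα0 hα1 hμ0
  refine ⟨K' * K, by positivity, fun C f hf => ?_⟩
  rw [mul_assoc]
  exact hK' _ _ (hK C f hf)

end Newton

section Telescope

variable {n : ℕ}

theorem hasSum_telescope {a : ℤ → ℝ} {A L : ℝ} (h : HasSum (fun m => a (m - 1) - a m) A)
    (hbot : Tendsto a atBot (𝓝 L)) (htop : Tendsto a atTop (𝓝 0)) : A = L := by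
  have hpart : ∀ N : ℕ, ∑ m ∈ Finset.Ico (-(N:ℤ)) N, (a (m - 1) - a m)
      = a (-(N:ℤ) - 1) - a ((N:ℤ) - 1) := by
    intro N
    induction N with
    | zero => simp
    | succ N ih =>
      have e : Finset.Ico (-((N + 1 : ℕ) : ℤ)) ((N + 1 : ℕ) : ℤ)
          = insert (-((N:ℤ) + 1)) (insert (N:ℤ) (Finset.Ico (-(N:ℤ)) N)) := by
        ext m
        simp only [Finset.mem_Ico, Finset.mem_insert]
        push_cast
        omega
      rw [e, Finset.sum_insert (by simp), Finset.sum_insert (by simp), ih]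
      push_cast
      rw [show -((N:ℤ) + 1) = -(N:ℤ) - 1 by ring, show (N:ℤ) + 1 - 1 = N by ring]
      ring
  have h1 := h.comp (Finset.tendsto_Ico_neg (R := ℤ))
  have h2 : Tendsto (fun N : ℕ => a (-(N:ℤ) - 1) - a ((N:ℤ) - 1)) atTop (𝓝 (L - 0)) := by
    refine (hbot.comp ?_).sub (htop.comp ?_)
    · refine tendsto_atBot_add_const_right _ _ ?_
      exact tendsto_neg_atTop_atBot.comp tendsto_natCast_atTop_atTop
    · exact tendsto_atTop_add_const_right _ (-1) tendsto_natCast_atTop_atTop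
  rw [sub_zero] at h2
  refine tendsto_nhds_unique (h1.congr fun N => ?_) h2
  exact hpart N

/-- The average of `f` against the dilate of `σ` at scale `l`. -/
def avg (σ : Euc n → ℝ) (l : ℝ) (f : Euc n → ℝ) (x : Euc n) : ℝ :=
  (l ^ n)⁻¹ * cv (fun y => σ (l⁻¹ • y)) f x

theorem avg_eq_piece (σ : Euc n → ℝ) {l : ℝ} (hl : 0 < l) (f : Euc n → ℝ) (x : Euc n) :
    avg σ l f x = (l ^ 2)⁻¹ * piece σ l f x := by
  unfold avg piece
  rw [smul_eq_mul]
  field_simp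

theorem avg_tendsto_zero {σ : Euc n → ℝ} (hσ : ContDiff ℝ ∞ σ) (hσs : ∀ y, 1 < ‖y‖ → σ y = 0)
    {k : ℕ} {α w C : ℝ} (hw0 : 0 < w) (hw : w < n) {f : Euc n → ℝ}
    (hf : HB n k α w C f) (x : Euc n) : Tendsto (fun l => avg σ l f x) atTop (𝓝 0) := by
  obtain ⟨M, hM0, hM⟩ := exists_iteratedFDeriv_bound hσ hσs 0
  have hn : 1 ≤ n := by
    have : (0:ℝ) < n := by linarith
    exact_mod_cast this
  obtain ⟨A, hA0, hA⟩ := exists_integral_ball_le n hn hw0.le hw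
  have hr : 0 < 1 + ‖x‖ := by positivity
  have hb : ∀ l : ℝ, 1 + ‖x‖ ≤ l → ‖avg σ l f x‖ ≤ M * A * 5 ^ ((n:ℝ) - w) * C * l ^ (-w) := by
    intro l hl
    have hl0 : 0 < l := by linarith
    have hw2 : w = w - 2 + 2 := by ring
    have := piece_far (E := ℝ) hσ hσs (hM 0 le_rfl) (μ := w - 2) (A := A) (by rwa [← hw2])
      (by rwa [← hw2]) hl0 (x := x) (by linarith) (C := C) (k := k) (α := α) (f := f)
    rw [norm_iteratedFDeriv_zero, ← hw2, ← Real.mul_rpow hr.le (by positivity),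
      mul_div_cancel₀ _ hr.ne'] at this
    rw [avg_eq_piece σ hl0, norm_mul, Real.norm_of_nonneg (by positivity)]
    calc _ ≤ (l ^ 2)⁻¹ * (M * A * 5 ^ ((n:ℝ) - w) * C * l ^ (-(w - 2 + (0:ℕ)))) := by gcongr
      _ = _ := by
        rw [show -(w - 2 + ((0:ℕ):ℝ)) = -w + (2:ℕ) by push_cast; ring, Real.rpow_add hl0,
          Real.rpow_natCast]
        field_simp
  refine squeeze_zero_norm' (eventually_atTop.2 ⟨_, hb⟩) ?_
  have := (tendsto_rpow_neg_atTop hw0).const_mul (M * A * 5 ^ ((n:ℝ) - w) * C)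
  rwa [mul_zero] at this

theorem avg_tendsto_self {σ : Euc n → ℝ} (hσ : ContDiff ℝ ∞ σ) (hσs : ∀ y, 1 < ‖y‖ → σ y = 0)
    (hσ1 : ∫ y, σ y = 1) {f : Euc n → ℝ} (hf : Continuous f) (x : Euc n) :
    Tendsto (fun l => avg σ l f x) (𝓝[>] 0) (𝓝 (f x)) := by
  obtain ⟨M, hM0, hM⟩ := exists_iteratedFDeriv_bound hσ hσs 0
  have hMσ : ∀ y, |σ y| ≤ M := fun y => by
    simpa [norm_iteratedFDeriv_zero] using hM 0 le_rfl y
  have hV := ballVol_nonneg n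
  rw [Metric.tendsto_nhds]
  intro ε hε
  set η := ε / (2 * (M * ballVol n + 1)) with hη
  have hη0 : 0 < η := by positivity
  obtain ⟨ρ, hρ, hρf⟩ := Metric.continuousAt_iff.1 hf.continuousAt η hη0
  filter_upwards [Ioo_mem_nhdsGT hρ] with l hl
  have hl0 : 0 < l := hl.1
  have hinteg : ∫ t, σ (l⁻¹ • t) = l ^ n := by
    rw [Measure.integral_comp_inv_smul_of_nonneg volume σ hl0.le, hσ1]
    simp
  have e := cv_sub_const (dilate_contDiff hσ l).continuous (dilate_support hσs hl0) hf (f x) x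
  have h1 := norm_cv_le (dilate_support hσs hl0) (M := M) (fun y => hMσ _)
    (g := fun y => f y - f x) (hf.sub continuous_const) x
  have h2 := setIntegral_norm_closedBall_le (g := fun y => f y - f x) (x := x) hl0.le (A := η)
    (fun y hy => by
      rw [← dist_eq_norm]
      refine (hρf ?_).le
      rw [dist_comm, dist_eq_norm]
      exact hy.trans_lt hl.2)
  rw [Real.dist_eq]
  unfold avg
  rw [e, hinteg, smul_eq_mul, mul_add, inv_mul_cancel_left₀ (by positivity), add_sub_cancel_right,
    abs_mul, abs_of_nonneg (by positivity)]
  calc (l ^ n)⁻¹ * |cv (fun y => σ (l⁻¹ • y)) (fun y => f y - f x) x|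
      ≤ (l ^ n)⁻¹ * (M * (η * (l ^ n * ballVol n))) := by
        gcongr
        exact h1.trans (by gcongr)
    _ = (M * ballVol n) * η := by field_simp
    _ ≤ (M * ballVol n + 1) * η := by gcongr; linarith
    _ = ε / 2 := by rw [hη]; field_simp
    _ < ε := by linarith

theorem pder_comp_smul (u : Euc n → ℝ) (c : ℝ) (j : Fin n) (x : Euc n) :
    pder n (fun y => u (c • y)) j x = c * pder n u j (c • x) := by
  unfold pder
  rw [fderiv_comp_smul]
  rfl

theorem pder_const_mul (u : Euc n → ℝ) (c : ℝ) (j : Fin n) (x : Euc n) :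
    pder n (fun y => c * u y) j x = c * pder n u j x := by
  unfold pder
  have := congrFun (fderiv_const_smul_field (𝕜 := ℝ) (f := u) c) x
  exact congrArg (fun L => L (EuclideanSpace.single j 1)) this

theorem lap_comp_smul (u : Euc n → ℝ) (c : ℝ) (x : Euc n) :
    lap n (fun y => u (c • y)) x = c ^ 2 * lap n u (c • x) := by
  unfold lap
  rw [Finset.mul_sum]
  refine Finset.sum_congr rfl fun j _ => ?_
  simp_rw [pder_comp_smul, pder_const_mul]
  rw [pder_comp_smul (fun y => pder n u j y)]
  ring

theorem ContDiff.pder {u : Euc n → ℝ} {N M : WithTop ℕ∞} (hu : ContDiff ℝ N u) (j : Fin n)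
    (h : M + 1 ≤ N) : ContDiff ℝ M (fun y => _root_.pder n u j y) :=
  (hu.fderiv_right h).clm_apply contDiff_const

theorem pder_support {u : Euc n → ℝ} {l : ℝ} (hu : ∀ y, l < ‖y‖ → u y = 0) (j : Fin n)
    (y : Euc n) (hy : l < ‖y‖) : pder n u j y = 0 := by
  have : u =ᶠ[𝓝 y] fun _ => 0 := by
    filter_upwards [(isOpen_lt continuous_const continuous_norm).mem_nhds hy] with z hz
    exact hu z hz
  unfold pder
  rw [this.fderiv_eq]
  simp

theorem pder_cv_left {K g : Euc n → ℝ} (hK : ContDiff ℝ ∞ K) (hc : HasCompactSupport K)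
    (hg : Continuous g) (j : Fin n) (x : Euc n) :
    pder n (cv K g) j x = cv (fun y => pder n K j y) g x := fderiv_cv_left hK hc hg x _

theorem pder_cv_right {K g : Euc n → ℝ} {l : ℝ} (hK : Continuous K)
    (hl : ∀ y, l < ‖y‖ → K y = 0) (hg : ContDiff ℝ 1 g) (j : Fin n) (x : Euc n) :
    pder n (cv K g) j x = cv K (fun y => pder n g j y) x := by
  unfold pder
  rw [(hasFDerivAt_cv_right hK hl hg x).fderiv, cv_apply, cv_apply,
    ContinuousLinearMap.integral_apply
      (integrable_cv hK (hasCompactSupport_of_ball hl) (hg.continuous_fderiv (by simp)) x)]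
  rfl

theorem sum_cv_pder_pder {κ σ : Euc n → ℝ} (hκ : ContDiff ℝ ∞ κ) (hσ : ContDiff ℝ ∞ σ)
    (hκs : ∀ y, 1 < ‖y‖ → κ y = 0) (hσs : ∀ y, 1 < ‖y‖ → σ y = 0)
    (hlap : ∀ x, lap n κ x = 2 ^ n * σ ((2:ℝ) • x) - σ x) {l : ℝ} (hl : 0 < l) {g : Euc n → ℝ}
    (hg : Continuous g) (x : Euc n) :
    l ^ 2 / l ^ n * ∑ j, cv (fun y => pder n (fun z => pder n (fun w => κ (l⁻¹ • w)) j z) j y) g x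
      = avg σ (l / 2) g x - avg σ l g x := by
  have hK := dilate_contDiff hκ l
  have hKs := dilate_support hκs hl
  have hl2 : 0 < l / 2 := by positivity
  have hi1 : Integrable fun t => σ ((l / 2)⁻¹ • t) • g (x - t) :=
    integrable_cv (dilate_contDiff hσ _).continuous
      (hasCompactSupport_of_ball (dilate_support hσs hl2)) hg x
  have hi2 : Integrable fun t => σ (l⁻¹ • t) • g (x - t) :=
    integrable_cv (dilate_contDiff hσ _).continuous
      (hasCompactSupport_of_ball (dilate_support hσs hl)) hg x
  have hsum : ∑ j, cv (fun y => pder n (fun z => pder n (fun w => κ (l⁻¹ • w)) j z) j y) g x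
      = ∫ t, lap n (fun w => κ (l⁻¹ • w)) t * g (x - t) := by
    simp_rw [cv_apply]
    rw [← integral_finsetSum _ fun j _ => ?_]
    · simp_rw [lap, Finset.sum_mul, smul_eq_mul]
    · refine integrable_cv ?_ (hasCompactSupport_of_ball (l := l) ?_) hg x
      · exact ((hK.pder j (M := ∞) (by simp)).pder j (M := ∞) (by simp)).continuous
      · exact pder_support (pder_support hKs j) j
  rw [hsum]
  have hfun : (fun t => lap n (fun w => κ (l⁻¹ • w)) t * g (x - t))
      = fun t => (l ^ 2)⁻¹ * (2 ^ n * (σ ((l / 2)⁻¹ • t) • g (x - t)) - σ (l⁻¹ • t) • g (x - t)) := by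
    ext t
    rw [lap_comp_smul, hlap, smul_smul, show (2:ℝ) * l⁻¹ = (l / 2)⁻¹ by field_simp, inv_pow]
    simp only [smul_eq_mul]
    ring
  rw [hfun, integral_const_mul, integral_sub (hi1.const_mul _) hi2, integral_const_mul]
  unfold avg
  rw [cv_apply, cv_apply, div_pow]
  generalize ∫ t, σ ((l / 2)⁻¹ • t) • g (x - t) = a
  generalize ∫ t, σ (l⁻¹ • t) • g (x - t) = b
  field_simp

theorem lap_piece {κ σ : Euc n → ℝ} (hκ : ContDiff ℝ ∞ κ) (hσ : ContDiff ℝ ∞ σ)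
    (hκs : ∀ y, 1 < ‖y‖ → κ y = 0) (hσs : ∀ y, 1 < ‖y‖ → σ y = 0)
    (hlap : ∀ x, lap n κ x = 2 ^ n * σ ((2:ℝ) • x) - σ x) {l : ℝ} (hl : 0 < l) {g : Euc n → ℝ}
    (hg : Continuous g) (x : Euc n) :
    lap n (piece κ l g) x = avg σ (l / 2) g x - avg σ l g x := by
  rw [← sum_cv_pder_pder hκ hσ hκs hσs hlap hl hg x, Finset.mul_sum]
  refine Finset.sum_congr rfl fun j _ => ?_
  have hK := dilate_contDiff hκ l
  have hKs := dilate_support hκs hl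
  unfold piece
  simp_rw [smul_eq_mul, pder_const_mul]
  have e : pder n (cv (fun y => κ (l⁻¹ • y)) g) j
      = cv (fun z => pder n (fun w => κ (l⁻¹ • w)) j z) g :=
    funext fun y => pder_cv_left hK (hasCompactSupport_of_ball hKs) hg j y
  rw [e, pder_cv_left (hK.pder j (M := ∞) (by simp))
    (hasCompactSupport_of_ball (pder_support hKs j)) hg j x]

theorem div_piece_grad {κ σ : Euc n → ℝ} (hκ : ContDiff ℝ ∞ κ) (hσ : ContDiff ℝ ∞ σ)
    (hκs : ∀ y, 1 < ‖y‖ → κ y = 0) (hσs : ∀ y, 1 < ‖y‖ → σ y = 0)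
    (hlap : ∀ x, lap n κ x = 2 ^ n * σ ((2:ℝ) • x) - σ x) {l : ℝ} (hl : 0 < l) {g : Euc n → ℝ}
    (hg : ContDiff ℝ 1 g) (x : Euc n) :
    ∑ j, pder n (piece κ l (fun y => pder n g j y)) j x = avg σ (l / 2) g x - avg σ l g x := by
  rw [← sum_cv_pder_pder hκ hσ hκs hσs hlap hl hg.continuous x, Finset.mul_sum]
  refine Finset.sum_congr rfl fun j _ => ?_
  have hK := dilate_contDiff hκ l
  have hKs := dilate_support hκs hl
  have hK1 := hK.pder j (M := ∞) (by simp)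
  unfold piece
  simp_rw [smul_eq_mul, pder_const_mul]
  congr 1
  rw [← pder_cv_left hK1 (hasCompactSupport_of_ball (pder_support hKs j)) hg.continuous j x,
    pder_cv_right hK1.continuous (pder_support hKs j) hg j x]
  exact pder_cv_left hK (hasCompactSupport_of_ball hKs)
    (hg.pder j (M := 0) (by simp)).continuous j x

theorem pder_pder_eq {u : Euc n → ℝ} (hu : ContDiff ℝ 2 u) (i j : Fin n) (x : Euc n) :
    pder n (fun y => pder n u i y) j x = iteratedFDeriv ℝ 2 u x
      ![EuclideanSpace.single j 1, EuclideanSpace.single i 1] := by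
  rw [iteratedFDeriv_two_apply]
  have hd : DifferentiableAt ℝ (fderiv ℝ u) x :=
    (hu.fderiv_right (m := 1) (by norm_num)).differentiable (by norm_num) x
  unfold pder
  rw [(hd.hasFDerivAt.clm_apply (hasFDerivAt_const (EuclideanSpace.single i (1:ℝ)) x)).fderiv]
  simp

theorem pder_eq_iteratedFDeriv (u : Euc n → ℝ) (j : Fin n) (x : Euc n) :
    pder n u j x = iteratedFDeriv ℝ 1 u x ![EuclideanSpace.single j 1] := by
  rw [iteratedFDeriv_one_apply]
  rfl

theorem DyadicBound.hasSum_pder {k : ℕ} {α μ C : ℝ} {p : ℤ → Euc n → ℝ}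
    (hp : DyadicBound n k α μ C p) (hα0 : 0 < α) (hμ0 : 0 < μ) (hk : 1 ≤ k) (j : Fin n)
    (x : Euc n) : HasSum (fun m => pder n (p m) j x) (pder n (fun x => ∑' m, p m x) j x) := by
  simp_rw [pder_eq_iteratedFDeriv]
  exact (hp.hasSum hα0 hμ0 hk x).mapL (ContinuousMultilinearMap.apply ℝ (fun _ : Fin 1 => Euc n) ℝ _)

theorem DyadicBound.hasSum_lap {k : ℕ} {α μ C : ℝ} {p : ℤ → Euc n → ℝ}
    (hp : DyadicBound n k α μ C p) (hα0 : 0 < α) (hμ0 : 0 < μ) (hk : 2 ≤ k)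
    (x : Euc n) : HasSum (fun m => lap n (p m) x) (lap n (fun x => ∑' m, p m x) x) := by
  unfold lap
  refine hasSum_sum fun j _ => ?_
  rw [pder_pder_eq ((hp.contDiff hα0 hμ0).of_le (by exact_mod_cast hk))]
  simp_rw [fun m => pder_pder_eq (contDiff_infty.1 (hp.1 m) 2) j j x]
  exact (hp.hasSum hα0 hμ0 hk x).mapL
    (ContinuousMultilinearMap.apply ℝ (fun _ : Fin 2 => Euc n) ℝ _)

theorem tendsto_two_zpow_atTop : Tendsto (fun m : ℤ => (2:ℝ) ^ m) atTop atTop := by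
  have h : Tendsto (fun m : ℤ => (2:ℝ) ^ m.toNat) atTop atTop :=
    (tendsto_pow_atTop_atTop_of_one_lt (by norm_num)).comp
      (tendsto_atTop_atTop.2 fun b => ⟨b, fun a ha => by omega⟩)
  refine h.congr' ?_
  filter_upwards [eventually_ge_atTop 0] with m hm
  rw [← zpow_natCast, Int.toNat_of_nonneg hm]

theorem tendsto_two_zpow_atBot : Tendsto (fun m : ℤ => (2:ℝ) ^ m) atBot (𝓝[>] 0) := by
  refine tendsto_nhdsWithin_iff.2 ⟨?_, Eventually.of_forall fun m => by
    simp only [Set.mem_Ioi]; positivity⟩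
  have := (tendsto_two_zpow_atTop.comp tendsto_neg_atBot_atTop).inv_tendsto_atTop
  refine this.congr fun m => ?_
  simp

theorem newton_telescope {σ : Euc n → ℝ} (hσ : ContDiff ℝ ∞ σ)
    (hσs : ∀ y, 1 < ‖y‖ → σ y = 0) (hσ1 : ∫ y, σ y = 1) {k : ℕ} {α w C A : ℝ} (hw0 : 0 < w)
    (hw : w < n) {g : Euc n → ℝ} (hg : HB n k α w C g) (x : Euc n)
    (h : HasSum (fun m : ℤ => avg σ ((2:ℝ) ^ m / 2) g x - avg σ ((2:ℝ) ^ m) g x) A) : A = g x := by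
  refine hasSum_telescope (a := fun m => avg σ ((2:ℝ) ^ m) g x) ?_ ?_ ?_
  · convert h using 4 with m
    rw [zpow_sub_one₀ (by norm_num)]
    ring
  · exact (avg_tendsto_self hσ hσs hσ1 hg.1.continuous x).comp tendsto_two_zpow_atBot
  · exact (avg_tendsto_zero hσ hσs hw0 hw hg x).comp tendsto_two_zpow_atTop

/-- The Laplacian has a bounded right inverse on weighted Hölder spaces, which commutes with
differentiation to the extent needed for the vector Laplacian. -/
theorem exists_laplace_solver (n : ℕ) (hn : 1 ≤ n) : ∃ G : (Euc n → ℝ) → Euc n → ℝ,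
    ∀ (α μ : ℝ), 0 < α → α < 1 → 0 < μ → μ < (n:ℝ) - 2 → ∀ k : ℕ,
      (∃ K : ℝ, 0 < K ∧ ∀ (C : ℝ) (f : Euc n → ℝ), HB n k α (μ + 2) C f →
        HB n (k + 2) α μ (K * C) (G f)) ∧
      (∀ (C : ℝ) (f : Euc n → ℝ), HB n k α (μ + 2) C f → ∀ x, lap n (G f) x = f x) ∧
      (∀ (C : ℝ) (g : Euc n → ℝ), HB n (k + 1) α (μ + 1) C g → ∀ x,
        ∑ j, pder n (G (fun y => pder n g j y)) j x = g x) := by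
  obtain ⟨κ, σ, hκ, hσ, hκs, hσs, hσ1, hlap⟩ := exists_dyadic_kernel n hn
  refine ⟨newton κ, fun α μ hα0 hα1 hμ0 hμ1 k => ?_⟩
  obtain ⟨K, hK0, hK⟩ := exists_dyadicBound_piece hκ hκs k hα0 hα1.le hμ0 hμ1
  refine ⟨exists_newton_bound hκ hκs k hα0 hα1 hμ0 hμ1, fun C f hf x => ?_, fun C g hg x => ?_⟩
  · have h := (hK C f hf).hasSum_lap hα0 hμ0 (by omega) x
    simp_rw [fun m : ℤ => lap_piece hκ hσ hκs hσs hlap (l := (2:ℝ) ^ m) (by positivity)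
      hf.1.continuous x] at h
    exact newton_telescope hσ hσs hσ1 (by linarith) (by linarith) hf x h
  · have hgj : ∀ j : Fin n, ∃ C', HB n k α (μ + 2) C' (fun y => pder n g j y) := fun j => by
      have := hg.fderiv.clm (ContinuousLinearMap.apply ℝ ℝ (EuclideanSpace.single j (1:ℝ)))
      rw [show μ + 1 + 1 = μ + 2 by ring] at this
      exact ⟨_, this⟩
    choose C' hC' using hgj
    have h : HasSum _ (∑ j, pder n (newton κ (fun y => pder n g j y)) j x) :=
      hasSum_sum fun j (_ : j ∈ Finset.univ) =>
        (hK _ _ (hC' j)).hasSum_pder hα0 hμ0 (by omega) j x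
    simp_rw [fun m : ℤ => div_piece_grad hκ hσ hκs hσs hlap (l := (2:ℝ) ^ m) (by positivity)
      (hg.1.of_le (by exact_mod_cast Nat.le_add_left _ _)) x] at h
    exact newton_telescope hσ hσs hσ1 (by linarith) (by linarith) hg x h

end Telescope

section Uniqueness

variable {n : ℕ}

theorem deriv_deriv_nonpos_of_isLocalMax {g : ℝ → ℝ} {t : ℝ} (hg : ContinuousAt g t)
    (h : IsLocalMax g t) : deriv (deriv g) t ≤ 0 := by
  by_contra! hpos
  have hmin := isLocalMin_of_deriv_deriv_pos hpos h.deriv_eq_zero hg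
  have hc : g =ᶠ[𝓝 t] fun _ => g t := by
    filter_upwards [h, hmin] with s hs hs'
    exact le_antisymm hs hs'
  have h1 : deriv g =ᶠ[𝓝 t] deriv fun _ => g t := hc.deriv
  rw [h1.deriv_eq] at hpos
  simp at hpos

theorem hasDerivAt_line {u : Euc n → ℝ} (hu : Differentiable ℝ u) (z : Euc n) (j : Fin n) (t : ℝ) :
    HasDerivAt (fun s : ℝ => u (z + s • EuclideanSpace.single j (1:ℝ)))
      (pder n u j (z + t • EuclideanSpace.single j (1:ℝ))) t := by
  have h1 : HasDerivAt (fun s : ℝ => z + s • EuclideanSpace.single j (1:ℝ))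
      (EuclideanSpace.single j (1:ℝ)) t := by
    simpa using ((hasDerivAt_id t).smul_const (EuclideanSpace.single j (1:ℝ))).const_add z
  exact (hu _).hasFDerivAt.comp_hasDerivAt t h1

theorem pder_pder_add_le_zero_of_isLocalMax {u : Euc n → ℝ} (hu : ContDiff ℝ 2 u) {ε : ℝ}
    {z : Euc n} (h : IsLocalMax (fun x => u x + ε * ‖x‖ ^ 2) z) (j : Fin n) :
    pder n (fun y => pder n u j y) j z + 2 * ε ≤ 0 := by
  set e : Euc n := EuclideanSpace.single j (1:ℝ) with he
  have hnorm : ∀ t : ℝ, ‖z + t • e‖ ^ 2 = ‖z‖ ^ 2 + 2 * t * z j + t ^ 2 := by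
    intro t
    have h1 : inner ℝ z e = z j := by simp [he, EuclideanSpace.inner_single_right]
    have h2 : ‖e‖ = 1 := by simp [he]
    rw [norm_add_sq_real, inner_smul_right, norm_smul, h1, h2, mul_one, Real.norm_eq_abs, sq_abs]
    ring
  set g : ℝ → ℝ := fun t => u (z + t • e) + ε * (‖z‖ ^ 2 + 2 * t * z j + t ^ 2) with hg
  have hcont : Continuous fun t : ℝ => z + t • e := by fun_prop
  have hmax : IsLocalMax g 0 := by
    have ht : Tendsto (fun t : ℝ => z + t • e) (𝓝 0) (𝓝 z) := by
      simpa using hcont.tendsto 0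
    have := ht.eventually h
    filter_upwards [this] with t ht
    simp only [hg, ← hnorm]
    simpa using ht
  have hd1 : ∀ t, HasDerivAt g (pder n u j (z + t • e) + ε * (2 * z j + 2 * t)) t := by
    intro t
    refine (hasDerivAt_line (hu.differentiable (by norm_num)) z j t).add (HasDerivAt.const_mul ε ?_)
    have h1 := (((hasDerivAt_id t).const_mul 2).mul_const (z j)).const_add (‖z‖ ^ 2)
    have h2 := h1.add ((hasDerivAt_id t).pow 2)
    refine h2.congr_deriv ?_
    simp
  have hd2 : HasDerivAt (deriv g) (pder n (fun y => pder n u j y) j z + 2 * ε) 0 := by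
    have e1 : deriv g = fun t => pder n u j (z + t • e) + ε * (2 * z j + 2 * t) :=
      funext fun t => (hd1 t).deriv
    rw [e1]
    have h0 := hasDerivAt_line ((hu.pder j (M := 1) (by norm_num)).differentiable (by norm_num)) z j 0
    rw [zero_smul, add_zero] at h0
    have h2 := (((hasDerivAt_id (0:ℝ)).const_mul 2).const_add (2 * z j)).const_mul ε
    refine (h0.add h2).congr_deriv ?_
    ring
  have := deriv_deriv_nonpos_of_isLocalMax (hd1 0).continuousAt hmax
  rwa [hd2.deriv] at this

theorem le_zero_of_lap_eq_zero (hn : 1 ≤ n) {u : Euc n → ℝ} (hu : ContDiff ℝ 2 u)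
    (hlap : ∀ x, lap n u x = 0) (hlim : Tendsto u (cocompact (Euc n)) (𝓝 0)) (x : Euc n) :
    u x ≤ 0 := by
  by_contra! hx
  have hev : ∀ᶠ y in cocompact (Euc n), u y < u x / 4 :=
    hlim.eventually (gt_mem_nhds (by linarith))
  rw [Filter.hasBasis_cocompact.eventually_iff] at hev
  obtain ⟨S, hS, hSu⟩ := hev
  obtain ⟨R₀, hR₀⟩ := hS.isBounded.exists_norm_le
  set R := max R₀ 0 + ‖x‖ + 1 with hR
  have hR0 : 0 < R := by positivity
  have hfar : ∀ y : Euc n, R ≤ ‖y‖ → u y < u x / 4 := fun y hy => hSu fun hyS => by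
    have := hR₀ y hyS
    have := le_max_left R₀ 0
    linarith [norm_nonneg x]
  set ε := u x / (4 * R ^ 2) with hε
  have hε0 : 0 < ε := by positivity
  have hvc : Continuous fun y => u y + ε * ‖y‖ ^ 2 := by
    have := hu.continuous
    fun_prop
  obtain ⟨z, hz, hmax⟩ := (isCompact_closedBall (0 : Euc n) R).exists_isMaxOn
    ⟨0, by simp [hR0.le]⟩ hvc.continuousOn
  have hxR : x ∈ Metric.closedBall (0 : Euc n) R := by
    have := le_max_right R₀ 0
    simp only [Metric.mem_closedBall, dist_zero_right]
    linarith
  have hzR : ‖z‖ ≤ R := by simpa using hz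
  have hzlt : ‖z‖ < R := by
    refine lt_of_le_of_ne hzR fun hzeq => ?_
    have h1 := hfar z hzeq.ge
    have h2 : u x + ε * ‖x‖ ^ 2 ≤ u z + ε * ‖z‖ ^ 2 := hmax hxR
    have h3 : ε * ‖z‖ ^ 2 = u x / 4 := by
      rw [hzeq, hε]
      field_simp
    have h4 : 0 ≤ ε * ‖x‖ ^ 2 := by positivity
    linarith
  have hloc : IsLocalMax (fun y => u y + ε * ‖y‖ ^ 2) z :=
    hmax.isLocalMax (mem_of_superset (Metric.ball_mem_nhds z (sub_pos.2 hzlt)) fun y hy => by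
      simp only [Metric.mem_closedBall, dist_zero_right]
      rw [Metric.mem_ball, dist_eq_norm] at hy
      have := norm_sub_norm_le y z
      linarith)
  have hsum := Finset.sum_le_sum fun j (_ : j ∈ (Finset.univ : Finset (Fin n))) =>
    pder_pder_add_le_zero_of_isLocalMax hu hloc j
  rw [Finset.sum_add_distrib] at hsum
  have hl := hlap z
  unfold lap at hl
  rw [hl] at hsum
  simp only [Finset.sum_const, Finset.card_univ, Fintype.card_fin, nsmul_eq_mul, zero_add,
    smul_zero] at hsum
  have : (0:ℝ) < n := by exact_mod_cast hn
  have : 0 < (n:ℝ) * (2 * ε) := by positivity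
  linarith

theorem HB.tendsto_zero {k : ℕ} {α μ C : ℝ} (hμ : 0 < μ) {u : Euc n → ℝ} (hu : HB n k α μ C u) :
    Tendsto u (cocompact (Euc n)) (𝓝 0) := by
  refine squeeze_zero_norm (a := fun x => C * (1 + ‖x‖) ^ (-μ)) (fun x => ?_) ?_
  · have := hu.2.1 0 (Nat.zero_le _) x
    rw [norm_iteratedFDeriv_zero] at this
    simpa using this
  · have := ((tendsto_rpow_neg_atTop hμ).comp
      (tendsto_atTop_add_const_left _ 1 (tendsto_norm_cocompact_atTop (E := Euc n)))).const_mul C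
    simpa using this

theorem HB.contDiff_two {k : ℕ} {α μ C : ℝ} {u : Euc n → ℝ} (hu : HB n k α μ C u) (hk : 2 ≤ k) :
    ContDiff ℝ 2 u := hu.1.of_le (by exact_mod_cast hk)

theorem pder_add {u v : Euc n → ℝ} {x : Euc n} (hu : DifferentiableAt ℝ u x)
    (hv : DifferentiableAt ℝ v x) (j : Fin n) :
    pder n (fun y => u y + v y) j x = pder n u j x + pder n v j x := by
  unfold pder
  rw [fderiv_fun_add hu hv]
  rfl

theorem lap_add {u v : Euc n → ℝ} (hu : ContDiff ℝ 2 u) (hv : ContDiff ℝ 2 v) (x : Euc n) :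
    lap n (fun y => u y + v y) x = lap n u x + lap n v x := by
  unfold lap
  rw [← Finset.sum_add_distrib]
  refine Finset.sum_congr rfl fun j _ => ?_
  have e : (fun y => pder n (fun y => u y + v y) j y) = fun y => pder n u j y + pder n v j y :=
    funext fun y => pder_add (hu.differentiable (by norm_num) y) (hv.differentiable (by norm_num) y) j
  rw [e]
  exact pder_add ((hu.pder j (M := 1) (by norm_num)).differentiable (by norm_num) x)
    ((hv.pder j (M := 1) (by norm_num)).differentiable (by norm_num) x) j

theorem lap_const_mul (u : Euc n → ℝ) (c : ℝ) (x : Euc n) :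
    lap n (fun y => c * u y) x = c * lap n u x := by
  unfold lap
  rw [Finset.mul_sum]
  simp_rw [pder_const_mul]

/-- A harmonic function decaying at infinity vanishes. -/
theorem HB.eq_zero_of_lap_eq_zero (hn : 1 ≤ n) {k : ℕ} (hk : 2 ≤ k) {α μ C : ℝ} (hμ : 0 < μ)
    {u : Euc n → ℝ} (hu : HB n k α μ C u) (hlap : ∀ x, lap n u x = 0) (x : Euc n) : u x = 0 := by
  refine le_antisymm (le_zero_of_lap_eq_zero hn (hu.contDiff_two hk) hlap (hu.tendsto_zero hμ) x) ?_
  have hm := hu.const_smul (-1)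
  simp only [smul_eq_mul] at hm
  have := le_zero_of_lap_eq_zero hn (hm.contDiff_two hk)
    (fun x => by rw [lap_const_mul, hlap, mul_zero]) (hm.tendsto_zero hμ) x
  linarith

end Uniqueness

section VectorLaplacian

variable {n : ℕ}

theorem HB.comp_coord {k : ℕ} {α μ C : ℝ} {X : Euc n → Euc n} (h : HB n k α μ C X) (j : Fin n) :
    HB n k α μ C (fun y => X y j) := by
  refine (h.clm (EuclideanSpace.proj j : Euc n →L[ℝ] ℝ)).mono ?_
  refine mul_le_of_le_one_left h.nonneg (ContinuousLinearMap.opNorm_le_bound _ zero_le_one ?_)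
  intro y
  rw [one_mul]
  exact PiLp.norm_apply_le y j

theorem HB.of_coord {k : ℕ} {α μ C : ℝ} {X : Euc n → Euc n}
    (h : ∀ j, HB n k α μ C (fun y => X y j)) : HB n k α μ (n * C) X := by
  have h1 := HB.sum Finset.univ fun j (_ : j ∈ (Finset.univ : Finset (Fin n))) =>
    (h j).clm (ContinuousLinearMap.toSpanSingleton ℝ (EuclideanSpace.single j (1:ℝ) : Euc n))
  have e : (fun y => ∑ j, ContinuousLinearMap.toSpanSingleton ℝ
      (EuclideanSpace.single j (1:ℝ) : Euc n) (X y j)) = X := by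
    ext y i
    simp [ContinuousLinearMap.toSpanSingleton_apply, Finset.sum_apply, Pi.single_apply]
  rw [e] at h1
  refine h1.mono (le_of_eq ?_)
  simp [ContinuousLinearMap.norm_toSpanSingleton]

theorem HB.pder {k : ℕ} {α μ C : ℝ} {u : Euc n → ℝ} (h : HB n (k+1) α μ C u) (j : Fin n) :
    HB n k α (μ+1) C (fun y => _root_.pder n u j y) := by
  refine (h.fderiv.clm (ContinuousLinearMap.apply ℝ ℝ (EuclideanSpace.single j (1:ℝ)))).mono ?_
  refine mul_le_of_le_one_left h.nonneg (ContinuousLinearMap.opNorm_le_bound _ zero_le_one ?_)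
  intro L
  rw [one_mul, ContinuousLinearMap.apply_apply]
  simpa using L.le_opNorm (EuclideanSpace.single j (1:ℝ))

theorem HB.divg {k : ℕ} {α μ C : ℝ} {X : Euc n → Euc n} (h : HB n (k+1) α μ C X) :
    HB n k α (μ+1) (n * C) (_root_.divg n X) := by
  have := HB.sum Finset.univ fun j (_ : j ∈ (Finset.univ : Finset (Fin n))) =>
    (h.comp_coord j).pder j
  simp only [Finset.sum_const, Finset.card_univ, Fintype.card_fin, nsmul_eq_mul] at this
  exact this

theorem pder_sum {ι : Type*} (s : Finset ι) {u : ι → Euc n → ℝ} {x : Euc n}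
    (hu : ∀ i ∈ s, DifferentiableAt ℝ (u i) x) (j : Fin n) :
    pder n (fun y => ∑ i ∈ s, u i y) j x = ∑ i ∈ s, pder n (u i) j x := by
  unfold pder
  rw [fderiv_fun_sum hu, _root_.sum_apply]

theorem pder_comm {u : Euc n → ℝ} (hu : ContDiff ℝ 2 u) (i j : Fin n) (x : Euc n) :
    pder n (fun y => pder n u i y) j x = pder n (fun y => pder n u j y) i x := by
  rw [pder_pder_eq hu, pder_pder_eq hu, iteratedFDeriv_two_apply, iteratedFDeriv_two_apply]
  have hs := hu.contDiffAt (x := x) |>.isSymmSndFDerivAt (by simp)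
  exact hs _ _

theorem contDiff_coord {X : Euc n → Euc n} {N : WithTop ℕ∞} (hX : ContDiff ℝ N X) (j : Fin n) :
    ContDiff ℝ N (fun y => X y j) :=
  (EuclideanSpace.proj j : Euc n →L[ℝ] ℝ).contDiff.comp hX

theorem vLap_eq {X : Euc n → Euc n} (hX : ContDiff ℝ 2 X) (x : Euc n) (j : Fin n) :
    vLap n X x j = -(1/2) * lap n (fun y => X y j) x - (1/2 - 1/(n:ℝ)) * pder n (divg n X) j x := by
  have hc : ∀ i, ContDiff ℝ 2 (fun y => X y i) := contDiff_coord hX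
  have hd1 : ∀ i k y, DifferentiableAt ℝ (fun y => pder n (fun z => X z i) k y) y := fun i k y =>
    ((hc i).pder k (M := 1) (by norm_num)).differentiable (by norm_num) y
  have hdiv : Differentiable ℝ (divg n X) := by
    unfold divg
    intro y
    exact DifferentiableAt.fun_sum fun i _ => hd1 i i y
  have h1 : ∀ k, pder n (fun y => confKill n X y j k) k x
      = (1/2) * (pder n (fun y => pder n (fun z => X z k) k y) j x
          + pder n (fun y => pder n (fun z => X z j) k y) k x)
        - (if j = k then (1/(n:ℝ)) * pder n (divg n X) k x else 0) := by
    intro k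
    have e : (fun y => confKill n X y j k) = fun y => (1/2) * (pder n (fun z => X z k) j y
        + pder n (fun z => X z j) k y) + (-(1/(n:ℝ)) * (if j = k then 1 else 0)) * divg n X y := by
      ext y
      unfold confKill
      ring
    rw [e, pder_add (((hd1 k j x).fun_add (hd1 j k x)).const_mul _) ((hdiv x).const_mul _),
      pder_const_mul, pder_const_mul, pder_add (hd1 k j x) (hd1 j k x), pder_comm (hc k)]
    split_ifs <;> ring
  unfold vLap
  simp_rw [h1]
  have h2 : pder n (divg n X) j x = ∑ k, pder n (fun y => pder n (fun z => X z k) k y) j x := by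
    unfold divg
    exact pder_sum _ (fun i _ => hd1 i i x) j
  rw [Finset.sum_sub_distrib, ← Finset.mul_sum, Finset.sum_add_distrib, ← h2, Finset.sum_ite_eq]
  simp only [Finset.mem_univ, if_true]
  unfold lap
  ring

theorem exists_vLap_solver (n : ℕ) (hn : 3 ≤ n) {α μ : ℝ} (hα0 : 0 < α) (hα1 : α < 1)
    (hμ0 : 0 < μ) (hμ1 : μ < (n:ℝ) - 2) (k : ℕ) :
    (∃ K : ℝ, 0 < K ∧ ∀ (C : ℝ) (F : Euc n → Euc n), HB n k α (μ + 2) C F →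
      ∃ Z, HB n (k + 2) α μ (K * C) Z ∧ ∀ x j, vLap n Z x j = F x j) ∧
    (∀ (C : ℝ) (Z : Euc n → Euc n), HB n (k + 2) α μ C Z → (∀ x j, vLap n Z x j = 0) → Z = 0) := by
  have hn1 : 1 ≤ n := by omega
  have hn3 : (3:ℝ) ≤ n := by exact_mod_cast hn
  have hninv : 1 / (n:ℝ) ≤ 1 / 3 := one_div_le_one_div_of_le (by norm_num) hn3
  obtain ⟨G, hG⟩ := exists_laplace_solver n hn1
  obtain ⟨⟨K, hK0, hK⟩, hsol, hdiv⟩ := hG α μ hα0 hα1 hμ0 hμ1 k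
  set a : ℝ := 1/2 - 1/(n:ℝ) with ha
  have ha0 : 0 < a := by rw [ha]; linarith
  have hgrad : ∀ {C : ℝ} {g : Euc n → ℝ}, HB n (k + 1) α (μ + 1) C g → ∀ j,
      HB n k α (μ + 2) C (fun y => pder n g j y) := fun {C g} hg j => by
    have := hg.pder j
    rwa [show μ + 1 + 1 = μ + 2 by ring] at this
  constructor
  · set c : ℝ := 2 * a / (a + 1/2) with hc
    refine ⟨n * (2 * K + |c| * (K * (n * K))), by positivity, fun C F hF => ?_⟩
    set V : Euc n → Euc n := fun x => WithLp.toLp 2 fun j => G (fun y => F y j) x with hV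
    have hVj : ∀ j, HB n (k + 2) α μ (K * C) (fun y => V y j) := fun j => hK _ _ (hF.comp_coord j)
    have hg : HB n (k + 1) α (μ + 1) (n * (K * C)) (divg n V) := by
      have := HB.sum Finset.univ fun j (_ : j ∈ (Finset.univ : Finset (Fin n))) => (hVj j).pder j
      simp only [Finset.sum_const, Finset.card_univ, Fintype.card_fin, nsmul_eq_mul] at this
      exact this
    have hH := fun j => hK _ _ (hgrad hg j)
    have hdivH := hdiv _ _ hg
    set Z : Euc n → Euc n := fun x => WithLp.toLp 2 fun j =>
      -2 * G (fun y => F y j) x + c * G (fun y => pder n (divg n V) j y) x with hZ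
    have hZj : ∀ j, HB n (k + 2) α μ ((2 * K + |c| * (K * (n * K))) * C) (fun y => Z y j) :=
      fun j => by
        have := ((hVj j).const_smul (-2)).add ((hH j).const_smul c)
        refine this.mono (le_of_eq ?_)
        rw [abs_neg, abs_of_pos (by norm_num : (0:ℝ) < 2)]
        ring
    have hZHB := HB.of_coord hZj
    refine ⟨Z, ?_, fun x j => ?_⟩
    · rwa [mul_assoc]
    have hV2 : ∀ j, ContDiff ℝ 2 (G (fun y => F y j)) := fun j => (hVj j).contDiff_two (by omega)
    have hH2 : ∀ j, ContDiff ℝ 2 (G (fun y => pder n (divg n V) j y)) := fun j =>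
      (hH j).contDiff_two (by omega)
    have hZdiv : divg n Z = fun y => (-2 + c) * divg n V y := by
      ext y
      have h1 : ∀ j, pder n (fun z => Z z j) j y = -2 * pder n (fun z => V z j) j y
          + c * pder n (G (fun y => pder n (divg n V) j y)) j y := fun j => by
        have hd1 := (hV2 j).differentiable (by norm_num) y
        have hd2 := (hH2 j).differentiable (by norm_num) y
        have := pder_add (hd1.const_mul (-2)) (hd2.const_mul c) j
        rwa [pder_const_mul, pder_const_mul] at this
      calc divg n Z y = ∑ j, pder n (fun z => Z z j) j y := rfl
        _ = -2 * ∑ j, pder n (fun z => V z j) j y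
            + c * ∑ j, pder n (G (fun y => pder n (divg n V) j y)) j y := by
          simp_rw [h1]
          rw [Finset.sum_add_distrib, Finset.mul_sum, Finset.mul_sum]
        _ = -2 * divg n V y + c * divg n V y := by rw [hdivH y]; rfl
        _ = _ := by ring
    have hZlap : lap n (fun y => Z y j) x = -2 * F x j + c * pder n (divg n V) j x := by
      have := lap_add (contDiff_const.mul (hV2 j)) (contDiff_const.mul (hH2 j)) x
        (u := fun y => -2 * G (fun y => F y j) y)
        (v := fun y => c * G (fun y => pder n (divg n V) j y) y)
      rw [lap_const_mul, lap_const_mul, hsol _ _ (hF.comp_coord j), hsol _ _ (hgrad hg j)] at this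
      exact this
    rw [vLap_eq (hZHB.1.of_le (by exact_mod_cast Nat.le_add_left _ _)), hZlap, hZdiv,
      pder_const_mul, ← ha]
    have hca : c * (a + 1/2) = 2 * a := by rw [hc]; field_simp
    linear_combination (-pder n (divg n V) j x) * hca
  · intro C Z hZ h0
    have hd := hZ.divg
    have hdj := hgrad hd
    have hZ2 : ContDiff ℝ 2 Z := hZ.1.of_le (by exact_mod_cast Nat.le_add_left _ _)
    have hlapZ : ∀ j x, lap n (fun y => Z y j) x = -(2 * a) * pder n (divg n Z) j x := by
      intro j x
      have := h0 x j
      rw [vLap_eq hZ2, ← ha] at this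
      linarith
    have hGd := fun j => hK _ _ (hdj j)
    have hU : ∀ j x, Z x j + 2 * a * G (fun y => pder n (divg n Z) j y) x = 0 := by
      intro j x
      refine HB.eq_zero_of_lap_eq_zero hn1 (Nat.le_add_left 2 k) hμ0
        ((hZ.comp_coord j).add ((hGd j).const_smul (2 * a))) (fun y => ?_) x
      have := lap_add ((hZ.comp_coord j).contDiff_two (by omega))
        (contDiff_const.mul ((hGd j).contDiff_two (by omega))) y
        (v := fun y => 2 * a * G (fun y => pder n (divg n Z) j y) y)
      rw [lap_const_mul, hsol _ _ (hdj j), hlapZ] at this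
      refine Eq.trans this ?_
      ring
    have hdz : ∀ x, divg n Z x = 0 := by
      intro x
      have h1 : ∀ j, (fun y => Z y j) = fun y => -(2 * a) * G (fun y => pder n (divg n Z) j y) y :=
        fun j => funext fun y => by linarith [hU j y]
      have h2 : divg n Z x = -(2 * a) * divg n Z x := by
        calc divg n Z x = ∑ j, pder n (fun z => Z z j) j x := rfl
          _ = -(2 * a) * ∑ j, pder n (G (fun y => pder n (divg n Z) j y)) j x := by
            rw [Finset.mul_sum]
            refine Finset.sum_congr rfl fun j _ => ?_
            rw [h1 j, pder_const_mul]
          _ = _ := by rw [hdiv _ _ hd x]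
      have h3 : (1 + 2 * a) * divg n Z x = 0 := by linarith
      exact (mul_eq_zero.1 h3).resolve_left (by positivity)
    have hdz' : divg n Z = fun _ => 0 := funext hdz
    ext x j
    refine HB.eq_zero_of_lap_eq_zero hn1 (Nat.le_add_left 2 k) hμ0 (hZ.comp_coord j) (fun y => ?_) x
    rw [hlapZ, hdz']
    simp [pder]

end VectorLaplacian

section Series

variable {n : ℕ}

theorem HB.norm_iteratedFDeriv_le {k : ℕ} {α μ C : ℝ} {u : Euc n → ℝ} (h : HB n k α μ C u)
    (hμ : 0 ≤ μ) {i : ℕ} (hi : i ≤ k) (x : Euc n) : ‖iteratedFDeriv ℝ i u x‖ ≤ C := by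
  refine (h.2.1 i hi x).trans (mul_le_of_le_one_right h.nonneg ?_)
  refine Real.rpow_le_one_of_one_le_of_nonpos (by linarith [norm_nonneg x]) ?_
  have : (0:ℝ) ≤ i := i.cast_nonneg
  linarith

theorem HB.hasSum_iteratedFDeriv {k : ℕ} {α μ : ℝ} {c : ℕ → ℝ} {d : ℕ → Euc n → ℝ}
    (hd : ∀ m, HB n k α μ (c m) (d m)) (hc : Summable c) (hμ : 0 ≤ μ) {i : ℕ} (hi : i ≤ k)
    (x : Euc n) :
    HasSum (fun m => iteratedFDeriv ℝ i (d m) x)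
      (iteratedFDeriv ℝ i (fun y => ∑' m, d m y) x) := by
  rw [iteratedFDeriv_tsum_apply (𝕜 := ℝ) (N := (k : ℕ∞)) (f := d) (v := fun _ => c)
    (fun m => (hd m).1) (fun _ _ => hc)
    (fun i m x hi => (hd m).norm_iteratedFDeriv_le hμ (by exact_mod_cast hi) x)
    (by exact_mod_cast hi)]
  exact (Summable.of_norm_bounded hc fun m => (hd m).norm_iteratedFDeriv_le hμ hi x).hasSum

theorem HB.hasSum {k : ℕ} {α μ : ℝ} {c : ℕ → ℝ} {d : ℕ → Euc n → ℝ}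
    (hd : ∀ m, HB n k α μ (c m) (d m)) (hc : Summable c) (hμ : 0 ≤ μ) (x : Euc n) :
    HasSum (fun m => d m x) (∑' m, d m x) := by
  refine (Summable.of_norm_bounded hc fun m => ?_).hasSum
  have := (hd m).norm_iteratedFDeriv_le hμ (Nat.zero_le k) x
  rwa [norm_iteratedFDeriv_zero] at this

theorem HB.tsum {k : ℕ} {α μ : ℝ} {c : ℕ → ℝ} {d : ℕ → Euc n → ℝ}
    (hd : ∀ m, HB n k α μ (c m) (d m)) (hc : Summable c) (hμ : 0 ≤ μ) :
    HB n k α μ (∑' m, c m) (fun y => ∑' m, d m y) := by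
  refine ⟨?_, fun i hi x => ?_, fun i hi x y hxy => ?_⟩
  · exact contDiff_tsum (𝕜 := ℝ) (N := (k : ℕ∞)) (f := d) (v := fun _ => c)
      (fun m => (hd m).1) (fun _ _ => hc)
      (fun i m x hi => (hd m).norm_iteratedFDeriv_le hμ (by exact_mod_cast hi) x)
  · rw [← (HB.hasSum_iteratedFDeriv hd hc hμ hi x).tsum_eq]
    exact tsum_of_norm_bounded (hc.hasSum.mul_right _) fun m => (hd m).2.1 i hi x
  · rw [← ((HB.hasSum_iteratedFDeriv hd hc hμ hi x).sub
      (HB.hasSum_iteratedFDeriv hd hc hμ hi y)).tsum_eq]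
    exact tsum_of_norm_bounded ((hc.hasSum.mul_right _).mul_right _)
      fun m => (hd m).2.2 i hi x y hxy

theorem HB.hasSum_pder {k : ℕ} {α μ : ℝ} {c : ℕ → ℝ} {d : ℕ → Euc n → ℝ}
    (hd : ∀ m, HB n (k + 1) α μ (c m) (d m)) (hc : Summable c) (hμ : 0 ≤ μ) (j : Fin n)
    (x : Euc n) :
    HasSum (fun m => _root_.pder n (d m) j x) (_root_.pder n (fun y => ∑' m, d m y) j x) := by
  simp_rw [pder_eq_iteratedFDeriv]
  exact (HB.hasSum_iteratedFDeriv hd hc hμ (Nat.le_add_left 1 k) x).mapL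
    (ContinuousMultilinearMap.apply ℝ (fun _ : Fin 1 => Euc n) ℝ ![EuclideanSpace.single j 1])

theorem HB.hasSum_lap {k : ℕ} {α μ : ℝ} {c : ℕ → ℝ} {d : ℕ → Euc n → ℝ}
    (hd : ∀ m, HB n (k + 2) α μ (c m) (d m)) (hc : Summable c) (hμ : 0 ≤ μ) (x : Euc n) :
    HasSum (fun m => lap n (d m) x) (lap n (fun y => ∑' m, d m y) x) := by
  refine hasSum_sum fun i _ => ?_
  have e : (fun y => _root_.pder n (fun y => ∑' m, d m y) i y)
      = fun y => ∑' m, _root_.pder n (d m) i y :=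
    funext fun y => (HB.hasSum_pder (k := k + 1) hd hc hμ i y).tsum_eq.symm
  rw [e]
  exact HB.hasSum_pder (k := k) (fun m => (hd m).pder i) hc (by linarith) i x

theorem HB.confKill {k : ℕ} {α μ C : ℝ} {X : Euc n → Euc n}
    (h : HB n (k + 1) α μ C X) (i j : Fin n) :
    HB n k α (μ + 1) ((1 + n) * C) (fun y => _root_.confKill n X y i j) := by
  have hC := h.nonneg
  have hn0 : (0:ℝ) ≤ n := n.cast_nonneg
  have h1 := ((((h.comp_coord j).pder i).add ((h.comp_coord i).pder j)).const_smul (1/2)).sub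
    (h.divg.const_smul (1 / (n:ℝ) * (if i = j then 1 else 0)))
  have e : (fun y => _root_.confKill n X y i j) = fun y =>
      (1/2:ℝ) • (_root_.pder n (fun z => X z j) i y + _root_.pder n (fun z => X z i) j y)
      - (1 / (n:ℝ) * (if i = j then 1 else 0)) • _root_.divg n X y := by
    ext y
    simp only [_root_.confKill, smul_eq_mul]
    ring
  rw [e]
  refine h1.mono ?_
  have h2 : |1 / (n:ℝ) * (if i = j then 1 else 0)| ≤ 1 := by
    have : 1 / (n:ℝ) ≤ 1 := by
      rcases Nat.eq_zero_or_pos n with h0 | h0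
      · simp [h0]
      · exact (div_le_one (by positivity)).2 (by exact_mod_cast h0)
    split_ifs
    · rw [mul_one, abs_of_nonneg (by positivity)]; exact this
    · simp
  have h3 : |(1/2:ℝ)| = 1/2 := abs_of_pos (by norm_num)
  rw [h3]
  have := mul_le_mul_of_nonneg_right h2 (mul_nonneg hn0 hC)
  linarith

theorem HB.hasSum_confKill {k : ℕ} {α μ : ℝ} {c : ℕ → ℝ} {Z : ℕ → Euc n → Euc n}
    {X : Euc n → Euc n} (hX : ∀ y j, X y j = ∑' m, Z m y j)
    (hd : ∀ m, HB n (k + 1) α μ (c m) (Z m)) (hc : Summable c) (hμ : 0 ≤ μ) (i j : Fin n)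
    (x : Euc n) :
    HasSum (fun m => _root_.confKill n (Z m) x i j) (_root_.confKill n X x i j) := by
  have h1 : ∀ i j, HasSum (fun m => _root_.pder n (fun y => Z m y j) i x)
      (_root_.pder n (fun y => X y j) i x) := fun i j => by
    simp_rw [hX]
    exact HB.hasSum_pder (fun m => (hd m).comp_coord j) hc hμ i x
  have h2 : HasSum (fun m => _root_.divg n (Z m) x) (_root_.divg n X x) :=
    hasSum_sum fun i _ => h1 i i
  exact (((h1 i j).add (h1 j i)).mul_left _).sub ((h2.mul_left _).mul_right _)

theorem HB.hasSum_vLap {k : ℕ} {α μ : ℝ} {c : ℕ → ℝ} {Z : ℕ → Euc n → Euc n}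
    {X : Euc n → Euc n} (hX : ∀ y j, X y j = ∑' m, Z m y j)
    (hd : ∀ m, HB n (k + 2) α μ (c m) (Z m)) (hc : Summable c) (hμ : 0 ≤ μ) (j : Fin n)
    (x : Euc n) :
    HasSum (fun m => vLap n (Z m) x j) (vLap n X x j) := by
  refine (hasSum_sum fun i _ => ?_).neg
  have e : (fun y => _root_.confKill n X y j i) = fun y => ∑' m, _root_.confKill n (Z m) y j i :=
    funext fun y => (HB.hasSum_confKill (k := k + 1) hX hd hc hμ j i y).tsum_eq.symm
  rw [e]
  exact HB.hasSum_pder (k := k) (fun m => (hd m).confKill j i) (hc.mul_left _) (by linarith) i x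

end Series

section Perturbation

variable {n : ℕ}

theorem pder_sub {u v : Euc n → ℝ} {x : Euc n} (hu : DifferentiableAt ℝ u x)
    (hv : DifferentiableAt ℝ v x) (j : Fin n) :
    pder n (fun y => u y - v y) j x = pder n u j x - pder n v j x := by
  unfold pder
  rw [fderiv_fun_sub hu hv]
  rfl

theorem lap_sub {u v : Euc n → ℝ} (hu : ContDiff ℝ 2 u) (hv : ContDiff ℝ 2 v) (x : Euc n) :
    lap n (fun y => u y - v y) x = lap n u x - lap n v x := by
  unfold lap
  rw [← Finset.sum_sub_distrib]
  refine Finset.sum_congr rfl fun i _ => ?_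
  rw [show (fun y => pder n (fun y => u y - v y) i y) = fun y => pder n u i y - pder n v i y from
    funext fun y => pder_sub (hu.differentiable (by norm_num) y)
      (hv.differentiable (by norm_num) y) i]
  exact pder_sub ((hu.pder i (M := 1) (by norm_num)).differentiable (by norm_num) x)
    ((hv.pder i (M := 1) (by norm_num)).differentiable (by norm_num) x) i

theorem confKill_sub {X Y : Euc n → Euc n} (hX : ContDiff ℝ 1 X) (hY : ContDiff ℝ 1 Y)
    (x : Euc n) (i j : Fin n) :
    confKill n (fun y => X y - Y y) x i j = confKill n X x i j - confKill n Y x i j := by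
  have h1 : ∀ i j, pder n (fun y => (X y - Y y) j) i x
      = pder n (fun y => X y j) i x - pder n (fun y => Y y j) i x := fun i j =>
    pder_sub ((contDiff_coord hX j).differentiable (by norm_num) x)
      ((contDiff_coord hY j).differentiable (by norm_num) x) i
  unfold confKill divg
  simp_rw [h1]
  rw [Finset.sum_sub_distrib]
  ring

theorem vLap_sub {X Y : Euc n → Euc n} (hX : ContDiff ℝ 2 X) (hY : ContDiff ℝ 2 Y)
    (x : Euc n) (j : Fin n) :
    vLap n (fun y => X y - Y y) x j = vLap n X x j - vLap n Y x j := by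
  have hX1 : ContDiff ℝ 1 X := hX.of_le (by norm_num)
  have hY1 : ContDiff ℝ 1 Y := hY.of_le (by norm_num)
  have hdiff : ∀ {V : Euc n → Euc n}, ContDiff ℝ 2 V → ∀ i,
      DifferentiableAt ℝ (fun y => confKill n V y j i) x := by
    intro V hV i
    have hd : ∀ i k, DifferentiableAt ℝ (fun y => pder n (fun z => V z i) k y) x := fun i k =>
      ((contDiff_coord hV i).pder k (M := 1) (by norm_num)).differentiable (by norm_num) x
    have hdiv : DifferentiableAt ℝ (divg n V) x := by
      unfold divg
      exact DifferentiableAt.fun_sum fun i _ => hd i i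
    exact (((hd i j).fun_add (hd j i)).const_mul _).fun_sub ((hdiv.const_mul _).mul_const _)
  unfold vLap
  simp_rw [confKill_sub hX1 hY1]
  rw [Finset.sum_congr rfl fun i _ => pder_sub (hdiff hX i) (hdiff hY i) i,
    Finset.sum_sub_distrib]
  ring

/-- The lower-order terms of the scalar equation. -/
def scalarLow (n : ℕ) (a : Euc n → ℝ) (b : Fin n → Fin n → Euc n → ℝ) (u : Euc n → ℝ)
    (Z : Euc n → Euc n) (x : Euc n) : ℝ :=
  a x * u x + ∑ i, ∑ j, b i j x * confKill n Z x i j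

/-- The lower-order terms of the vector equation. -/
def vectorLow (n : ℕ) (c : Fin n → Euc n → ℝ) (u : Euc n → ℝ) (x : Euc n) : Euc n :=
  WithLp.toLp 2 fun j => c j x * u x

theorem HB.congr_weight {k : ℕ} {α μ μ' C : ℝ} {u : Euc n → ℝ} (h : HB n k α μ C u)
    (e : μ = μ') : HB n k α μ' C u := e ▸ h

theorem exists_scalarLow_bound (n q : ℕ) {α ν : ℝ} : ∃ M : ℝ, 0 < M ∧
    ∀ (ε C : ℝ) (a : Euc n → ℝ) (b : Fin n → Fin n → Euc n → ℝ) (u : Euc n → ℝ)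
      (Z : Euc n → Euc n), HB n (q + 1) α 2 ε a →
      (∀ i j, HB n (q + 1) α (ν / 2 + 1) ε (b i j)) → HB n (q + 3) α ν C u →
      HB n (q + 2) α (ν / 2) C Z → HB n (q + 1) α (ν + 2) (M * ε * C) (scalarLow n a b u Z) := by
  obtain ⟨K₁, hK₁, h₁⟩ := HB.smul (n := n) (E := ℝ) (q + 1) (α := α) 2 ν
  obtain ⟨K₂, hK₂, h₂⟩ := HB.smul (n := n) (E := ℝ) (q + 1) (α := α) (ν / 2 + 1) (ν / 2 + 1)
  refine ⟨K₁ + n * (n * (K₂ * (1 + n))), by positivity, fun ε C a b u Z ha hb hu hZ => ?_⟩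
  have t1 := (h₁ _ _ _ _ ha (hu.mono_order (by omega))).congr_weight (add_comm 2 ν)
  have t2 : ∀ i j, HB n (q + 1) α (ν + 2) (K₂ * (ε * ((1 + n) * C)))
      (fun x => b i j x • confKill n Z x i j) := fun i j =>
    (h₂ _ _ _ _ (hb i j) (hZ.confKill i j)).congr_weight (by ring)
  have t3 := HB.sum Finset.univ fun i (_ : i ∈ (Finset.univ : Finset (Fin n))) =>
    HB.sum Finset.univ fun j (_ : j ∈ (Finset.univ : Finset (Fin n))) => t2 i j
  refine (t1.add t3).mono (le_of_eq ?_)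
  simp only [Finset.sum_const, Finset.card_univ, Fintype.card_fin, nsmul_eq_mul]
  ring

theorem exists_vectorLow_bound (n q : ℕ) (hn : 0 < n) {α ν : ℝ} (hν : 0 ≤ ν) : ∃ M : ℝ, 0 < M ∧
    ∀ (ε C : ℝ) (c : Fin n → Euc n → ℝ) (u : Euc n → ℝ),
      (∀ j, HB n q α (ν / 2 + 2) ε (c j)) → HB n (q + 3) α ν C u →
      HB n q α (ν / 2 + 2) (M * ε * C) (vectorLow n c u) := by
  obtain ⟨K₁, hK₁, h₁⟩ := HB.smul (n := n) (E := ℝ) q (α := α) (ν / 2 + 2) ν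
  refine ⟨n * K₁, by positivity, fun ε C c u hc hu => ?_⟩
  have t1 : ∀ j, HB n q α (ν / 2 + 2) (K₁ * (ε * C)) (fun y => vectorLow n c u y j) := fun j =>
    (h₁ _ _ _ _ (hc j) (hu.mono_order (by omega))).mono_weight (by linarith)
  refine (HB.of_coord t1).mono (le_of_eq ?_)
  ring

/-- The perturbed linear system is satisfied by `(u, Z)` with data `(f, F)`. -/
def PerturbedSystem (n : ℕ) (a : Euc n → ℝ) (b : Fin n → Fin n → Euc n → ℝ)
    (c : Fin n → Euc n → ℝ) (f : Euc n → ℝ) (F : Euc n → Euc n) (u : Euc n → ℝ)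
    (Z : Euc n → Euc n) : Prop :=
  (∀ x, lap n u x + scalarLow n a b u Z x = f x) ∧
    (∀ x j, vLap n Z x j + vectorLow n c u x j = F x j)

theorem exists_seq_of_step {X : Type*} {P : ℕ → X → Prop} {R : X → X → Prop} {x₀ : X}
    (h₀ : P 0 x₀) (h : ∀ m x, P m x → ∃ y, P (m + 1) y ∧ R x y) :
    ∃ s : ℕ → X, s 0 = x₀ ∧ (∀ m, P m (s m)) ∧ ∀ m, R (s m) (s (m + 1)) := by
  choose! g hg using h
  let s : ∀ m : ℕ, {x // P m x} := fun m =>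
    Nat.rec ⟨x₀, h₀⟩ (fun m y => ⟨g m y.1, (hg m y.1 y.2).1⟩) m
  exact ⟨fun m => (s m).1, rfl, fun m => (s m).2, fun m => (hg m (s m).1 (s m).2).2⟩

theorem exists_perturbation (n q : ℕ) (hn : 3 ≤ n) {α ν : ℝ} (hα0 : 0 < α) (hα1 : α < 1)
    (hν0 : 0 < ν) (hν1 : ν < (n:ℝ) - 2) : ∃ ε : ℝ, 0 < ε ∧
    ∀ (a : Euc n → ℝ) (b : Fin n → Fin n → Euc n → ℝ) (c : Fin n → Euc n → ℝ),
      HB n (q + 1) α 2 ε a → (∀ i j, HB n (q + 1) α (ν / 2 + 1) ε (b i j)) →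
      (∀ j, HB n q α (ν / 2 + 2) ε (c j)) →
      (∀ (C : ℝ) (f : Euc n → ℝ) (F : Euc n → Euc n), HB n (q + 1) α (ν + 2) C f →
        HB n q α (ν / 2 + 2) C F → ∃ (C' : ℝ) (u : Euc n → ℝ) (Z : Euc n → Euc n),
          HB n (q + 3) α ν C' u ∧ HB n (q + 2) α (ν / 2) C' Z ∧ PerturbedSystem n a b c f F u Z) ∧
      (∀ (C : ℝ) (u : Euc n → ℝ) (Z : Euc n → Euc n), HB n (q + 3) α ν C u →
        HB n (q + 2) α (ν / 2) C Z → PerturbedSystem n a b c (fun _ => 0) (fun _ => 0) u Z →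
        u = 0 ∧ Z = 0) := by
  have hn1 : 1 ≤ n := by omega
  obtain ⟨G, hG⟩ := exists_laplace_solver n hn1
  obtain ⟨⟨K₁, hK₁, hGb⟩, hGsol, -⟩ := hG α ν hα0 hα1 hν0 hν1 (q + 1)
  obtain ⟨⟨K₂, hK₂, hV⟩, hVinj⟩ := exists_vLap_solver n hn hα0 hα1 (μ := ν / 2) (by linarith)
    (by linarith) q
  obtain ⟨M₁, hM₁, hB₁⟩ := exists_scalarLow_bound n q (α := α) (ν := ν)
  obtain ⟨M₂, hM₂, hB₂⟩ := exists_vectorLow_bound n q hn1 (α := α) hν0.le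
  set K := K₁ + K₂ with hK
  set M := M₁ + M₂ with hM
  have hK0 : 0 < K := by positivity
  have hM0 : 0 < M := by positivity
  -- the unperturbed operator is invertible
  have hsolve : ∀ (C : ℝ) (f : Euc n → ℝ) (F : Euc n → Euc n), HB n (q + 1) α (ν + 2) C f →
      HB n q α (ν / 2 + 2) C F → ∃ p : (Euc n → ℝ) × (Euc n → Euc n),
        (HB n (q + 3) α ν (K * C) p.1 ∧ HB n (q + 2) α (ν / 2) (K * C) p.2) ∧
        (∀ x, lap n p.1 x = f x) ∧ (∀ x j, vLap n p.2 x j = F x j) := by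
    intro C f F hf hF
    have hC := hf.nonneg
    obtain ⟨Z, hZ, hZe⟩ := hV C F hF
    exact ⟨(G f, Z), ⟨(hGb C f hf).mono (by rw [hK]; gcongr; linarith),
      hZ.mono (by rw [hK]; gcongr; linarith)⟩, hGsol C f hf, hZe⟩
  refine ⟨1 / (2 * K * M), by positivity, fun a b c ha hb hc => ?_⟩
  set ε := 1 / (2 * K * M) with hε
  have hε0 : 0 < ε := by positivity
  have hKM : K * (M * ε) = 1 / 2 := by rw [hε]; field_simp
  -- the correction step
  have hstep : ∀ (C : ℝ) (p : (Euc n → ℝ) × (Euc n → Euc n)),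
      HB n (q + 3) α ν C p.1 ∧ HB n (q + 2) α (ν / 2) C p.2 →
      ∃ p' : (Euc n → ℝ) × (Euc n → Euc n),
        (HB n (q + 3) α ν (C / 2) p'.1 ∧ HB n (q + 2) α (ν / 2) (C / 2) p'.2) ∧
        (∀ x, lap n p'.1 x = -scalarLow n a b p.1 p.2 x) ∧
        (∀ x j, vLap n p'.2 x j = -vectorLow n c p.1 x j) := by
    rintro C p ⟨hu, hZ⟩
    have hC := hu.nonneg
    have h1 : HB n (q + 1) α (ν + 2) (M * ε * C) (fun x => -scalarLow n a b p.1 p.2 x) :=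
      (hB₁ ε C a b p.1 p.2 ha hb hu hZ).neg.mono (by rw [hM]; gcongr; linarith)
    have h2 : HB n q α (ν / 2 + 2) (M * ε * C) (fun x => -vectorLow n c p.1 x) :=
      (hB₂ ε C c p.1 hc hu).neg.mono (by rw [hM]; gcongr; linarith)
    have e : K * (M * ε * C) = C / 2 := by linear_combination C * hKM
    obtain ⟨p', hp', h3, h4⟩ := hsolve _ _ _ h1 h2
    rw [e] at hp'
    exact ⟨p', hp', h3, h4⟩
  constructor
  · intro C f F hf hF
    have hC := hf.nonneg
    obtain ⟨p₀, hp₀, hlap₀, hvlap₀⟩ := hsolve C f F hf hF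
    obtain ⟨s, hs0, hs, hR⟩ := exists_seq_of_step
      (P := fun m (p : (Euc n → ℝ) × (Euc n → Euc n)) =>
        HB n (q + 3) α ν (K * C * (1 / 2) ^ m) p.1 ∧
        HB n (q + 2) α (ν / 2) (K * C * (1 / 2) ^ m) p.2)
      (R := fun p p' => (∀ x, lap n p'.1 x = -scalarLow n a b p.1 p.2 x) ∧
        (∀ x j, vLap n p'.2 x j = -vectorLow n c p.1 x j)) (x₀ := p₀)
      (by simpa using hp₀) (fun m p hp => by
        obtain ⟨p', h1, h2⟩ := hstep _ p hp
        refine ⟨p', ?_, h2⟩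
        rwa [show K * C * (1 / 2) ^ m / 2 = K * C * (1 / 2) ^ (m + 1) by ring] at h1)
    have hsum : Summable fun m : ℕ => K * C * (1 / 2 : ℝ) ^ m :=
      (summable_geometric_of_lt_one (by norm_num) (by norm_num)).mul_left _
    have hsu := fun m => (hs m).1
    have hsZ := fun m => (hs m).2
    set u : Euc n → ℝ := fun y => ∑' m, (s m).1 y with hu
    set Z : Euc n → Euc n := fun y => WithLp.toLp 2 fun j => ∑' m, (s m).2 y j with hZ
    have hZe : ∀ y j, Z y j = ∑' m, (s m).2 y j := fun y j => rfl
    have hS0 : 0 ≤ ∑' m : ℕ, K * C * (1 / 2 : ℝ) ^ m := tsum_nonneg fun m => by positivity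
    have hn1' : (1:ℝ) ≤ n := by exact_mod_cast hn1
    refine ⟨n * ∑' m : ℕ, K * C * (1 / 2 : ℝ) ^ m, u, Z, (HB.tsum hsu hsum hν0.le).mono ?_,
      HB.of_coord fun j => HB.tsum (fun m => (hsZ m).comp_coord j) hsum (by linarith),
      fun x => ?_, fun x j => ?_⟩
    · exact le_mul_of_one_le_left hS0 hn1'
    · have h1 := HB.hasSum_lap hsu hsum hν0.le x
      have h2 : HasSum (fun m => scalarLow n a b (s m).1 (s m).2 x) (scalarLow n a b u Z x) :=
        ((HB.hasSum hsu hsum hν0.le x).mul_left _).add (hasSum_sum fun i _ => hasSum_sum fun j _ =>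
          (HB.hasSum_confKill hZe hsZ hsum (by linarith) i j x).mul_left _)
      have h3 := (hasSum_nat_add_iff' 1).2 h1
      simp only [(hR _).1, Finset.range_one, Finset.sum_singleton, hs0, hlap₀] at h3
      have := h3.unique h2.neg
      linarith
    · have h1 := HB.hasSum_vLap hZe hsZ hsum (by linarith) j x
      have h2 : HasSum (fun m => vectorLow n c (s m).1 x j) (vectorLow n c u x j) :=
        (HB.hasSum hsu hsum hν0.le x).mul_left _
      have h3 := (hasSum_nat_add_iff' 1).2 h1
      simp only [(hR _).2, Finset.range_one, Finset.sum_singleton, hs0, hvlap₀] at h3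
      have := h3.unique h2.neg
      linarith
  · intro C u Z hu hZ ⟨he₁, he₂⟩
    have hhalf : ∀ C, HB n (q + 3) α ν C u ∧ HB n (q + 2) α (ν / 2) C Z →
        HB n (q + 3) α ν (C / 2) u ∧ HB n (q + 2) α (ν / 2) (C / 2) Z := by
      intro C hC
      obtain ⟨⟨u', Z'⟩, ⟨hu', hZ'⟩, h1, h2⟩ := hstep C (u, Z) hC
      have eu : u = u' := by
        ext x
        refine sub_eq_zero.1 (HB.eq_zero_of_lap_eq_zero hn1 (by omega) hν0 (hC.1.sub hu')
          (fun y => ?_) x)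
        rw [lap_sub (hC.1.contDiff_two (by omega)) (hu'.contDiff_two (by omega)), h1]
        linarith [he₁ y]
      have eZ : (fun x => Z x - Z' x) = 0 := by
        refine hVinj _ _ (hC.2.sub hZ') fun y j => ?_
        rw [vLap_sub (hC.2.1.of_le (by exact_mod_cast Nat.le_add_left _ _))
          (hZ'.1.of_le (by exact_mod_cast Nat.le_add_left _ _)), h2]
        have := he₂ y j
        simp only [PiLp.zero_apply] at this
        linarith
      have eZ' : Z = Z' := funext fun x => sub_eq_zero.1 (congrFun eZ x)
      rw [eu, eZ']
      exact ⟨hu', hZ'⟩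
    have hall : ∀ m : ℕ, HB n (q + 3) α ν (C * (1 / 2) ^ m) u ∧
        HB n (q + 2) α (ν / 2) (C * (1 / 2) ^ m) Z := by
      intro m
      induction m with
      | zero => simpa using ⟨hu, hZ⟩
      | succ m ih =>
        have := hhalf _ ih
        rwa [show C * (1 / 2) ^ m / 2 = C * (1 / 2) ^ (m + 1) by ring] at this
    have hlim : Tendsto (fun m : ℕ => C * (1 / 2 : ℝ) ^ m) atTop (𝓝 0) := by
      simpa using (tendsto_pow_atTop_nhds_zero_of_lt_one (r := (1 / 2 : ℝ)) (by norm_num)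
        (by norm_num)).const_mul C
    have hzero : ∀ {k : ℕ} {μ : ℝ} {v : Euc n → ℝ}, 0 ≤ μ →
        (∀ m : ℕ, HB n k α μ (C * (1 / 2) ^ m) v) → ∀ x, v x = 0 := by
      intro k μ v hμ hv x
      refine norm_le_zero_iff.1 (ge_of_tendsto' hlim fun m => ?_)
      have := (hv m).norm_iteratedFDeriv_le hμ (Nat.zero_le k) x
      rwa [norm_iteratedFDeriv_zero] at this
    constructor
    · ext x
      exact hzero hν0.le (fun m => (hall m).1) x
    · ext x j
      exact hzero (v := fun y => Z y j) (by linarith) (fun m => (hall m).2.comp_coord j) x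

end Perturbation

section Coefficients

variable {n : ℕ}

theorem HB.exists_mul_one_add_rpow {α ν : ℝ} (hα0 : 0 < α) (hα1 : α < 1) (hν : 0 ≤ ν) (k : ℕ)
    (μ p : ℝ) : ∃ K : ℝ, 0 < K ∧ ∀ (C D : ℝ) (ψ u : Euc n → ℝ), C ≤ 1 / 2 → HB n k α ν C ψ →
      HB n k α μ D u → HB n k α μ (K * D) (fun x => u x * (1 + ψ x) ^ p) := by
  obtain ⟨K₁, hK₁, h₁⟩ := HB.one_add_rpow (n := n) hα0 hα1.le hν k p
  obtain ⟨K₂, hK₂, h₂⟩ := HB.smul (n := n) (E := ℝ) k (α := α) μ 0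
  refine ⟨K₂ * K₁, by positivity, fun C D ψ u hC hψ hu => ?_⟩
  refine ((h₂ _ _ _ _ hu (h₁ C ψ hC hψ)).congr_weight (add_zero μ)).mono (le_of_eq ?_)
  ring

theorem HB.exists_mul_mul_one_add_rpow {α ν : ℝ} (hα0 : 0 < α) (hα1 : α < 1) (hν : 0 ≤ ν) (k : ℕ)
    (p : ℝ) : ∃ K : ℝ, 0 < K ∧ ∀ (C D : ℝ) (ψ u v : Euc n → ℝ), C ≤ 1 / 2 → D ≤ 1 →
      HB n k α ν C ψ → HB n k α (ν / 2 + 1) D u → HB n k α (ν / 2 + 1) D v →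
      HB n k α 2 (K * D) (fun x => u x * v x * (1 + ψ x) ^ p) := by
  obtain ⟨K₁, hK₁, h₁⟩ := HB.exists_mul_one_add_rpow (n := n) hα0 hα1 hν k 2 p
  obtain ⟨K₂, hK₂, h₂⟩ := HB.smul (n := n) (E := ℝ) k (α := α) (ν / 2 + 1) (ν / 2 + 1)
  refine ⟨K₁ * K₂, by positivity, fun C D ψ u v hC hD hψ hu hv => ?_⟩
  have h := (h₂ _ _ _ _ hu hv).mono_weight (μ' := 2) (by linarith)
  refine (h₁ C _ ψ _ hC hψ h).mono ?_
  have hD0 := hu.nonneg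
  rw [← mul_assoc]
  exact mul_le_mul_of_nonneg_left (mul_le_of_le_one_left hD0 hD) (by positivity)

theorem PerturbedSystem.sub {a : Euc n → ℝ} {b : Fin n → Fin n → Euc n → ℝ}
    {c : Fin n → Euc n → ℝ} {f : Euc n → ℝ} {F : Euc n → Euc n} {u u' : Euc n → ℝ}
    {Z Z' : Euc n → Euc n} (hu : ContDiff ℝ 2 u) (hu' : ContDiff ℝ 2 u') (hZ : ContDiff ℝ 2 Z)
    (hZ' : ContDiff ℝ 2 Z') (h : PerturbedSystem n a b c f F u Z)
    (h' : PerturbedSystem n a b c f F u' Z') :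
    PerturbedSystem n a b c (fun _ => 0) (fun _ => 0) (fun x => u x - u' x)
      (fun x => Z x - Z' x) := by
  refine ⟨fun x => ?_, fun x j => ?_⟩
  · have h1 := h.1 x
    have h2 := h'.1 x
    unfold scalarLow at *
    rw [lap_sub hu hu']
    simp_rw [confKill_sub (hZ.of_le one_le_two) (hZ'.of_le one_le_two), mul_sub,
      Finset.sum_sub_distrib]
    linear_combination h1 - h2
  · have h1 := h.2 x j
    have h2 := h'.2 x j
    rw [vLap_sub hZ hZ']
    simp only [vectorLow, PiLp.zero_apply] at *
    linear_combination h1 - h2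

theorem exists_small_coefficients (n q : ℕ) {α ν : ℝ} (hα0 : 0 < α) (hα1 : α < 1) (hν : 0 ≤ ν)
    (c₁ c₂ c₃ c₄ p₁ p₂ p₃ p₄ : ℝ) : ∃ Q : ℝ, 0 < Q ∧ ∀ (D : ℝ) (τ ψ : Euc n → ℝ)
      (S : Fin n → Fin n → Euc n → ℝ), D ≤ 1 / 2 → HB n (q + 1) α (ν / 2 + 1) D τ →
      HB n (q + 1) α ν D ψ → (∀ i j, HB n (q + 1) α (ν / 2 + 1) D (S i j)) →
      HB n (q + 1) α 2 (Q * D) (fun x => c₁ * (∑ i, ∑ j, S i j x ^ 2) * (1 + ψ x) ^ p₁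
        - c₂ * τ x ^ 2 * (1 + ψ x) ^ p₂) ∧
      (∀ i j, HB n (q + 1) α (ν / 2 + 1) (Q * D) (fun x => c₃ * (S i j x * (1 + ψ x) ^ p₃))) ∧
      (∀ j, HB n q α (ν / 2 + 2) (Q * D) (fun x => c₄ * (pder n τ j x * (1 + ψ x) ^ p₄))) := by
  obtain ⟨K₁, hK₁, h₁⟩ := HB.exists_mul_mul_one_add_rpow (n := n) hα0 hα1 hν (q + 1) p₁
  obtain ⟨K₂, hK₂, h₂⟩ := HB.exists_mul_mul_one_add_rpow (n := n) hα0 hα1 hν (q + 1) p₂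
  obtain ⟨K₃, hK₃, h₃⟩ := HB.exists_mul_one_add_rpow (n := n) hα0 hα1 hν (q + 1) (ν / 2 + 1) p₃
  obtain ⟨K₄, hK₄, h₄⟩ := HB.exists_mul_one_add_rpow (n := n) hα0 hα1 hν q (ν / 2 + 2) p₄
  set Q₁ := |c₁| * (n * (n * K₁)) + |c₂| * K₂ with hQ₁
  refine ⟨Q₁ + |c₃| * K₃ + |c₄| * K₄ + 1, by positivity, fun D τ ψ S hD hτ hψ hS => ?_⟩
  have hD0 := hτ.nonneg
  have hQ₁0 : 0 ≤ Q₁ := by positivity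
  have hQ₃ : 0 ≤ |c₃| * K₃ := by positivity
  have hQ₄ : 0 ≤ |c₄| * K₄ := by positivity
  refine ⟨?_, fun i j => ?_, fun j => ?_⟩
  · have t1 := (HB.sum Finset.univ fun i (_ : i ∈ (Finset.univ : Finset (Fin n))) =>
      HB.sum Finset.univ fun j (_ : j ∈ (Finset.univ : Finset (Fin n))) =>
        h₁ D D ψ _ _ hD (by linarith) hψ (hS i j) (hS i j)).const_smul c₁
    have t2 := (h₂ D D ψ _ _ hD (by linarith) hψ hτ hτ).const_smul c₂
    have e : (fun x => c₁ * (∑ i, ∑ j, S i j x ^ 2) * (1 + ψ x) ^ p₁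
        - c₂ * τ x ^ 2 * (1 + ψ x) ^ p₂) = fun x =>
        c₁ • (∑ i, ∑ j, S i j x * S i j x * (1 + ψ x) ^ p₁)
          - c₂ • (τ x * τ x * (1 + ψ x) ^ p₂) := by
      ext x
      simp only [smul_eq_mul, ← Finset.sum_mul, sq]
      ring
    rw [e]
    refine (t1.sub t2).mono ?_
    simp only [Finset.sum_const, Finset.card_univ, Fintype.card_fin, nsmul_eq_mul]
    have : |c₁| * (n * (n * (K₁ * D))) + |c₂| * (K₂ * D) = Q₁ * D := by rw [hQ₁]; ring
    rw [this]
    gcongr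
    linarith
  · refine ((h₃ D D ψ _ hD hψ (hS i j)).const_smul c₃).mono ?_
    rw [← mul_assoc]
    gcongr
    linarith
  · have hτ' : HB n q α (ν / 2 + 2) D (fun y => pder n τ j y) :=
      (hτ.pder j).congr_weight (by ring)
    refine ((h₄ D D ψ _ hD (hψ.mono_order (Nat.le_succ q)) hτ').const_smul c₄).mono ?_
    rw [← mul_assoc]
    gcongr
    linarith

end Coefficients

/-- Proposition 2 of the paper. For `δ > 0` sufficiently small, any
solution `(φ, W, τ)` of the flat-background conformally formulated vacuum constraint
system with `φ = 1 + ψ`, where `τ ∈ C^{k,α}_{−ν/2−1}`, `ψ ∈ C^{k+2,α}_{−ν}` and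
`W ∈ C^{k+1,α}_{−ν/2}` all have norm `< δ`, is nondegenerate: the linearization `𝓛` of
the system at `(φ, W)` in the `(φ, W)` directions is an isomorphism from
`C^{k+2,α}_{−ν} × C^{k+1,α}_{−ν/2}` onto `C^{k,α}_{−ν−2} × C^{k−1,α}_{−ν/2−2}`
(stated here as: every target pair `(f, F)` has a unique preimage `(ψ', Z)`). -/
theorem nondegeneracy_of_small_solutions
    (n k : ℕ) (α ν : ℝ) (hn : 3 ≤ n) (hk : 1 ≤ k)
    (hα0 : 0 < α) (hα1 : α < 1) (hν0 : 0 < ν) (hν1 : ν < (n:ℝ) - 2) :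
    ∃ δ : ℝ, 0 < δ ∧
      ∀ (τ ψ : Euc n → ℝ) (W : Euc n → Euc n),
        (∃ Cτ : ℝ, Cτ < δ ∧ WBound n k α (ν/2 + 1) Cτ τ) →
        (∃ Cψ : ℝ, Cψ < δ ∧ WBound n (k+2) α ν Cψ ψ) →
        (∃ CW : ℝ, CW < δ ∧ WBound n (k+1) α (ν/2) CW W) →
        (∀ x : Euc n, 0 < 1 + ψ x) →
        VacuumSystem n (fun x => 1 + ψ x) W τ →
        ∀ (f : Euc n → ℝ) (F : Euc n → Euc n),
          MemW n k α (ν+2) f → MemW n (k-1) α (ν/2 + 2) F →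
          ∃! p : (Euc n → ℝ) × (Euc n → Euc n),
            MemW n (k+2) α ν p.1 ∧ MemW n (k+1) α (ν/2) p.2 ∧
            (∀ x : Euc n,
              lap n p.1 x
              + ((-3*(n:ℝ)+2)/((n:ℝ)-2)) * (((n:ℝ)-2)/(4*((n:ℝ)-1)))
                  * (∑ j, ∑ k', (confKill n W x j k')^2)
                  * (1 + ψ x) ^ ((-3*(n:ℝ)+2)/((n:ℝ)-2) - 1) * p.1 x
              - (((n:ℝ)+2)/((n:ℝ)-2)) * (((n:ℝ)-2)/(4*(n:ℝ))) * (τ x)^2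
                  * (1 + ψ x) ^ (((n:ℝ)+2)/((n:ℝ)-2) - 1) * p.1 x
              + 2 * (((n:ℝ)-2)/(4*((n:ℝ)-1)))
                  * (∑ j, ∑ k', confKill n W x j k' * confKill n p.2 x j k')
                  * (1 + ψ x) ^ ((-3*(n:ℝ)+2)/((n:ℝ)-2)) = f x) ∧
            (∀ (x : Euc n) (j : Fin n),
              vLap n p.2 x j
              + (((n:ℝ)-1)/(n:ℝ)) * ((2*(n:ℝ))/((n:ℝ)-2))
                  * (1 + ψ x) ^ ((2*(n:ℝ))/((n:ℝ)-2) - 1) * p.1 x * pder n τ j x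
              = F x j) := by
  obtain ⟨q, rfl⟩ : ∃ q, k = q + 1 := ⟨k - 1, by omega⟩
  obtain ⟨ε, hε, hpert⟩ := exists_perturbation n q hn hα0 hα1 hν0 hν1
  obtain ⟨Q, hQ, hcoef⟩ := exists_small_coefficients n q hα0 hα1 hν0.le
    (((-3*(n:ℝ)+2)/((n:ℝ)-2)) * (((n:ℝ)-2)/(4*((n:ℝ)-1))))
    ((((n:ℝ)+2)/((n:ℝ)-2)) * (((n:ℝ)-2)/(4*(n:ℝ))))
    (2 * (((n:ℝ)-2)/(4*((n:ℝ)-1))))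
    ((((n:ℝ)-1)/(n:ℝ)) * ((2*(n:ℝ))/((n:ℝ)-2)))
    ((-3*(n:ℝ)+2)/((n:ℝ)-2) - 1) (((n:ℝ)+2)/((n:ℝ)-2) - 1)
    ((-3*(n:ℝ)+2)/((n:ℝ)-2)) ((2*(n:ℝ))/((n:ℝ)-2) - 1)
  obtain ⟨Kτ, hKτ, hτHB⟩ := WBound.hB (n := n) (E := ℝ) (q + 1) (ν / 2 + 1) hα0 hα1.le
  obtain ⟨Kψ, hKψ, hψHB⟩ := WBound.hB (n := n) (E := ℝ) (q + 3) ν hα0 hα1.le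
  obtain ⟨KW, hKW, hWHB⟩ := WBound.hB (n := n) (E := Euc n) (q + 2) (ν / 2) hα0 hα1.le
  obtain ⟨Kf, hKf, hfHB⟩ := WBound.hB (n := n) (E := ℝ) (q + 1) (ν + 2) hα0 hα1.le
  obtain ⟨KF, hKF, hFHB⟩ := WBound.hB (n := n) (E := Euc n) q (ν / 2 + 2) hα0 hα1.le
  obtain ⟨Ku, hKu, huWB⟩ := HB.wBound (n := n) (E := ℝ) (q + 3) ν hα0 hα1.le
  obtain ⟨KZ, hKZ, hZWB⟩ := HB.wBound (n := n) (E := Euc n) (q + 2) (ν / 2) hα0 hα1.le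
  set L := Kτ + Kψ + (1 + n) * KW with hL
  have hL0 : 0 < L := by positivity
  have hnKW : 0 ≤ (1 + n) * KW := by positivity
  set D := min (1 / 2) (ε / Q) with hD
  have hD0 : 0 < D := by positivity
  have hDε : Q * D ≤ ε := by
    calc Q * D ≤ Q * (ε / Q) := by gcongr; exact min_le_right _ _
      _ = ε := by field_simp
  refine ⟨D / L, by positivity, ?_⟩
  rintro τ ψ W ⟨Cτ, hCτ, hτ⟩ ⟨Cψ, hCψ, hψ⟩ ⟨CW, hCW, hW⟩ - - f F ⟨Cf, hf⟩ ⟨CF, hF⟩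
  have hsmall : ∀ {K C : ℝ}, 0 < K → K ≤ L → C < D / L → K * C ≤ D := by
    intro K C hK hKL hC
    calc K * C ≤ K * (D / L) := by gcongr
      _ ≤ L * (D / L) := by gcongr
      _ = D := by field_simp
  obtain ⟨ha, hb, hc⟩ := hcoef D τ ψ (fun i j x => confKill n W x i j) (min_le_left _ _)
    ((hτHB Cτ τ hτ).mono (hsmall hKτ (by linarith) hCτ))
    (((hψHB Cψ ψ hψ).mono (hsmall hKψ (by linarith) hCψ)).mono_order (by omega))
    (fun i j => ((hWHB CW W hW).confKill i j).mono (by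
      rw [← mul_assoc]
      exact hsmall (by positivity) (by linarith) hCW))
  obtain ⟨hex, huniq⟩ := hpert _ _ _ (ha.mono hDε) (fun i j => (hb i j).mono hDε)
    (fun j => (hc j).mono hDε)
  have hsum : ∀ (c r : ℝ) (Z : Euc n → Euc n) (x : Euc n),
      ∑ i, ∑ j, c * (confKill n W x i j * r) * confKill n Z x i j
        = c * (∑ i, ∑ j, confKill n W x i j * confKill n Z x i j) * r := by
    intro c r Z x
    simp only [Finset.mul_sum, Finset.sum_mul]
    exact Finset.sum_congr rfl fun i _ => Finset.sum_congr rfl fun j _ => by ring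
  have hf' := (hfHB Cf f hf).mono (le_max_left _ (KF * CF))
  have hF' := (hFHB CF F hF).mono (le_max_right (Kf * Cf) _)
  obtain ⟨C', u, Z, hu, hZ, hsys₁, hsys₂⟩ := hex _ f F hf' hF'
  refine ⟨(u, Z), ⟨⟨_, huWB C' u hu⟩, ⟨_, hZWB C' Z hZ⟩, fun x => ?_, fun x j => ?_⟩, ?_⟩
  · have h := hsys₁ x
    rw [scalarLow, hsum] at h
    linear_combination h
  · have h := hsys₂ x j
    simp only [vectorLow] at h
    linear_combination h
  · rintro ⟨u', Z'⟩ ⟨⟨Cu', hu'⟩, ⟨CZ', hZ'⟩, h₁, h₂⟩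
    have hu'' := hψHB Cu' u' hu'
    have hZ'' := hWHB CZ' Z' hZ'
    have hdu := hu''.sub hu
    have hdZ := hZ''.sub hZ
    have hsys := PerturbedSystem.sub (hu''.contDiff_two (by omega)) (hu.contDiff_two (by omega))
      (hZ''.1.of_le (by exact_mod_cast Nat.le_add_left _ _))
      (hZ.1.of_le (by exact_mod_cast Nat.le_add_left _ _))
      ⟨fun x => by
        have h := h₁ x
        rw [scalarLow, hsum]
        linear_combination h, fun x j => by
        have h := h₂ x j
        simp only [vectorLow]
        linear_combination h⟩ ⟨hsys₁, hsys₂⟩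
    obtain ⟨e₁, e₂⟩ := huniq _ _ _ (hdu.mono (le_max_left _ (KW * CZ' + C')))
      (hdZ.mono (le_max_right (Kψ * Cu' + C') _)) hsys
    exact Prod.ext (funext fun x => sub_eq_zero.1 (congrFun e₁ x))
      (funext fun x => sub_eq_zero.1 (congrFun e₂ x))
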